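/- arXiv:0912.5472 — 3 statements merged into one kernel-verified Lean document; each statement's English description precedes it below -/
import Mathlib

section
/- Under the hypotheses of the Proposition (dim g > 4, K and Φ satisfying (i) and (ii)) together with the condition Tr(K_Z ∘ ad_U) = 0 for all Z,U ∈ g, if the rank of g is at least 3, then Φ(X,Y) = 0 and K_X Y = 0 for all X, Y ∈ g. -/
open LieAlgebra

/-- The inner product `⟨X,Y⟩ = -κ(X,Y)`, the negative of the Killing form. -/
noncomputable def ip (R : Type*) (g : Type*) [CommRing R] [LieRing g] [LieAlgebra R g]
    (X Y : g) : R :=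
  - killingForm R g X Y

/-- The endomorphism `X ∧ Y : Z ↦ ⟨X,Z⟩Y - ⟨Y,Z⟩X`, where `⟨·,·⟩ = -κ(·,·)`. -/
noncomputable def wedge (R : Type*) (g : Type*) [CommRing R] [LieRing g] [LieAlgebra R g]
    (X Y : g) : Module.End R g :=
  (-(killingForm R g X)).smulRight Y - (-(killingForm R g Y)).smulRight X

section CasimirFrame

variable {g ι : Type*} [LieRing g] [LieAlgebra ℝ g] [Fintype ι]

/-- `e` is an orthonormal basis for the invariant inner product `B`, normalized so that the
Casimir element `∑ ad(e i)²` acts as `-1`. -/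
structure CasimirFrame (B : LinearMap.BilinForm ℝ g) (e : ι → g) : Prop where
  symm : ∀ x y, B x y = B y x
  lie_left : ∀ x y z : g, B ⁅x, y⁆ z = -B y ⁅x, z⁆
  pos : ∀ x, x ≠ 0 → 0 < B x x
  unit : ∀ i, B (e i) (e i) = 1
  expand : ∀ x, ∑ i, B x (e i) • e i = x
  casimir : ∀ x : g, ∑ i, ⁅e i, ⁅e i, x⁆⁆ = -x

namespace CasimirFrame

variable {B : LinearMap.BilinForm ℝ g} {e : ι → g}

lemma eq_of_forall (F : CasimirFrame B e) {x y : g} (h : ∀ z, B x z = B y z) : x = y := by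
  by_contra hne
  have := F.pos (x - y) (sub_ne_zero.2 hne)
  rw [map_sub B, LinearMap.sub_apply, h, sub_self] at this
  exact this.false

lemma nonneg (F : CasimirFrame B e) (x : g) : 0 ≤ B x x := by
  rcases eq_or_ne x 0 with rfl | hx
  · simp
  · exact (F.pos x hx).le

lemma two_mul_le (F : CasimirFrame B e) (x y : g) : 2 * B x y ≤ B x x + B y y := by
  have := F.nonneg (x - y)
  simp only [map_sub, LinearMap.sub_apply, F.symm y x] at this
  linarith

lemma sum_expand (F : CasimirFrame B e) (x : g) (f : g → ℝ) (hf : IsLinearMap ℝ f := by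
      constructor <;> intros <;> simp only [map_add, LinearMap.add_apply, map_smul,
        LinearMap.smul_apply, smul_eq_mul, lie_add, add_lie, smul_lie, lie_smul] <;> ring) :
    ∑ i, B x (e i) * f (e i) = f x := by
  conv_rhs => rw [← F.expand x]
  change _ = hf.mk' f _
  simp

lemma sum_swap (F : CasimirFrame B e) (u : g) (f : g → g → ℝ)
    (hl : ∀ y, IsLinearMap ℝ (fun x => f x y) := by
      intro _; constructor <;> intros <;> simp only [map_add, LinearMap.add_apply, map_smul,
        LinearMap.smul_apply, smul_eq_mul, lie_add, add_lie, smul_lie, lie_smul] <;> ring)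
    (hr : ∀ x, IsLinearMap ℝ (f x) := by
      intro _; constructor <;> intros <;> simp only [map_add, LinearMap.add_apply, map_smul,
        LinearMap.smul_apply, smul_eq_mul, lie_add, add_lie, smul_lie, lie_smul] <;> ring) :
    ∑ i, f ⁅u, e i⁆ (e i) = -∑ i, f (e i) ⁅u, e i⁆ := by
  have h1 : ∀ i, f ⁅u, e i⁆ (e i) = ∑ j, B ⁅u, e i⁆ (e j) * f (e j) (e i) := fun i =>
    (F.sum_expand _ (fun x => f x (e i)) (hl _)).symm
  have h2 : ∀ i, f (e i) ⁅u, e i⁆ = ∑ j, B ⁅u, e i⁆ (e j) * f (e i) (e j) := fun i =>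
    (F.sum_expand _ (f (e i)) (hr _)).symm
  simp only [h1, h2]
  rw [Finset.sum_comm, ← Finset.sum_neg_distrib]
  refine Finset.sum_congr rfl fun i _ => ?_
  rw [← Finset.sum_neg_distrib]
  refine Finset.sum_congr rfl fun j _ => ?_
  rw [F.lie_left, F.symm]
  ring

lemma sum_casimir (F : CasimirFrame B e) (x : g) (f : g → ℝ) (hf : IsLinearMap ℝ f := by
      constructor <;> intros <;> simp only [map_add, LinearMap.add_apply, map_smul,
        LinearMap.smul_apply, smul_eq_mul, lie_add, add_lie, smul_lie, lie_smul] <;> ring) :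
    ∑ i, f ⁅e i, ⁅e i, x⁆⁆ = -f x := by
  change ∑ i, hf.mk' f _ = -hf.mk' f _
  rw [← map_sum, F.casimir, map_neg]

lemma sum_lie_lie (F : CasimirFrame B e) (x y : g) : ∑ i, B ⁅e i, x⁆ ⁅e i, y⁆ = B x y := by
  have := F.sum_casimir y (fun z => B x z)
  simp only [F.lie_left, Finset.sum_neg_distrib, this, neg_neg]

lemma sum_lie_lie' (F : CasimirFrame B e) (x y : g) : ∑ i, B ⁅x, e i⁆ ⁅y, e i⁆ = B x y := by
  rw [← F.sum_lie_lie x y]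
  refine Finset.sum_congr rfl fun i _ => ?_
  rw [← lie_skew x, ← lie_skew y]
  simp only [map_neg, LinearMap.neg_apply, neg_neg]

/-- The set of commuting members of an orthonormal frame has at most a third of its size. -/
lemma three_mul_card_le (F : CasimirFrame B e) (s : Finset ι)
    (hs : ∀ i ∈ s, ∀ j ∈ s, ⁅e i, e j⁆ = 0) :
    3 * s.card ≤ Fintype.card ι := by
  classical
  set c : ι → ι → ι → ℝ := fun i j k => B ⁅e i, e j⁆ (e k) ^ 2 with hc
  have c_swap : ∀ i j k, c i j k = c j i k := fun i j k => by
    simp only [hc]; rw [← lie_skew]; simp only [map_neg, LinearMap.neg_apply, neg_sq]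
  have c_rot : ∀ i j k, c i j k = c i k j := fun i j k => by
    simp only [hc]; rw [F.lie_left, F.symm]; simp
  have c_zero : ∀ i, ∀ j ∈ s, ∀ k ∈ s, c i j k = 0 := fun i j hj k hk => by
    rw [c_swap, c_rot]; simp [hc, hs j hj k hk]
  have c_sum : ∀ i, ∑ j, ∑ k, c i j k = 1 := fun i => by
    rw [← F.unit i, ← F.sum_lie_lie']
    refine Finset.sum_congr rfl fun j _ => ?_
    rw [← F.sum_expand ⁅e i, e j⁆ (fun x => B ⁅e i, e j⁆ x)]
    simp [hc, sq]
  have c_nonneg : ∀ i j k, 0 ≤ c i j k := fun i j k => sq_nonneg _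
  have hsplit : ∀ f : ι → ℝ, ∑ i, f i = ∑ i ∈ s, f i + ∑ i ∈ sᶜ, f i := fun f =>
    (Finset.sum_add_sum_compl s f).symm
  have h1 : ∀ j ∈ s, ∑ i ∈ sᶜ, ∑ k ∈ sᶜ, c i j k = 1 := fun j hj => by
    rw [← c_sum j, hsplit]
    have : ∑ i ∈ s, ∑ k, c j i k = 0 := Finset.sum_eq_zero fun i hi =>
      Finset.sum_eq_zero fun k _ => by rw [c_rot, c_swap, c_rot]; rw [c_zero k i hi j hj]
    rw [this, zero_add]
    refine Finset.sum_congr rfl fun i _ => ?_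
    rw [hsplit, Finset.sum_eq_zero (s := s), zero_add]
    · exact Finset.sum_congr rfl fun k _ => c_swap _ _ _
    · intro k hk; rw [c_swap, c_zero i j hj k hk]
  have h2 : ∀ i, 2 * ∑ j ∈ s, ∑ k ∈ sᶜ, c i j k ≤ 1 := fun i => by
    rw [← c_sum i, hsplit]
    have a1 : ∑ j ∈ s, ∑ k ∈ sᶜ, c i j k ≤ ∑ j ∈ s, ∑ k, c i j k :=
      Finset.sum_le_sum fun j _ =>
        Finset.sum_le_sum_of_subset_of_nonneg (Finset.subset_univ _) fun _ _ _ => c_nonneg _ _ _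
    have a2 : ∑ j ∈ s, ∑ k ∈ sᶜ, c i j k ≤ ∑ j ∈ sᶜ, ∑ k, c i j k := by
      rw [Finset.sum_comm]
      refine Finset.sum_le_sum fun j _ => ?_
      simp_rw [c_rot i _ j]
      exact Finset.sum_le_sum_of_subset_of_nonneg (Finset.subset_univ _)
        fun _ _ _ => c_nonneg _ _ _
    linarith
  have h3 : ∑ i ∈ sᶜ, ∑ j ∈ s, ∑ k ∈ sᶜ, c i j k = s.card := by
    rw [Finset.sum_comm, Finset.sum_congr rfl h1]; simp
  have h4 : 2 * ∑ i ∈ sᶜ, ∑ j ∈ s, ∑ k ∈ sᶜ, c i j k ≤ (sᶜ.card : ℝ) := by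
    rw [Finset.mul_sum]
    exact (Finset.sum_le_sum fun i _ => h2 i).trans (by simp)
  rw [h3] at h4
  have h5 : 2 * s.card ≤ sᶜ.card := by exact_mod_cast h4
  have := Finset.card_add_card_compl s
  omega

/-- An alternating map `T` for which `ad ∘ T` satisfies the first Bianchi identity factors through
the bracket. -/
lemma exists_eq_apply_lie (F : CasimirFrame B e) (T : g →ₗ[ℝ] g →ₗ[ℝ] g)
    (halt : ∀ x y, T y x = -T x y)
    (hT : ∀ x y z, ⁅T x y, z⁆ + ⁅T y z, x⁆ + ⁅T z x, y⁆ = 0) :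
    ∃ L : g →ₗ[ℝ] g, (∀ x y, B (L x) y = B x (L y)) ∧ ∀ x y, T x y = L ⁅x, y⁆ := by
  have bianchi : ∀ x y z w,
      B (T x y) ⁅z, w⁆ + B (T y z) ⁅x, w⁆ + B (T z x) ⁅y, w⁆ = 0 := fun x y z w => by
    have h := congrArg (fun v => B v w) (hT x y z)
    simp only [map_add, LinearMap.add_apply, map_zero, LinearMap.zero_apply] at h
    rw [← lie_skew, ← lie_skew (T y z), ← lie_skew (T z x)] at h
    simpa only [map_neg, LinearMap.neg_apply, F.lie_left, neg_neg] using h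
  have anti₁ : ∀ x y z w : g, B (T y x) ⁅z, w⁆ = -B (T x y) ⁅z, w⁆ := fun x y z w => by
    rw [halt x y]; simp only [map_neg, LinearMap.neg_apply]
  have anti₂ : ∀ x y z w : g, B (T x y) ⁅w, z⁆ = -B (T x y) ⁅z, w⁆ := fun x y z w => by
    rw [← lie_skew]; simp only [map_neg]
  have pair : ∀ x y z w : g, B (T x y) ⁅z, w⁆ = B (T z w) ⁅x, y⁆ := fun x y z w => by
    linarith [bianchi x y z w, bianchi y z w x, bianchi z w x y, bianchi w x y z,
      anti₂ y z x w, anti₂ z w x y, anti₁ x z y w, anti₂ x z y w, anti₂ w x y z,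
      anti₂ x y z w, anti₁ w y z x, anti₂ w y z x, anti₂ y w z x]
  have hL_apply : ∀ p, (-∑ i, T (e i) ∘ₗ (ad ℝ g (e i) : g →ₗ[ℝ] g)) p
      = -∑ i, T (e i) ⁅e i, p⁆ := fun p => by simp
  generalize (-∑ i, T (e i) ∘ₗ (ad ℝ g (e i) : g →ₗ[ℝ] g)) = L at hL_apply
  have hL : ∀ p z w : g, B (L p) ⁅z, w⁆ = B (T z w) p := fun p z w => by
    have := F.sum_casimir p (fun v => B (T z w) v)
    simp only [hL_apply, map_neg, map_sum, LinearMap.neg_apply, LinearMap.sum_apply,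
      pair _ _ z w, this, neg_neg]
  have hsymm : ∀ x y, B (L x) y = B (L y) x := fun x y => by
    have := F.sum_casimir y (fun v => B (L x) v)
    simp only [hL] at this
    rw [← neg_neg (B (L x) y), ← this, hL_apply y]
    simp only [map_neg, map_sum, LinearMap.neg_apply, LinearMap.sum_apply]
  refine ⟨L, fun x y => by rw [hsymm, F.symm], fun x y => F.eq_of_forall fun z => ?_⟩
  rw [hsymm, hL]

/-- A symmetric map for which `ad ∘ L` composed with the bracket satisfies the first Bianchi
identity differs from a map with vanishing cyclic sum by an intertwiner. -/
lemma exists_intertwiner (F : CasimirFrame B e) (L : g →ₗ[ℝ] g)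
    (hsymm : ∀ x y, B (L x) y = B x (L y))
    (hL : ∀ x y z : g, ⁅L ⁅x, y⁆, z⁆ + ⁅L ⁅y, z⁆, x⁆ + ⁅L ⁅z, x⁆, y⁆ = 0) :
    ∃ P : g →ₗ[ℝ] g, (∀ x y, B (P x) y = B x (P y)) ∧ (∀ x y : g, P ⁅x, y⁆ = ⁅x, P y⁆) ∧
      (∑ i, B (P (e i)) (e i) = 3 * ∑ i, B (L (e i)) (e i)) ∧
      ∀ x y z : g, B (L x) ⁅y, z⁆ + B (L y) ⁅z, x⁆ + B (L z) ⁅x, y⁆ = B (P x) ⁅y, z⁆ := by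
  have bianchi : ∀ x y z w : g,
      B (L ⁅x, y⁆) ⁅z, w⁆ + B (L ⁅y, z⁆) ⁅x, w⁆ + B (L ⁅z, x⁆) ⁅y, w⁆ = 0 := fun x y z w => by
    have h := congrArg (fun v => B v w) (hL x y z)
    simp only [map_add, LinearMap.add_apply, map_zero, LinearMap.zero_apply] at h
    rw [← lie_skew, ← lie_skew (L ⁅y, z⁆), ← lie_skew (L ⁅z, x⁆)] at h
    simpa only [map_neg, LinearMap.neg_apply, F.lie_left, neg_neg] using h
  set τ : g → g → g → ℝ := fun a b c => ∑ i, B (L ⁅a, e i⁆) ⁅b, ⁅c, e i⁆⁆ with hτ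
  have τ_anti : ∀ x y q, τ x y q = -τ y x q := fun x y q => by
    have := F.sum_swap q (fun u v => B (L ⁅x, v⁆) ⁅y, u⁆)
    simp only [hτ, this]
    congr 1
    refine Finset.sum_congr rfl fun i _ => ?_
    rw [hsymm, F.symm]
  have τ_eq : ∀ x y q : g, B (L ⁅x, y⁆) q = 2 * τ x y q := fun x y q => by
    have h := Finset.sum_eq_zero fun i (_ : i ∈ Finset.univ) => bianchi x y (e i) ⁅e i, q⁆
    have h1 := F.sum_casimir q (fun v => B (L ⁅x, y⁆) v)
    have h2 : ∑ i, B (L ⁅y, e i⁆) ⁅x, ⁅e i, q⁆⁆ = -τ y x q := by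
      rw [hτ, ← Finset.sum_neg_distrib]
      refine Finset.sum_congr rfl fun i _ => ?_
      rw [← lie_skew (e i) q]; simp only [map_neg, lie_neg]
    have h3 : ∑ i, B (L ⁅e i, x⁆) ⁅y, ⁅e i, q⁆⁆ = τ x y q := by
      refine Finset.sum_congr rfl fun i _ => ?_
      rw [← lie_skew (e i) q, ← lie_skew (e i) x]
      simp only [map_neg, lie_neg, LinearMap.neg_apply, neg_neg]
    simp only [Finset.sum_add_distrib] at h
    linarith [τ_anti x y q]
  set R : g → g → ℝ := fun x y => ∑ i, B (L ⁅x, e i⁆) ⁅y, e i⁆ with hR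
  have τ_jacobi : ∀ x y q : g, τ x y q - τ x q y = R x ⁅y, q⁆ := fun x y q => by
    simp only [hτ, hR, ← Finset.sum_sub_distrib]
    refine Finset.sum_congr rfl fun i _ => ?_
    rw [lie_lie, map_sub]
  have hP_apply : ∀ x, (L - (2 : ℝ) • ∑ i, (ad ℝ g (e i) : g →ₗ[ℝ] g) ∘ₗ L ∘ₗ
      (ad ℝ g (e i) : g →ₗ[ℝ] g)) x = L x - (2 : ℝ) • ∑ i, ⁅e i, L ⁅e i, x⁆⁆ := fun x => by simp
  generalize (L - (2 : ℝ) • ∑ i, (ad ℝ g (e i) : g →ₗ[ℝ] g) ∘ₗ L ∘ₗ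
      (ad ℝ g (e i) : g →ₗ[ℝ] g)) = P at hP_apply
  have hP : ∀ x y, B (P x) y = B (L x) y + 2 * R x y := fun x y => by
    simp only [hP_apply, map_sub, map_smul, map_sum, LinearMap.sub_apply, LinearMap.smul_apply,
      LinearMap.sum_apply, smul_eq_mul, F.lie_left, Finset.sum_neg_distrib, hR]
    rw [mul_neg, sub_neg_eq_add]
    congr 2
    refine Finset.sum_congr rfl fun i _ => ?_
    rw [← lie_skew x, ← lie_skew y]
    simp only [map_neg, LinearMap.neg_apply, neg_neg]
  have hP_symm : ∀ x y, B (P x) y = B x (P y) := fun x y => by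
    rw [F.symm x, hP, hP, hsymm, F.symm]
    congr 2
    refine Finset.sum_congr rfl fun i _ => ?_
    rw [hsymm, F.symm]
  have hP_cyc : ∀ x y z : g, B (L x) ⁅y, z⁆ + B (L y) ⁅z, x⁆ + B (L z) ⁅x, y⁆ = B (P x) ⁅y, z⁆ :=
    fun x y z => by
    have h1 := τ_eq x y z
    have h2 := τ_eq x z y
    rw [hsymm, F.symm] at h1 h2
    rw [← lie_skew, map_neg] at h2
    rw [hP]
    linarith [τ_jacobi x y z]
  refine ⟨P, hP_symm, fun x y => F.eq_of_forall fun z => ?_, ?_, hP_cyc⟩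
  · have h1 := hP_cyc z x y
    have h2 := hP_cyc y z x
    rw [F.lie_left, hP_symm, F.symm]
    simp only [← lie_skew z x, map_neg] at h1 h2
    linarith
  · have h1 : ∀ j, R (e j) (e j) = -∑ i, B (L (e i)) ⁅e j, ⁅e j, e i⁆⁆ := fun j =>
      F.sum_swap (e j) (fun u v => B (L u) ⁅e j, v⁆)
    have h2 : ∑ j, R (e j) (e j) = ∑ i, B (L (e i)) (e i) := by
      simp only [h1, Finset.sum_neg_distrib]
      rw [Finset.sum_comm, ← Finset.sum_neg_distrib]
      refine Finset.sum_congr rfl fun i _ => ?_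
      have := F.sum_casimir (e i) (fun v => B (L (e i)) v)
      simp only [this, neg_neg]
    simp only [hP, Finset.sum_add_distrib, ← Finset.mul_sum, h2]
    ring

lemma sum_apply_lie_eq_zero (F : CasimirFrame B e) {Ψ : g →ₗ[ℝ] g →ₗ[ℝ] g}
    (halt : ∀ x y, Ψ y x = -Ψ x y)
    (hcyc : ∀ x y z, B (Ψ x y) z + B (Ψ y z) x + B (Ψ z x) y = 0)
    (htr : ∀ u z : g, ∑ i, B (Ψ ⁅u, e i⁆ (e i)) z = 0) (u a : g) :
    ∑ i, B (Ψ u ⁅a, e i⁆) (e i) = 0 := by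
  have h := Finset.sum_eq_zero fun i (_ : i ∈ Finset.univ) => hcyc u ⁅a, e i⁆ (e i)
  have h1 := F.sum_swap a (fun x y => B (Ψ x u) y)
  simp only [halt u, map_neg, LinearMap.neg_apply, Finset.sum_neg_distrib, neg_neg] at h1
  simp only [halt u (e _), map_neg, LinearMap.neg_apply, Finset.sum_add_distrib,
    Finset.sum_neg_distrib, htr] at h
  linarith

lemma sum_lie_lie_apply_eq_zero (F : CasimirFrame B e) {Ψ : g →ₗ[ℝ] g →ₗ[ℝ] g}
    (halt : ∀ x y, Ψ y x = -Ψ x y)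
    (htr : ∀ u z : g, ∑ i, B (Ψ ⁅u, e i⁆ (e i)) z = 0) (u y x : g) :
    ∑ i, B (Ψ ⁅u, ⁅y, e i⁆⁆ (e i)) x = 0 := by
  have h1 := F.sum_swap y (fun v w => B (Ψ ⁅u, v⁆ w) x)
  have h2 := F.sum_swap u (fun v w => B (Ψ ⁅y, v⁆ w) x)
  have h3 : ∑ i, B (Ψ ⁅u, e i⁆ ⁅y, e i⁆) x = -∑ i, B (Ψ ⁅y, e i⁆ ⁅u, e i⁆) x := by
    simp only [halt ⁅y, e _⁆, map_neg, LinearMap.neg_apply, Finset.sum_neg_distrib]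
  have h4 := htr ⁅u, y⁆ x
  simp only [lie_lie, map_sub, LinearMap.sub_apply, Finset.sum_sub_distrib] at h4
  linarith

/-- The Ricci-type contraction of the second Bianchi identity. -/
lemma contracted_bianchi (F : CasimirFrame B e) {Ψ Φ : g →ₗ[ℝ] g →ₗ[ℝ] g}
    (halt : ∀ x y, Ψ y x = -Ψ x y)
    (hcyc : ∀ x y z, B (Ψ x y) z + B (Ψ y z) x + B (Ψ z x) y = 0)
    (htr : ∀ u z : g, ∑ i, B (Ψ ⁅u, e i⁆ (e i)) z = 0)
    (hΦalt : ∀ x y, Φ y x = -Φ x y)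
    (htrace : ∀ y, ∑ i, B (Φ y (e i)) (e i) = ∑ i, B (Ψ y (e i)) (e i))
    (hmain : ∀ x y z u v : g,
      (B (Ψ u ⁅⁅x, y⁆, v⁆) z + B (Ψ ⁅⁅x, y⁆, u⁆ v) z + B ⁅Ψ x y, z⁆ ⁅u, v⁆
        - (B (Φ x y) u * B z v - B z u * B (Φ x y) v) / 2)
      + (B (Ψ u ⁅⁅y, z⁆, v⁆) x + B (Ψ ⁅⁅y, z⁆, u⁆ v) x + B ⁅Ψ y z, x⁆ ⁅u, v⁆
        - (B (Φ y z) u * B x v - B x u * B (Φ y z) v) / 2)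
      + (B (Ψ u ⁅⁅z, x⁆, v⁆) y + B (Ψ ⁅⁅z, x⁆, u⁆ v) y + B ⁅Ψ z x, y⁆ ⁅u, v⁆
        - (B (Φ z x) u * B y v - B y u * B (Φ z x) v) / 2) = 0) (x y u : g) :
    ((Fintype.card ι : ℝ) - 3) / 2 * B (Φ x y) u =
      ∑ i, B (Ψ ⁅⁅x, y⁆, u⁆ (e i)) (e i)
      + ∑ i, B (Ψ y (e i)) ⁅x, ⁅u, e i⁆⁆ - ∑ i, B (Ψ x (e i)) ⁅y, ⁅u, e i⁆⁆
      + (B x u * ∑ i, B (Ψ y (e i)) (e i) - B y u * ∑ i, B (Ψ x (e i)) (e i)) / 2 := by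
  have h := Finset.sum_eq_zero fun i (_ : i ∈ Finset.univ) => hmain x y (e i) u (e i)
  simp only [Finset.sum_add_distrib, Finset.sum_sub_distrib, ← Finset.sum_div,
    ← Finset.mul_sum] at h
  have a1 := F.sum_apply_lie_eq_zero halt hcyc htr u ⁅x, y⁆
  have a2 := F.sum_lie_lie' (Ψ x y) u
  have a3 : ∑ i, B (Φ x y) u * B (e i) (e i) = Fintype.card ι * B (Φ x y) u := by
    simp [F.unit, mul_comm]
  have a4 : ∑ i, B (e i) u * B (Φ x y) (e i) = B (Φ x y) u := by
    rw [← F.sum_expand u (fun v => B (Φ x y) v)]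
    exact Finset.sum_congr rfl fun i _ => by rw [F.symm (e i) u]
  have b1 : ∑ i, B (Ψ u ⁅⁅y, e i⁆, e i⁆) x = -B (Ψ u y) x := by
    rw [← F.sum_casimir y (fun v => B (Ψ u v) x)]
    refine Finset.sum_congr rfl fun i _ => ?_
    rw [← lie_skew (e i) y, lie_neg, lie_skew]
  have b2 : ∀ x y, ∑ i, B (Ψ ⁅⁅y, e i⁆, u⁆ (e i)) x = 0 := fun x y => by
    have := F.sum_lie_lie_apply_eq_zero halt htr u y x
    simp only [← lie_skew _ u, map_neg, LinearMap.neg_apply, Finset.sum_neg_distrib, this, neg_zero]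
  have b3 : ∑ i, B ⁅Ψ y (e i), x⁆ ⁅u, e i⁆ = ∑ i, B (Ψ y (e i)) ⁅x, ⁅u, e i⁆⁆ := by
    simp only [← lie_skew _ x, map_neg, LinearMap.neg_apply, F.lie_left, neg_neg]
  have b4 : ∑ i, B (Φ y (e i)) u * B x (e i) = -B (Φ x y) u := by
    simp only [mul_comm _ (B x (e _))]
    rw [F.sum_expand x (fun v => B (Φ y v) u), hΦalt x y]
    simp only [map_neg, LinearMap.neg_apply]
  have c1 : ∑ i, B (Ψ u ⁅⁅e i, x⁆, e i⁆) y = B (Ψ u x) y := by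
    rw [← neg_neg (B (Ψ u x) y), ← F.sum_casimir x (fun v => B (Ψ u v) y),
      ← Finset.sum_neg_distrib]
    refine Finset.sum_congr rfl fun i _ => ?_
    rw [← lie_skew (e i) ⁅e i, x⁆]
    simp only [map_neg, LinearMap.neg_apply, neg_neg]
  have c2 : ∑ i, B (Ψ ⁅⁅e i, x⁆, u⁆ (e i)) y = 0 := by
    have := b2 y x
    simp only [← lie_skew (e _) x, neg_lie, map_neg, LinearMap.neg_apply, Finset.sum_neg_distrib,
      this, neg_zero]
  have c3 : ∑ i, B ⁅Ψ (e i) x, y⁆ ⁅u, e i⁆ = -∑ i, B (Ψ x (e i)) ⁅y, ⁅u, e i⁆⁆ := by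
    simp only [halt x, ← lie_skew _ y, lie_neg, F.lie_left, neg_neg,
      Finset.sum_neg_distrib]
  have c4 : ∑ i, B (Φ (e i) x) u * B y (e i) = -B (Φ x y) u := by
    simp only [mul_comm _ (B y (e _))]
    rw [F.sum_expand y (fun v => B (Φ v x) u), hΦalt x y]
    simp only [map_neg, LinearMap.neg_apply]
  have c5 : ∑ i, B (Φ (e i) x) (e i) = -∑ i, B (Ψ x (e i)) (e i) := by
    simp only [hΦalt x, map_neg, LinearMap.neg_apply, Finset.sum_neg_distrib, htrace]
  have hc := hcyc x y u
  rw [halt u y] at hc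
  simp only [map_neg, LinearMap.neg_apply] at hc
  simp only [← Finset.mul_sum] at a3
  rw [a1, a2, a3, a4, b1, b2, b3, b4, c1, c2, c3, c4, c5, htrace] at h
  linarith

/-- The trace of `Ψ` vanishes in the contracted identity. -/
lemma trace_eq_zero (F : CasimirFrame B e) {Ψ Φ : g →ₗ[ℝ] g →ₗ[ℝ] g} (hcard : 2 < Fintype.card ι)
    (halt : ∀ x y, Ψ y x = -Ψ x y)
    (hcyc : ∀ x y z, B (Ψ x y) z + B (Ψ y z) x + B (Ψ z x) y = 0)
    (htr : ∀ u z : g, ∑ i, B (Ψ ⁅u, e i⁆ (e i)) z = 0)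
    (hΦalt : ∀ x y, Φ y x = -Φ x y)
    (htrace : ∀ y, ∑ i, B (Φ y (e i)) (e i) = ∑ i, B (Ψ y (e i)) (e i))
    (h : ∀ x y u : g, ((Fintype.card ι : ℝ) - 3) / 2 * B (Φ x y) u =
      ∑ i, B (Ψ ⁅⁅x, y⁆, u⁆ (e i)) (e i)
      + ∑ i, B (Ψ y (e i)) ⁅x, ⁅u, e i⁆⁆ - ∑ i, B (Ψ x (e i)) ⁅y, ⁅u, e i⁆⁆
      + (B x u * ∑ i, B (Ψ y (e i)) (e i) - B y u * ∑ i, B (Ψ x (e i)) (e i)) / 2) (y : g) :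
    ∑ i, B (Ψ y (e i)) (e i) = 0 := by
  have hφ_apply : ∀ v, (∑ i, (B.flip (e i)) ∘ₗ (Ψ.flip (e i))) v = ∑ i, B (Ψ v (e i)) (e i) :=
    fun v => by simp
  generalize (∑ i, (B.flip (e i)) ∘ₗ (Ψ.flip (e i))) = φ at hφ_apply
  simp only [← hφ_apply] at h htrace ⊢
  have hs := Finset.sum_congr rfl fun j (_ : j ∈ Finset.univ) => h (e j) y (e j)
  simp only [Finset.sum_add_distrib, Finset.sum_sub_distrib, ← Finset.sum_div,
    ← Finset.mul_sum] at hs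
  have a1 : ∑ j, B (Φ (e j) y) (e j) = -φ y := by
    simp only [hΦalt y, map_neg, LinearMap.neg_apply, Finset.sum_neg_distrib, htrace]
  have a2 : ∑ j, φ ⁅⁅e j, y⁆, e j⁆ = φ y := by
    rw [← neg_neg (φ y), ← F.sum_casimir y (fun v => φ v), ← Finset.sum_neg_distrib]
    refine Finset.sum_congr rfl fun i _ => ?_
    rw [← lie_skew (e i) ⁅e i, y⁆, map_neg, neg_neg]
  have a3 : ∑ j, ∑ i, B (Ψ y (e i)) ⁅e j, ⁅e j, e i⁆⁆ = -φ y := by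
    rw [Finset.sum_comm, hφ_apply, ← Finset.sum_neg_distrib]
    exact Finset.sum_congr rfl fun i _ => F.sum_casimir (e i) (fun v => B (Ψ y (e i)) v)
  have a4 : ∑ j, ∑ i, B (Ψ (e j) (e i)) ⁅⁅y, e j⁆, e i⁆ = 0 := by
    refine Finset.sum_eq_zero fun j _ => ?_
    have h1 := F.sum_swap ⁅y, e j⁆ (fun v w => B (Ψ (e j) v) w)
    have h2 := F.sum_apply_lie_eq_zero halt hcyc htr (e j) ⁅y, e j⁆
    linarith
  have a5 : ∑ j, ∑ i, B (Ψ (e j) (e i)) ⁅e j, ⁅y, e i⁆⁆ = 0 := by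
    rw [Finset.sum_comm, ← a4]
    refine Finset.sum_congr rfl fun j _ => Finset.sum_congr rfl fun i _ => ?_
    rw [halt (e j), ← lie_skew (e i)]
    simp only [map_neg, LinearMap.neg_apply, neg_neg]
  have a6 : ∑ j, ∑ i, B (Ψ (e j) (e i)) ⁅y, ⁅e j, e i⁆⁆ = 0 := by
    simp only [leibniz_lie y, map_add, Finset.sum_add_distrib, a4, a5, add_zero]
  have a7 : ∑ j, B (e j) (e j) * φ y = Fintype.card ι * φ y := by
    simp [F.unit]
  have a8 : ∑ j, B y (e j) * φ (e j) = φ y := F.sum_expand y (fun v => φ v)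
  rw [a1, a2, a3, a6, a7, a8] at hs
  have h2 : ((Fintype.card ι : ℝ) - 2) * φ y = 0 := by linarith
  have h3 : (2 : ℝ) < Fintype.card ι := by exact_mod_cast hcard
  exact (mul_eq_zero.1 h2).resolve_left (by linarith)

/-- A map `Ψ` satisfying the contracted identity vanishes in large dimension. -/
lemma eq_zero_of_contracted (F : CasimirFrame B e) {Ψ Φ : g →ₗ[ℝ] g →ₗ[ℝ] g} {L : g →ₗ[ℝ] g}
    (hcard : 7 < Fintype.card ι) (halt : ∀ x y, Ψ y x = -Ψ x y)
    (htr : ∀ u z : g, ∑ i, B (Ψ ⁅u, e i⁆ (e i)) z = 0)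
    (hΦ : ∀ x y, Φ x y = Ψ x y + (1 / 2 : ℝ) • L ⁅x, y⁆)
    (h : ∀ x y u : g, ((Fintype.card ι : ℝ) - 3) / 2 * B (Φ x y) u =
      ∑ i, B (Ψ y (e i)) ⁅x, ⁅u, e i⁆⁆ - ∑ i, B (Ψ x (e i)) ⁅y, ⁅u, e i⁆⁆) (x y : g) :
    Ψ x y = 0 := by
  set Q : ℝ := ∑ i, ∑ j, B (Ψ (e i) (e j)) (Ψ (e i) (e j)) with hQ
  have hcross : ∑ i, ∑ j, B (L ⁅e i, e j⁆) (Ψ (e i) (e j)) = 0 := by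
    have h1 : ∀ i, ∑ j, B (L ⁅e i, e j⁆) (Ψ (e i) (e j))
        = -∑ j, B (Ψ ⁅e j, e i⁆ (e i)) (L (e j)) := fun i => by
      have := F.sum_swap (e i) (fun v w => B (L v) (Ψ (e i) w))
      rw [this]
      congr 1
      refine Finset.sum_congr rfl fun j _ => ?_
      rw [F.symm, halt _ (e i), ← lie_skew (e j)]
      simp only [map_neg, LinearMap.neg_apply]
    simp only [h1, Finset.sum_neg_distrib]
    rw [Finset.sum_comm, neg_eq_zero]
    exact Finset.sum_eq_zero fun j _ => htr _ _
  have hleft : ∑ i, ∑ j, B (Φ (e i) (e j)) (Ψ (e i) (e j)) = Q := by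
    simp only [hΦ, map_add, map_smul, LinearMap.add_apply, LinearMap.smul_apply,
      Finset.sum_add_distrib, ← Finset.smul_sum, hcross, smul_zero, add_zero, hQ]
  set S : ℝ := ∑ i, ∑ j, ∑ k, B ⁅e j, Ψ (e i) (e k)⁆ ⁅Ψ (e i) (e j), e k⁆ with hS
  have hright₁ : ∑ i, ∑ j, ∑ k, B (Ψ (e i) (e k)) ⁅e j, ⁅Ψ (e i) (e j), e k⁆⁆ = -S := by
    simp only [hS, F.lie_left, Finset.sum_neg_distrib, neg_neg]
  have hright₂ : ∑ i, ∑ j, ∑ k, B (Ψ (e j) (e k)) ⁅e i, ⁅Ψ (e i) (e j), e k⁆⁆ = S := by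
    rw [Finset.sum_comm, ← neg_neg S, ← hright₁]
    simp only [← Finset.sum_neg_distrib]
    refine Finset.sum_congr rfl fun i _ => Finset.sum_congr rfl fun j _ =>
      Finset.sum_congr rfl fun k _ => ?_
    rw [halt (e i) (e j)]
    simp only [neg_lie, lie_neg, map_neg]
  have hS_le : S ≤ Q := by
    have h1 : ∑ i, ∑ j, ∑ k, B ⁅e j, Ψ (e i) (e k)⁆ ⁅e j, Ψ (e i) (e k)⁆ = Q := by
      refine Finset.sum_congr rfl fun i _ => ?_
      rw [Finset.sum_comm]
      exact Finset.sum_congr rfl fun k _ => F.sum_lie_lie _ _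
    have h2 : ∑ i, ∑ j, ∑ k, B ⁅Ψ (e i) (e j), e k⁆ ⁅Ψ (e i) (e j), e k⁆ = Q :=
      Finset.sum_congr rfl fun i _ => Finset.sum_congr rfl fun j _ => F.sum_lie_lie' _ _
    have h3 : 2 * S ≤ ∑ i, ∑ j, ∑ k, B ⁅e j, Ψ (e i) (e k)⁆ ⁅e j, Ψ (e i) (e k)⁆
        + ∑ i, ∑ j, ∑ k, B ⁅Ψ (e i) (e j), e k⁆ ⁅Ψ (e i) (e j), e k⁆ := by
      simp only [hS, Finset.mul_sum, ← Finset.sum_add_distrib]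
      exact Finset.sum_le_sum fun i _ => Finset.sum_le_sum fun j _ =>
        Finset.sum_le_sum fun k _ => F.two_mul_le _ _
    linarith
  have hsum : ((Fintype.card ι : ℝ) - 3) / 2 * Q = 2 * S := by
    rw [← hleft]
    simp only [Finset.mul_sum, h, Finset.sum_sub_distrib]
    rw [hright₁, hright₂]
    ring
  have hQ_nonneg : 0 ≤ Q := Finset.sum_nonneg fun i _ => Finset.sum_nonneg fun j _ => F.nonneg _
  have hcard' : (8 : ℝ) ≤ Fintype.card ι := by exact_mod_cast hcard
  have hQ_zero : Q = 0 := by nlinarith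
  have hzero : ∀ i j, Ψ (e i) (e j) = 0 := fun i j => by
    by_contra hne
    have h1 := (Finset.sum_eq_zero_iff_of_nonneg fun i _ =>
      Finset.sum_nonneg fun j _ => F.nonneg (Ψ (e i) (e j))).1 hQ_zero i (Finset.mem_univ i)
    have h2 := (Finset.sum_eq_zero_iff_of_nonneg fun j _ =>
      F.nonneg (Ψ (e i) (e j))).1 h1 j (Finset.mem_univ j)
    exact (F.pos _ hne).ne' h2
  rw [← F.expand x, ← F.expand y]
  simp [hzero]

/-- The contraction of one cyclic term of the second Bianchi identity with `ad w`. -/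
lemma sum_contract_ad (F : CasimirFrame B e) {k : g →ₗ[ℝ] g}
    (hk : ∀ u : g, ∑ i, B (k ⁅u, e i⁆) (e i) = 0)
    (a t z φ w : g) :
    ∑ i, (B ⁅a, k ⁅w, e i⁆⁆ (e i) - B (k ⁅a, ⁅w, e i⁆⁆) (e i) + B ⁅⁅t, z⁆, ⁅w, e i⁆⁆ (e i)
      + (B φ ⁅w, e i⁆ * B z (e i) - B z ⁅w, e i⁆ * B φ (e i))) = -B w ⁅t + (2 : ℝ) • φ, z⁆ := by
  have h1 := F.sum_swap a (fun p q => B (k ⁅w, p⁆) q)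
  have h2 := hk ⁅w, a⁆
  have h3 := F.sum_lie_lie' w ⁅t, z⁆
  have h4 : ∑ i, B φ ⁅w, e i⁆ * B z (e i) = B φ ⁅w, z⁆ := by
    rw [← F.sum_expand z (fun v => B φ ⁅w, v⁆)]
    exact Finset.sum_congr rfl fun i _ => mul_comm _ _
  have h5 : ∑ i, B z ⁅w, e i⁆ * B φ (e i) = B z ⁅w, φ⁆ := by
    rw [← F.sum_expand φ (fun v => B z ⁅w, v⁆)]
    exact Finset.sum_congr rfl fun i _ => mul_comm _ _
  have h6 : B z ⁅w, φ⁆ = -B φ ⁅w, z⁆ := by rw [F.symm, F.lie_left]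
  have h7 : B w ⁅φ, z⁆ = -B φ ⁅w, z⁆ := by
    rw [← F.lie_left, ← neg_neg (B w _), ← F.lie_left, ← lie_skew]
    simp only [map_neg, LinearMap.neg_apply, neg_neg]
  simp only [lie_lie, map_sub, LinearMap.sub_apply, Finset.sum_sub_distrib] at h2
  simp only [Finset.sum_add_distrib, Finset.sum_sub_distrib, F.lie_left a, F.lie_left ⁅t, z⁆,
    Finset.sum_neg_distrib, h3, h4, h5, h6, add_lie, smul_lie, map_add, map_smul, smul_eq_mul, h7]
  linarith

/-- A map `L` through which `K x y - K y x + 2 • Φ x y` factors is traceless. -/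
lemma sum_apply_eq_zero (F : CasimirFrame B e) {K Φ : g →ₗ[ℝ] g →ₗ[ℝ] g} {L : g →ₗ[ℝ] g}
    (htr : ∀ z u : g, ∑ i, B (K z ⁅u, e i⁆) (e i) = 0) (hΦalt : ∀ x y, Φ y x = -Φ x y)
    (hi : ∀ x y z, B (Φ x y) z + B (Φ y z) x + B (Φ z x) y = 0)
    (hL : ∀ x y, K x y - K y x + (2 : ℝ) • Φ x y = L ⁅x, y⁆) :
    ∑ i, B (L (e i)) (e i) = 0 := by
  have h1 : ∑ j, ∑ i, B (K (e i) ⁅e i, e j⁆) (e j) = 0 := by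
    rw [Finset.sum_comm]
    exact Finset.sum_eq_zero fun i _ => htr _ _
  have h2 : ∑ j, ∑ i, B (K ⁅e i, e j⁆ (e i)) (e j) = 0 := by
    rw [← neg_eq_zero, ← h1, ← Finset.sum_neg_distrib]
    refine Finset.sum_congr rfl fun j _ => ?_
    have := F.sum_swap (e j) (fun p q => B (K p q) (e j))
    simp only [← lie_skew (e j) (e _), map_neg, LinearMap.neg_apply, Finset.sum_neg_distrib,
      neg_neg] at this
    exact this
  have h3 : ∑ j, ∑ i, B (Φ (e i) ⁅e i, e j⁆) (e j) = 0 := by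
    have h := Finset.sum_eq_zero fun j (_ : j ∈ Finset.univ) =>
      Finset.sum_eq_zero fun i (_ : i ∈ Finset.univ) => hi (e i) ⁅e i, e j⁆ (e j)
    simp only [Finset.sum_add_distrib] at h
    have a1 : ∑ j, ∑ i, B (Φ ⁅e i, e j⁆ (e j)) (e i)
        = ∑ j, ∑ i, B (Φ (e i) ⁅e i, e j⁆) (e j) := by
      rw [Finset.sum_comm]
      refine Finset.sum_congr rfl fun j _ => Finset.sum_congr rfl fun i _ => ?_
      rw [hΦalt (e i), ← lie_skew (e j)]
      simp only [map_neg, neg_neg]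
    have a2 : ∑ j, ∑ i, B (Φ (e j) (e i)) ⁅e i, e j⁆
        = ∑ j, ∑ i, B (Φ (e i) ⁅e i, e j⁆) (e j) := by
      rw [Finset.sum_comm]
      conv_rhs => rw [Finset.sum_comm]
      refine Finset.sum_congr rfl fun i _ => ?_
      have := F.sum_swap (e i) (fun p q => B (Φ p (e i)) q)
      simp only [hΦalt (e i) ⁅_, _⁆, map_neg, LinearMap.neg_apply, Finset.sum_neg_distrib] at this
      exact (neg_injective this).symm
    linarith
  have h4 : ∀ j, B (L (e j)) (e j) = -∑ i, B (L ⁅e i, ⁅e i, e j⁆⁆) (e j) := fun j => by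
    rw [F.sum_casimir (e j) (fun v => B (L v) (e j)), neg_neg]
  simp only [h4, ← hL, map_add, map_sub, map_smul, LinearMap.add_apply, LinearMap.sub_apply,
    LinearMap.smul_apply, smul_eq_mul, Finset.sum_add_distrib, Finset.sum_sub_distrib,
    ← Finset.mul_sum, Finset.sum_neg_distrib, h1, h2, h3]
  simp

/-- Rigidity of the second Bianchi identity, in terms of a frame. -/
theorem eq_zero_of_bianchi (F : CasimirFrame B e) {K Φ : g →ₗ[ℝ] g →ₗ[ℝ] g}
    (hcard : 7 < Fintype.card ι)
    (hschur : ∀ P : g →ₗ[ℝ] g, (∀ x y, B (P x) y = B x (P y)) →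
      (∀ x y : g, P ⁅x, y⁆ = ⁅x, P y⁆) → ∃ c : ℝ, ∀ x, P x = c • x)
    (hskew : ∀ z x y, B (K z x) y = -B x (K z y))
    (htr : ∀ z u : g, ∑ i, B (K z ⁅u, e i⁆) (e i) = 0) (hΦalt : ∀ x y, Φ y x = -Φ x y)
    (hi : ∀ x y z, B (Φ x y) z + B (Φ y z) x + B (Φ z x) y = 0)
    (hii : ∀ x y z u v : g,
      (B ⁅⁅x, y⁆, K z u⁆ v - B (K z ⁅⁅x, y⁆, u⁆) v + B ⁅⁅K x y - K y x, z⁆, u⁆ v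
        + (B (Φ x y) u * B z v - B z u * B (Φ x y) v))
      + (B ⁅⁅y, z⁆, K x u⁆ v - B (K x ⁅⁅y, z⁆, u⁆) v + B ⁅⁅K y z - K z y, x⁆, u⁆ v
        + (B (Φ y z) u * B x v - B x u * B (Φ y z) v))
      + (B ⁅⁅z, x⁆, K y u⁆ v - B (K y ⁅⁅z, x⁆, u⁆) v + B ⁅⁅K z x - K x z, y⁆, u⁆ v
        + (B (Φ z x) u * B y v - B y u * B (Φ z x) v)) = 0) :
    (∀ x y, Φ x y = 0) ∧ ∀ x y, K x y = 0 := by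
  have hT : ∀ x y z : g, ⁅(K - K.flip + (2 : ℝ) • Φ) x y, z⁆ + ⁅(K - K.flip + (2 : ℝ) • Φ) y z, x⁆
      + ⁅(K - K.flip + (2 : ℝ) • Φ) z x, y⁆ = 0 := fun x y z => F.eq_of_forall fun w => by
    have h := Finset.sum_eq_zero fun i (_ : i ∈ Finset.univ) => hii x y z ⁅w, e i⁆ (e i)
    rw [Finset.sum_add_distrib, Finset.sum_add_distrib, F.sum_contract_ad (htr z),
      F.sum_contract_ad (htr x), F.sum_contract_ad (htr y)] at h
    rw [F.symm, F.symm _ w, map_zero, map_add, map_add]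
    simp only [LinearMap.add_apply, LinearMap.sub_apply, LinearMap.flip_apply,
      LinearMap.smul_apply]
    linarith
  obtain ⟨L, hLsymm, hL⟩ := F.exists_eq_apply_lie (K - K.flip + (2 : ℝ) • Φ)
    (fun x y => by simp [hΦalt x y]; abel) hT
  simp only [hL] at hT
  simp only [LinearMap.add_apply, LinearMap.sub_apply, LinearMap.flip_apply,
    LinearMap.smul_apply] at hL
  obtain ⟨P, hPsymm, hPlie, hPtr, hP⟩ := F.exists_intertwiner L hLsymm hT
  obtain ⟨c, hc⟩ := hschur P hPsymm hPlie
  have hc_zero : c = 0 := by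
    simp only [F.sum_apply_eq_zero htr hΦalt hi hL, hc, map_smul, LinearMap.smul_apply, F.unit,
      smul_eq_mul, mul_one, mul_zero, Finset.sum_const, Finset.card_univ, nsmul_eq_mul] at hPtr
    exact (mul_eq_zero.1 hPtr).resolve_left (by exact_mod_cast (by omega : Fintype.card ι ≠ 0))
  simp only [hc, hc_zero, zero_smul, map_zero, LinearMap.zero_apply] at hP
  set Ψ : g →ₗ[ℝ] g →ₗ[ℝ] g := (1 / 2 : ℝ) • (K.flip - K) with hΨ_def
  have hΨ : ∀ x y, K x y - K y x = (-2 : ℝ) • Ψ x y := fun x y => by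
    simp only [hΨ_def, LinearMap.smul_apply, LinearMap.sub_apply, LinearMap.flip_apply]
    module
  have hΦ : ∀ x y, Φ x y = Ψ x y + (1 / 2 : ℝ) • L ⁅x, y⁆ := fun x y => by
    rw [← hL, hΨ]
    module
  have halt : ∀ x y, Ψ y x = -Ψ x y := fun x y => by
    simp only [hΨ_def, LinearMap.smul_apply, LinearMap.sub_apply, LinearMap.flip_apply]
    module
  have hcyc : ∀ x y z, B (Ψ x y) z + B (Ψ y z) x + B (Ψ z x) y = 0 := fun x y z => by
    have h1 := hi x y z
    have h2 := hP x y z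
    simp only [hΦ, map_add, map_smul, LinearMap.add_apply, LinearMap.smul_apply, smul_eq_mul,
      F.symm (L _)] at h1
    simp only [hLsymm] at h2
    linarith
  have hΨ_inner : ∀ x y z, B (K x y) z - B (K y x) z = -2 * B (Ψ x y) z := fun x y z => by
    rw [← LinearMap.sub_apply, ← map_sub, hΨ]
    simp only [map_smul, LinearMap.smul_apply, smul_eq_mul]
  have koszul : ∀ x y z, B (K x y) z = 2 * B (Ψ y z) x := fun x y z => by
    have hs : ∀ x y z, B (K x y) z = -B (K x z) y := fun x y z => by rw [hskew, F.symm]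
    linarith [hcyc x y z, hΨ_inner x y z, hΨ_inner y z x, hΨ_inner z x y, hs x y z, hs y z x,
      hs z x y]
  have htr' : ∀ u z : g, ∑ i, B (Ψ ⁅u, e i⁆ (e i)) z = 0 := fun u z => by
    have h := htr z u
    simp only [koszul, ← Finset.mul_sum] at h
    linarith
  have htrace : ∀ y, ∑ i, B (Φ y (e i)) (e i) = ∑ i, B (Ψ y (e i)) (e i) := fun y => by
    have h1 := F.sum_swap y (fun u v => B (L u) v)
    have h2 : ∑ i, B (L ⁅y, e i⁆) (e i) = ∑ i, B (L (e i)) ⁅y, e i⁆ :=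
      Finset.sum_congr rfl fun i _ => by rw [hLsymm, F.symm]
    have h3 : ∑ i, B (L ⁅y, e i⁆) (e i) = 0 := by linarith
    simp only [hΦ, map_add, map_smul, LinearMap.add_apply, LinearMap.smul_apply, smul_eq_mul,
      Finset.sum_add_distrib, ← Finset.mul_sum, h3, mul_zero, add_zero]
  have lie_right : ∀ p u v : g, B ⁅p, u⁆ v = B p ⁅u, v⁆ := fun p u v => by
    rw [← lie_skew]
    simp only [map_neg, LinearMap.neg_apply, F.lie_left, neg_neg]
  have hcontr := F.contracted_bianchi halt hcyc htr' hΦalt htrace fun x y z u v => by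
    have h := hii x y z u v
    simp only [hΨ, smul_lie, map_smul, LinearMap.smul_apply, smul_eq_mul, lie_right ⁅Ψ _ _, _⁆,
      F.lie_left ⁅_, _⁆ (K _ _), koszul] at h
    linarith
  have hφ := F.trace_eq_zero (by omega) halt hcyc htr' hΦalt htrace hcontr
  simp only [hφ, mul_zero, sub_zero, zero_div, add_zero, zero_add] at hcontr
  have hΨ_zero := F.eq_zero_of_contracted hcard halt htr' hΦ hcontr
  simp only [hΨ_zero, map_zero, LinearMap.zero_apply, Finset.sum_const_zero, sub_zero] at hcontr
  have hcard' : (7 : ℝ) < Fintype.card ι := by exact_mod_cast hcard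
  refine ⟨fun x y => F.eq_of_forall fun z => ?_, fun x y => F.eq_of_forall fun z => ?_⟩
  · rw [map_zero, LinearMap.zero_apply]
    exact (mul_eq_zero.1 (hcontr x y z)).resolve_left (by linarith)
  · rw [koszul, hΨ_zero]
    simp

end CasimirFrame

end CasimirFrame

section PosDef

variable {V : Type*} [AddCommGroup V] [Module ℝ V] [FiniteDimensional ℝ V]
  {B : LinearMap.BilinForm ℝ V}

/-- The inner product space core of a positive definite symmetric bilinear form. -/
abbrev innerCoreOfPosDef (hsymm : ∀ x y, B x y = B y x)
    (hpos : ∀ x, x ≠ 0 → 0 < B x x) : InnerProductSpace.Core ℝ V where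
  inner x y := B x y
  conj_inner_symm x y := by simpa using hsymm y x
  re_inner_nonneg x := by
    rcases eq_or_ne x 0 with rfl | hx
    · simp
    · exact (hpos x hx).le
  add_left x y z := by simp
  smul_left x y r := by simp
  definite x hx := by
    by_contra hne
    exact (hpos x hne).ne' hx

/-- Every subspace has an adapted orthonormal basis. -/
lemma exists_orthonormal_frame (hsymm : ∀ x y, B x y = B y x)
    (hpos : ∀ x, x ≠ 0 → 0 < B x x) (W : Submodule ℝ V) :
    ∃ (u : Finset V) (s : Finset u), (∀ i : u, B (i : V) i = 1) ∧
      (∀ x, ∑ i : u, B x i • (i : V) = x) ∧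
      (∀ f : V →ₗ[ℝ] V, LinearMap.trace ℝ V f = ∑ i : u, B (f i) i) ∧
      (∀ i ∈ s, (i : V) ∈ W) ∧ Module.finrank ℝ W ≤ s.card := by
  classical
  let _ : NormedAddCommGroup V := (innerCoreOfPosDef hsymm hpos).toNormedAddCommGroup
  let _ : InnerProductSpace ℝ V := InnerProductSpace.ofCore (innerCoreOfPosDef hsymm hpos).toCore
  have hinner : ∀ x y : V, inner ℝ x y = B x y := fun _ _ => rfl
  let b := stdOrthonormalBasis ℝ W
  have hb : Orthonormal ℝ (fun i => (b i : V)) := b.orthonormal.comp_linearIsometry W.subtypeₗᵢ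
  obtain ⟨u, b', hu, hb'⟩ := hb.toSubtypeRange.exists_orthonormalBasis_extension
  have hb'_apply : ∀ i : u, b' i = (i : V) := fun i => by rw [hb']
  refine ⟨u, Finset.univ.filter fun i => (i : V) ∈ W, fun i => ?_, fun x => ?_, fun f => ?_,
    fun i hi => (Finset.mem_filter.1 hi).2, ?_⟩
  · rw [← hb'_apply, ← hinner, real_inner_self_eq_norm_sq, b'.norm_eq_one, one_pow]
  · conv_rhs => rw [← b'.sum_repr' x]
    refine Finset.sum_congr rfl fun i _ => ?_
    rw [hb'_apply, hsymm, hinner]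
  · rw [LinearMap.trace_eq_sum_inner f b']
    refine Finset.sum_congr rfl fun i _ => ?_
    rw [hb'_apply, hsymm, hinner]
  · rw [← Fintype.card_fin (Module.finrank ℝ W), ← Finset.card_univ]
    refine Finset.card_le_card_of_injOn
      (fun i => ⟨(b i : V), hu (Set.mem_range_self i)⟩) (fun i _ => by simp) fun i _ j _ hij => ?_
    have : (b i : V) = b j := congrArg (fun v : u => (v : V)) hij
    exact hb.linearIndependent.injective this

lemma exists_eigenvector_of_symm [Nontrivial V] (hsymm : ∀ x y, B x y = B y x)
    (hpos : ∀ x, x ≠ 0 → 0 < B x x) (P : V →ₗ[ℝ] V) (hP : ∀ x y, B (P x) y = B x (P y)) :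
    ∃ (c : ℝ) (x : V), x ≠ 0 ∧ P x = c • x := by
  let _ : NormedAddCommGroup V := (innerCoreOfPosDef hsymm hpos).toNormedAddCommGroup
  let _ : InnerProductSpace ℝ V := InnerProductSpace.ofCore (innerCoreOfPosDef hsymm hpos).toCore
  have hP' : P.IsSymmetric := hP
  obtain ⟨x, hx⟩ := hP'.hasEigenvalue_iSup_of_finiteDimensional.exists_hasEigenvector
  exact ⟨_, x, hx.2, hx.apply_eq_smul⟩

end PosDef

/-- Schur's lemma for symmetric intertwiners of a simple Lie algebra. -/
lemma exists_smul_of_intertwiner {g : Type*} [LieRing g] [LieAlgebra ℝ g] [Module.Finite ℝ g]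
    [LieAlgebra.IsSimple ℝ g] {B : LinearMap.BilinForm ℝ g} (hsymm : ∀ x y, B x y = B y x)
    (hpos : ∀ x, x ≠ 0 → 0 < B x x) (P : g →ₗ[ℝ] g) (hP : ∀ x y, B (P x) y = B x (P y))
    (hlie : ∀ x y : g, P ⁅x, y⁆ = ⁅x, P y⁆) : ∃ c : ℝ, ∀ x, P x = c • x := by
  have : Nontrivial g := by
    by_contra hn
    rw [not_nontrivial_iff_subsingleton] at hn
    exact LieAlgebra.IsSimple.non_abelian ℝ (L := g) ⟨fun _ _ => Subsingleton.elim _ _⟩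
  obtain ⟨c, x, hx, hPx⟩ := exists_eigenvector_of_symm hsymm hpos P hP
  let I : LieIdeal ℝ g :=
    { LinearMap.ker (P - c • LinearMap.id) with
      lie_mem := fun {y m} hm => by
        have hm' : P m - c • m = 0 := hm
        change P ⁅y, m⁆ - c • ⁅y, m⁆ = 0
        rw [hlie, ← lie_smul, ← lie_sub, hm', lie_zero] }
  have hmem : ∀ y, y ∈ I ↔ P y - c • y = 0 := fun y => Iff.rfl
  refine ⟨c, fun y => sub_eq_zero.1 ((hmem y).1 ?_)⟩
  rcases LieAlgebra.IsSimple.eq_bot_or_eq_top (R := ℝ) I with h | h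
  · have : x ∈ I := (hmem x).2 (sub_eq_zero.2 hPx)
    rw [h, LieSubmodule.mem_bot] at this
    exact absurd this hx
  · rw [h]; exact LieSubmodule.mem_top _

/-- A compact simple Lie algebra has a Casimir frame adapted to a given subspace. -/
lemma exists_casimirFrame {g : Type*} [LieRing g] [LieAlgebra ℝ g] [Module.Finite ℝ g]
    (hneg : ∀ x : g, x ≠ 0 → killingForm ℝ g x x < 0) (W : Submodule ℝ g) :
    ∃ (u : Finset g) (s : Finset u), CasimirFrame (-killingForm ℝ g) (fun i : u => (i : g)) ∧
      (∀ f : g →ₗ[ℝ] g, LinearMap.trace ℝ g f = ∑ i : u, (-killingForm ℝ g) (f i) i) ∧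
      (∀ i ∈ s, (i : g) ∈ W) ∧ Module.finrank ℝ W ≤ s.card := by
  have hsymm : ∀ x y, (-killingForm ℝ g) x y = (-killingForm ℝ g) y x := fun x y => by
    simp only [LinearMap.neg_apply, LieModule.traceForm_comm ℝ g g x y]
  have hpos : ∀ x, x ≠ 0 → 0 < (-killingForm ℝ g) x x := fun x hx => by
    simpa using hneg x hx
  have hlie : ∀ x y z : g, (-killingForm ℝ g) ⁅x, y⁆ z = -(-killingForm ℝ g) y ⁅x, z⁆ :=
    fun x y z => by
    have := LieModule.traceForm_apply_lie_apply' ℝ g g x y z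
    simp only [LinearMap.neg_apply, this]
  obtain ⟨u, s, hunit, hexp, htrace, hs, hcard⟩ := exists_orthonormal_frame hsymm hpos W
  have hkill : ∀ x y : g, killingForm ℝ g x y = ∑ i : u, (-killingForm ℝ g) ⁅x, ⁅y, (i : g)⁆⁆ i :=
    fun x y => by
    exact htrace (ad ℝ g x ∘ₗ ad ℝ g y)
  refine ⟨u, s, ⟨hsymm, hlie, hpos, hunit, hexp, fun x => ?_⟩, htrace, hs, hcard⟩
  have hw : ∀ w, (-killingForm ℝ g) (∑ i : u, ⁅(i : g), ⁅(i : g), x⁆⁆ - -x) w = 0 := fun w => by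
    have h1 : ∀ i : u, (-killingForm ℝ g) ⁅(i : g), ⁅(i : g), x⁆⁆ w
        = (-killingForm ℝ g) ⁅x, ⁅w, (i : g)⁆⁆ i := fun i => by
      rw [hlie (i : g) ⁅(i : g), x⁆, hlie x, hsymm ⁅(i : g), x⁆, ← lie_skew w, ← lie_skew x (i : g)]
      simp only [map_neg, LinearMap.neg_apply, neg_neg]
    rw [map_sub, map_sum, LinearMap.sub_apply, LinearMap.sum_apply, Finset.sum_congr rfl
      fun i _ => h1 i, ← hkill]
    simp
  by_contra hne
  exact (hpos _ (sub_ne_zero.2 hne)).ne' (hw _)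

lemma isKilling_of_neg {g : Type*} [LieRing g] [LieAlgebra ℝ g]
    (hneg : ∀ x : g, x ≠ 0 → killingForm ℝ g x x < 0) : IsKilling ℝ g where
  killingCompl_top_eq_bot := by
    refine (LieSubmodule.eq_bot_iff _).2 fun x hx => ?_
    by_contra hne
    rw [LieIdeal.mem_killingCompl] at hx
    exact (hneg x hne).ne (hx x (LieSubmodule.mem_top x))

theorem stmt_10 (g : Type*) [LieRing g] [LieAlgebra ℝ g] [Module.Finite ℝ g]
    [LieAlgebra.IsSimple ℝ g]
    (hneg : ∀ X : g, X ≠ 0 → killingForm ℝ g X X < 0)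
    (hdim : 4 < Module.finrank ℝ g)
    (K : g →ₗ[ℝ] Module.End ℝ g)
    (hskew : ∀ Z X Y : g, ip ℝ g (K Z X) Y + ip ℝ g X (K Z Y) = 0)
    (htr : ∀ Z U : g, LinearMap.trace ℝ g (K Z ∘ₗ ad ℝ g U) = 0)
    (Φ : g →ₗ[ℝ] g →ₗ[ℝ] g)
    (hΦalt : ∀ X : g, Φ X X = 0)
    (hi : ∀ X Y Z : g, ip ℝ g (Φ X Y) Z + ip ℝ g (Φ Y Z) X + ip ℝ g (Φ Z X) Y = 0)
    (hii : ∀ X Y Z : g,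
      (⁅ad ℝ g ⁅X, Y⁆, K Z⁆ + ad ℝ g ⁅K X Y - K Y X, Z⁆ + wedge ℝ g (Φ X Y) Z)
      + (⁅ad ℝ g ⁅Y, Z⁆, K X⁆ + ad ℝ g ⁅K Y Z - K Z Y, X⁆ + wedge ℝ g (Φ Y Z) X)
      + (⁅ad ℝ g ⁅Z, X⁆, K Y⁆ + ad ℝ g ⁅K Z X - K X Z, Y⁆ + wedge ℝ g (Φ Z X) Y) = 0)
    (hrank : ∃ h : LieSubalgebra ℝ g, h.IsCartanSubalgebra ∧ 3 ≤ Module.finrank ℝ h) :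
    (∀ X Y : g, Φ X Y = 0) ∧ (∀ X Y : g, K X Y = 0) := by
  obtain ⟨h, hcartan, hrank⟩ := hrank
  obtain ⟨u, s, F, htrace, hs, hscard⟩ := exists_casimirFrame hneg h.toSubmodule
  have : IsKilling ℝ g := isKilling_of_neg hneg
  have hcard : 3 * s.card ≤ Fintype.card u := F.three_mul_card_le s fun i hi j hj => by
    have := congrArg (Subtype.val : h → g)
      (LieModule.IsTrivial.trivial (⟨i, hs i hi⟩ : h) (⟨j, hs j hj⟩ : h))
    simpa using this
  have hfin : 3 ≤ s.card := hrank.trans hscard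
  have a1 : ∀ z x y, (-killingForm ℝ g) (K z x) y = -(-killingForm ℝ g) x (K z y) :=
    fun z x y => eq_neg_of_add_eq_zero_left (hskew z x y)
  have a2 : ∀ z v : g, ∑ i : u, (-killingForm ℝ g) (K z ⁅v, (i : g)⁆) i = 0 :=
    fun z v => (htrace (K z ∘ₗ ad ℝ g v)).symm.trans (htr z v)
  have a3 : ∀ x y, Φ y x = -Φ x y := fun x y => by
    have := hΦalt (x + y)
    simp only [map_add, LinearMap.add_apply, hΦalt, zero_add, add_zero] at this
    exact eq_neg_of_add_eq_zero_left this
  refine F.eq_zero_of_bianchi (by omega) (exists_smul_of_intertwiner F.symm F.pos) a1 a2 a3 hi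
    fun x y z v w => ?_
  have hwedge : ∀ x y v : g, wedge ℝ g x y v
      = (-killingForm ℝ g) x v • y - (-killingForm ℝ g) y v • x := fun _ _ _ => rfl
  have := congrArg (fun f : Module.End ℝ g => (-killingForm ℝ g) (f v) w) (hii x y z)
  generalize -killingForm ℝ g = B at hwedge this ⊢
  simp only [LinearMap.add_apply, LinearMap.sub_apply, hwedge, Ring.lie_def, Module.End.mul_apply,
    ad_apply, map_add, map_sub, map_smul, LinearMap.smul_apply, smul_eq_mul, LinearMap.zero_apply,
    map_zero] at this ⊢
  linarith
end

section
/- Under the hypotheses of the Proposition (dim g > 4, K and Φ satisfying (i) and (ii)) together with the condition Tr(K_Z ∘ ad_U) = 0 for all Z,U ∈ g, if the rank of g equals 2, then Φ(X,Y) = 0 and K_X Y = 0 for all X, Y ∈ g. -/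
open LieAlgebra

section PosDefForm

variable {V : Type*} [AddCommGroup V] [Module ℝ V] [Module.Finite ℝ V]
  {B : V →ₗ[ℝ] V →ₗ[ℝ] ℝ}

/-- The inner product space core attached to a positive definite symmetric bilinear form. -/
@[reducible] def coreOfPosDef (B : V →ₗ[ℝ] V →ₗ[ℝ] ℝ) (hsymm : ∀ x y, B x y = B y x)
    (hpos : ∀ x, x ≠ 0 → 0 < B x x) : InnerProductSpace.Core ℝ V where
  inner x y := B x y
  conj_inner_symm x y := by simp [hsymm x y]
  re_inner_nonneg x := by
    rcases eq_or_ne x 0 with rfl | hx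
    · simp
    · exact (hpos x hx).le
  add_left x y z := by simp
  smul_left x y r := by simp
  definite x hx := by
    by_contra h
    exact (hpos x h).ne' hx

lemma exists_orthonormal_basis (hsymm : ∀ x y, B x y = B y x)
    (hpos : ∀ x, x ≠ 0 → 0 < B x x) :
    ∃ e : Module.Basis (Fin (Module.finrank ℝ V)) ℝ V,
      ∀ i j, B (e i) (e j) = if i = j then 1 else 0 := by
  let _ : NormedAddCommGroup V := (coreOfPosDef B hsymm hpos).toNormedAddCommGroup
  let _ : InnerProductSpace ℝ V := InnerProductSpace.ofCore (coreOfPosDef B hsymm hpos).toCore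
  refine ⟨(stdOrthonormalBasis ℝ V).toBasis, fun i j => ?_⟩
  have h := orthonormal_iff_ite.mp (stdOrthonormalBasis ℝ V).orthonormal i j
  rw [← OrthonormalBasis.coe_toBasis] at h
  exact h

lemma exists_eigenvector (hsymm : ∀ x y, B x y = B y x)
    (hpos : ∀ x, x ≠ 0 → 0 < B x x) [Nontrivial V] {T : Module.End ℝ V}
    (hT : ∀ x y, B (T x) y = B x (T y)) : ∃ x, x ≠ 0 ∧ ∃ μ : ℝ, T x = μ • x := by
  let _ : NormedAddCommGroup V := (coreOfPosDef B hsymm hpos).toNormedAddCommGroup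
  let _ : InnerProductSpace ℝ V := InnerProductSpace.ofCore (coreOfPosDef B hsymm hpos).toCore
  have hs : T.IsSymmetric := hT
  obtain ⟨x, hx⟩ := hs.hasEigenvalue_iSup_of_finiteDimensional.exists_hasEigenvector
  exact ⟨x, hx.2, _, hx.apply_eq_smul⟩

lemma exists_eigenvector_mem (hsymm : ∀ x y, B x y = B y x)
    (hpos : ∀ x, x ≠ 0 → 0 < B x x) {T : Module.End ℝ V}
    (hT : ∀ x y, B (T x) y = B x (T y)) {p : Submodule ℝ V} (hp : ∀ x ∈ p, T x ∈ p)
    (hne : p ≠ ⊥) : ∃ x ∈ p, x ≠ 0 ∧ ∃ μ : ℝ, T x = μ • x := by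
  have : Nontrivial p := Submodule.nontrivial_iff_ne_bot.mpr hne
  obtain ⟨x, hx, μ, h⟩ := exists_eigenvector (B := B.domRestrict₁₂ p p) (T := T.restrict hp)
    (fun x y => hsymm x y) (fun x hx => hpos x (by simpa using hx))
    (fun x y => hT x y)
  exact ⟨x, x.2, by simpa using hx, μ, by simpa using congrArg Subtype.val h⟩

lemma even_finrank_of_skew_injective (hsymm : ∀ x y, B x y = B y x)
    (hpos : ∀ x, x ≠ 0 → 0 < B x x) {T : Module.End ℝ V}
    (hT : ∀ x y, B (T x) y = - B x (T y)) (hinj : Function.Injective T) :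
    Even (Module.finrank ℝ V) := by
  obtain ⟨e, he⟩ := exists_orthonormal_basis hsymm hpos
  have hM : (LinearMap.toMatrix e e T).transpose = - LinearMap.toMatrix e e T := by
    have hr : ∀ x i, e.repr x i = B (e i) x := by
      intro x i
      have h := congrArg (B (e i)) (e.sum_repr x)
      simpa [he, -Module.Basis.sum_repr, eq_comm] using h
    ext i j
    simp only [Matrix.transpose_apply, Matrix.neg_apply, LinearMap.toMatrix_apply, hr]
    rw [hsymm, hT]
  have hdet : LinearMap.det T ≠ 0 := by
    have := (LinearEquiv.ofInjectiveEndo T hinj).isUnit_det'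
    exact this.ne_zero
  have h2 := congrArg Matrix.det hM
  rw [Matrix.det_transpose, Matrix.det_neg, LinearMap.det_toMatrix] at h2
  by_contra hodd
  rw [Nat.not_even_iff_odd] at hodd
  rw [Fintype.card_fin, hodd.neg_one_pow] at h2
  exact hdet (by linarith)

lemma even_finrank_range_of_skew (hsymm : ∀ x y, B x y = B y x)
    (hpos : ∀ x, x ≠ 0 → 0 < B x x) {T : Module.End ℝ V}
    (hT : ∀ x y, B (T x) y = - B x (T y)) : Even (Module.finrank ℝ (LinearMap.range T)) := by
  have hp : ∀ x ∈ LinearMap.range T, T x ∈ LinearMap.range T := fun x _ => ⟨x, rfl⟩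
  refine even_finrank_of_skew_injective (B := B.domRestrict₁₂ _ _) (T := T.restrict hp)
    (fun x y => hsymm x y) (fun x hx => hpos x (by simpa using hx))
    (fun x y => hT x y) ?_
  rw [← LinearMap.ker_eq_bot, LinearMap.ker_eq_bot']
  rintro ⟨_, y, rfl⟩ hy
  have hy' : T (T y) = 0 := by simpa using congrArg Subtype.val hy
  by_contra hne
  have := hpos (T y) (fun h => hne (Subtype.ext h))
  rw [hT, hy'] at this
  simp at this

end PosDefForm

section InnerProduct

variable {g : Type*} [LieRing g] [LieAlgebra ℝ g]

@[simp] lemma ip_add_left (X Y Z : g) : ip ℝ g (X + Y) Z = ip ℝ g X Z + ip ℝ g Y Z := by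
  simp [ip]; ring

@[simp] lemma ip_add_right (X Y Z : g) : ip ℝ g X (Y + Z) = ip ℝ g X Y + ip ℝ g X Z := by
  simp [ip]; ring

@[simp] lemma ip_sub_left (X Y Z : g) : ip ℝ g (X - Y) Z = ip ℝ g X Z - ip ℝ g Y Z := by
  simp [ip]; ring

@[simp] lemma ip_sub_right (X Y Z : g) : ip ℝ g X (Y - Z) = ip ℝ g X Y - ip ℝ g X Z := by
  simp [ip]; ring

@[simp] lemma ip_neg_left (X Y : g) : ip ℝ g (-X) Y = - ip ℝ g X Y := by simp [ip]

@[simp] lemma ip_neg_right (X Y : g) : ip ℝ g X (-Y) = - ip ℝ g X Y := by simp [ip]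

@[simp] lemma ip_smul_left (c : ℝ) (X Y : g) : ip ℝ g (c • X) Y = c * ip ℝ g X Y := by simp [ip]

@[simp] lemma ip_smul_right (c : ℝ) (X Y : g) : ip ℝ g X (c • Y) = c * ip ℝ g X Y := by simp [ip]

@[simp] lemma ip_zero_left (X : g) : ip ℝ g 0 X = 0 := by simp [ip]

@[simp] lemma ip_zero_right (X : g) : ip ℝ g X 0 = 0 := by simp [ip]

lemma ip_sum_left {ι : Type*} (s : Finset ι) (f : ι → g) (X : g) :
    ip ℝ g (∑ i ∈ s, f i) X = ∑ i ∈ s, ip ℝ g (f i) X := by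
  simp [ip]

lemma ip_sum_right {ι : Type*} (s : Finset ι) (f : ι → g) (X : g) :
    ip ℝ g X (∑ i ∈ s, f i) = ∑ i ∈ s, ip ℝ g X (f i) := by
  simp [ip]

lemma ip_comm (X Y : g) : ip ℝ g X Y = ip ℝ g Y X := by
  simp only [ip, LieModule.traceForm_comm ℝ g g X Y]

lemma ip_lie_left (X Y Z : g) : ip ℝ g ⁅X, Y⁆ Z = ip ℝ g X ⁅Y, Z⁆ := by
  simp only [ip, LieModule.traceForm_apply_lie_apply ℝ g g X Y Z]

lemma ip_lie_skew (X Y Z : g) : ip ℝ g ⁅X, Y⁆ Z = - ip ℝ g Y ⁅X, Z⁆ := by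
  rw [← lie_skew, ip_neg_left, ip_lie_left]

@[simp] lemma wedge_apply (X Y Z : g) :
    wedge ℝ g X Y Z = ip ℝ g X Z • Y - ip ℝ g Y Z • X := by
  simp [wedge, ip]

/-- The inner product as a bilinear map. -/
noncomputable def ipForm (g : Type*) [LieRing g] [LieAlgebra ℝ g] : g →ₗ[ℝ] g →ₗ[ℝ] ℝ :=
  - killingForm ℝ g

lemma ipForm_apply (X Y : g) : ipForm g X Y = ip ℝ g X Y := by simp [ipForm, ip]

variable (hneg : ∀ X : g, X ≠ 0 → killingForm ℝ g X X < 0)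

include hneg

lemma ip_self_pos {X : g} (hX : X ≠ 0) : 0 < ip ℝ g X X := by
  simpa [ip] using hneg X hX

lemma ip_self_nonneg (X : g) : 0 ≤ ip ℝ g X X := by
  rcases eq_or_ne X 0 with rfl | hX
  · simp
  · exact (ip_self_pos hneg hX).le

lemma eq_zero_of_ip_self {X : g} (h : ip ℝ g X X = 0) : X = 0 := by
  by_contra hX
  exact (ip_self_pos hneg hX).ne' h

lemma eq_of_forall_ip {X Y : g} (h : ∀ Z, ip ℝ g X Z = ip ℝ g Y Z) : X = Y := by
  rw [← sub_eq_zero]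
  apply eq_zero_of_ip_self hneg
  simp [h]

omit hneg

variable {ι : Type*} [Fintype ι] [DecidableEq ι] {e : Module.Basis ι ℝ g}
  (he : ∀ i j, ip ℝ g (e i) (e j) = if i = j then 1 else 0)

include he

lemma sum_ip_smul (X : g) : ∑ i, ip ℝ g X (e i) • e i = X := by
  have hr : ∀ i, ip ℝ g X (e i) = e.repr X i := by
    intro i
    have h := congrArg (fun Y => ip ℝ g Y (e i)) (e.sum_repr X)
    simpa [he, ip_sum_left, -Module.Basis.sum_repr, eq_comm] using h
  simp [hr, e.sum_repr]

lemma sum_ip_mul (X Y : g) : ∑ i, ip ℝ g X (e i) * ip ℝ g Y (e i) = ip ℝ g X Y := by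
  conv_rhs => rw [← sum_ip_smul he X]
  simp only [ip_sum_left, ip_smul_left, ip_comm (e _) Y]

lemma trace_eq_sum_ip (T : Module.End ℝ g) :
    LinearMap.trace ℝ g T = ∑ i, ip ℝ g (T (e i)) (e i) := by
  have hr : ∀ X i, ip ℝ g X (e i) = e.repr X i := by
    intro X i
    have h := congrArg (fun Y => ip ℝ g Y (e i)) (e.sum_repr X)
    simpa [he, ip_sum_left, -Module.Basis.sum_repr, eq_comm] using h
  simp [LinearMap.trace_eq_matrix_trace ℝ e, Matrix.trace, LinearMap.toMatrix_apply, hr]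

lemma sum_adjoint {E : Type*} [AddCommGroup E] [Module ℝ E] (b : g →ₗ[ℝ] g →ₗ[ℝ] E)
    {M M' : g → g} (hM : ∀ X Y, ip ℝ g (M X) Y = ip ℝ g X (M' Y)) :
    ∑ i, b (M (e i)) (e i) = ∑ i, b (e i) (M' (e i)) := by
  calc ∑ i, b (M (e i)) (e i)
      = ∑ i, ∑ j, ip ℝ g (M (e i)) (e j) • b (e j) (e i) := by
        refine Finset.sum_congr rfl fun i _ => ?_
        conv_lhs => rw [← sum_ip_smul he (M (e i))]
        simp
    _ = ∑ j, ∑ i, ip ℝ g (M' (e j)) (e i) • b (e j) (e i) := by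
        rw [Finset.sum_comm]
        simp only [hM, ip_comm (e _) (M' _)]
    _ = ∑ i, b (e i) (M' (e i)) := by
        refine Finset.sum_congr rfl fun i _ => ?_
        conv_rhs => rw [← sum_ip_smul he (M' (e i))]
        simp

lemma sum_skew {E : Type*} [AddCommGroup E] [Module ℝ E] (b : g →ₗ[ℝ] g →ₗ[ℝ] E)
    {M : g → g} (hM : ∀ X Y, ip ℝ g (M X) Y = - ip ℝ g X (M Y)) :
    ∑ i, b (M (e i)) (e i) = - ∑ i, b (e i) (M (e i)) := by
  rw [sum_adjoint he b (M' := fun X => - M X) (fun X Y => by rw [hM, ip_neg_right])]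
  simp

lemma sum_lie_swap {E : Type*} [AddCommGroup E] [Module ℝ E] (b : g →ₗ[ℝ] g →ₗ[ℝ] E) (U : g) :
    ∑ i, b ⁅U, e i⁆ (e i) = - ∑ i, b (e i) ⁅U, e i⁆ :=
  sum_skew he b (M := fun X => ⁅U, X⁆) fun X Y => ip_lie_skew U X Y

lemma sum_ip_lie_lie (X Y : g) : ∑ i, ip ℝ g ⁅X, e i⁆ ⁅Y, e i⁆ = ip ℝ g X Y := by
  have h : ip ℝ g X Y = - LinearMap.trace ℝ g (ad ℝ g X ∘ₗ ad ℝ g Y) := rfl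
  rw [h, trace_eq_sum_ip he, ← Finset.sum_neg_distrib]
  refine Finset.sum_congr rfl fun i _ => ?_
  simp only [LinearMap.comp_apply, ad_apply]
  rw [ip_lie_skew X ⁅Y, e i⁆, ip_comm, neg_neg]

include hneg

lemma sum_lie_lie (X : g) : ∑ i, ⁅e i, ⁅e i, X⁆⁆ = - X := by
  refine eq_of_forall_ip hneg fun Z => ?_
  rw [ip_sum_left, ip_neg_left, ← sum_ip_lie_lie he, ← Finset.sum_neg_distrib]
  refine Finset.sum_congr rfl fun i _ => ?_
  rw [ip_lie_skew, ← lie_skew X (e i), ← lie_skew Z (e i)]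
  simp only [ip_neg_left, ip_neg_right, neg_neg]

end InnerProduct

section Simple

variable {g : Type*} [LieRing g] [LieAlgebra ℝ g] [Module.Finite ℝ g]
  (hneg : ∀ X : g, X ≠ 0 → killingForm ℝ g X X < 0)

include hneg

omit [Module.Finite ℝ g] in
lemma eq_zero_of_forall_lie {X : g} (h : ∀ Y : g, ⁅X, Y⁆ = 0) : X = 0 := by
  by_contra hX
  have had : ad ℝ g X = 0 := by ext Y; simpa using h Y
  have := hneg X hX
  rw [killingForm_apply_apply, had] at this
  simp at this

lemma exists_ip_eigenvector_mem {T : Module.End ℝ g}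
    (hT : ∀ X Y, ip ℝ g (T X) Y = ip ℝ g X (T Y)) {p : Submodule ℝ g}
    (hp : ∀ X ∈ p, T X ∈ p) (hne : p ≠ ⊥) : ∃ X ∈ p, X ≠ 0 ∧ ∃ μ : ℝ, T X = μ • X := by
  refine exists_eigenvector_mem (B := ipForm g) ?_ ?_ ?_ hp hne
  · intro X Y
    simp only [ipForm_apply, ip_comm X Y]
  · intro X hX
    simpa only [ipForm_apply] using ip_self_pos hneg hX
  · intro X Y
    simpa only [ipForm_apply] using hT X Y

lemma exists_add_lie (H Z : g) : ∃ Z₀ Z₁ : g, ⁅H, Z₀⁆ = 0 ∧ Z = Z₀ + ⁅H, Z₁⁆ := by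
  have hdisj : Disjoint (LinearMap.ker (ad ℝ g H)) (LinearMap.range (ad ℝ g H)) := by
    rw [Submodule.disjoint_def]
    rintro _ h ⟨Y, rfl⟩
    apply eq_zero_of_ip_self hneg
    simp only [LinearMap.mem_ker, ad_apply] at h
    simp [ip_lie_skew, h]
  have htop := Submodule.eq_top_of_disjoint _ _
    (by rw [add_comm, LinearMap.finrank_range_add_finrank_ker]) hdisj
  have hZ : Z ∈ LinearMap.ker (ad ℝ g H) ⊔ LinearMap.range (ad ℝ g H) := by
    rw [htop]; trivial
  obtain ⟨Z₀, h₀, _, ⟨Z₁, rfl⟩, h⟩ := Submodule.mem_sup.mp hZ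
  exact ⟨Z₀, Z₁, by simpa using h₀, by simpa using h.symm⟩

lemma even_finrank_sub_ker_ad (X : g) :
    ∃ k, Module.finrank ℝ g = 2 * k + Module.finrank ℝ (LinearMap.ker (ad ℝ g X)) := by
  have h : Even (Module.finrank ℝ (LinearMap.range (ad ℝ g X))) := by
    refine even_finrank_range_of_skew (B := ipForm g) ?_ ?_ ?_
    · intro X Y
      simp only [ipForm_apply, ip_comm X Y]
    · intro X hX
      simpa only [ipForm_apply] using ip_self_pos hneg hX
    · intro Y Z
      simpa only [ipForm_apply, ad_apply] using ip_lie_skew X Y Z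
  obtain ⟨k, hk⟩ := h
  refine ⟨k, ?_⟩
  rw [← LinearMap.finrank_range_add_finrank_ker (ad ℝ g X), hk]
  ring

lemma even_finrank_of_cartan (h : LieSubalgebra ℝ g) (hC : h.IsCartanSubalgebra)
    (h2 : Module.finrank ℝ h = 2) [IsKilling ℝ g] : Even (Module.finrank ℝ g) := by
  have hab : ∀ X Y : g, X ∈ h → Y ∈ h → ⁅X, Y⁆ = 0 := by
    intro X Y hX hY
    have : IsLieAbelian h := inferInstance
    exact congrArg Subtype.val (trivial_lie_zero h h ⟨X, hX⟩ ⟨Y, hY⟩)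
  obtain ⟨b⟩ : Nonempty (Module.Basis (Fin 2) ℝ h) := ⟨Module.finBasisOfFinrankEq ℝ h h2⟩
  set H₁ : g := (b 0 : g) with hH₁
  set H₂ : g := (b 1 : g) with hH₂
  set z := LinearMap.ker (ad ℝ g H₁) with hz
  have hp : ∀ Y ∈ z, ad ℝ g H₂ Y ∈ z := by
    intro Y hY
    simp only [hz, LinearMap.mem_ker, ad_apply] at hY ⊢
    rw [leibniz_lie, hY, hab H₁ H₂ (b 0).2 (b 1).2]
    simp
  have hev : Even (Module.finrank ℝ (LinearMap.range ((ad ℝ g H₂).restrict hp))) := by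
    refine even_finrank_range_of_skew (B := (ipForm g).domRestrict₁₂ z z) ?_ ?_ ?_
    · intro X Y
      change ipForm g X Y = ipForm g Y X
      simp only [ipForm_apply, ip_comm (X : g) Y]
    · intro X hX
      change 0 < ipForm g X X
      simpa only [ipForm_apply] using ip_self_pos hneg (by simpa using hX)
    · intro X Y
      change ipForm g (ad ℝ g H₂ X) Y = - ipForm g X (ad ℝ g H₂ Y)
      simpa only [ipForm_apply, ad_apply] using ip_lie_skew H₂ X Y
  have hker : (LinearMap.ker ((ad ℝ g H₂).restrict hp)).map z.subtype = h.toSubmodule := by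
    ext Y
    constructor
    · rintro ⟨⟨Y, hY₁⟩, hY₂, rfl⟩
      simp only [hz, LinearMap.mem_ker, ad_apply] at hY₁
      have hY₂' : ⁅H₂, Y⁆ = 0 := congrArg Subtype.val (LinearMap.mem_ker.mp hY₂)
      change Y ∈ h
      have hn : Y ∈ h.normalizer := by
        rw [LieSubalgebra.mem_normalizer_iff']
        intro X hX
        have hX' : X = b.repr ⟨X, hX⟩ 0 • H₁ + b.repr ⟨X, hX⟩ 1 • H₂ := by
          have := b.sum_repr ⟨X, hX⟩
          rw [Fin.sum_univ_two] at this
          exact (congrArg Subtype.val this).symm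
        rw [hX', add_lie, smul_lie, smul_lie, hY₁, hY₂']
        simp
      rwa [hC.self_normalizing] at hn
    · intro hY
      have hY₁ : ⁅H₁, Y⁆ = 0 := hab _ _ (b 0).2 hY
      have hY₂ : ⁅H₂, Y⁆ = 0 := hab _ _ (b 1).2 hY
      exact ⟨⟨Y, by simpa [hz] using hY₁⟩, LinearMap.mem_ker.mpr (Subtype.ext hY₂), rfl⟩
  have hk2 : Module.finrank ℝ (LinearMap.ker ((ad ℝ g H₂).restrict hp)) = 2 := by
    rw [← h2, ← Submodule.finrank_map_subtype_eq, hker]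
    rfl
  obtain ⟨k, hk⟩ := even_finrank_sub_ker_ad hneg H₁
  obtain ⟨l, hl⟩ := hev
  rw [← hz] at hk
  have := LinearMap.finrank_range_add_finrank_ker ((ad ℝ g H₂).restrict hp)
  exact ⟨k + l + 1, by omega⟩

variable [IsSimple ℝ g]

lemma exists_eq_smul_of_commute_ad {T : Module.End ℝ g}
    (hT : ∀ X Y, ip ℝ g (T X) Y = ip ℝ g X (T Y)) (hc : ∀ X Y : g, T ⁅X, Y⁆ = ⁅X, T Y⁆) :
    ∃ c : ℝ, ∀ X, T X = c • X := by
  rcases subsingleton_or_nontrivial g with hs | hn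
  · exact ⟨0, fun X => Subsingleton.elim _ _⟩
  obtain ⟨X, -, hX, c, hTX⟩ := exists_ip_eigenvector_mem hneg hT (p := ⊤) (by simp) top_ne_bot
  refine ⟨c, fun Y => ?_⟩
  let I : LieIdeal ℝ g :=
    { Module.End.eigenspace T c with
      lie_mem := by
        intro Y Z hZ
        have hZ' : T Z = c • Z := Module.End.mem_eigenspace_iff.mp hZ
        refine Module.End.mem_eigenspace_iff.mpr ?_
        rw [hc, hZ', lie_smul] }
  have hI : ∀ Z, Z ∈ I ↔ T Z = c • Z := fun Z => Module.End.mem_eigenspace_iff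
  rcases IsSimple.eq_bot_or_eq_top I with h | h
  · exact absurd ((LieSubmodule.mem_bot X).mp (h ▸ (hI X).mpr hTX)) hX
  · exact (hI Y).mp (h ▸ LieSubmodule.mem_top Y)

lemma eq_zero_or_eq_zero_of_lie_lie {H₁ H₂ : g} (h : ∀ X : g, ⁅H₁, ⁅H₂, X⁆⁆ = 0)
    (hcomm : ⁅H₁, H₂⁆ = 0) : H₁ = 0 ∨ H₂ = 0 := by
  have h' : ∀ X : g, ⁅H₂, ⁅H₁, X⁆⁆ = 0 := by
    intro X
    rw [leibniz_lie, h, ← lie_skew H₂ H₁, hcomm]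
    simp
  have hmem : ∀ Y X : g, ⁅⁅H₂, Y⁆, ⁅H₁, X⁆⁆ = 0 := by
    intro Y X
    obtain ⟨X₀, X₁, h₀, rfl⟩ := exists_add_lie hneg H₁ X
    have h1 := h ⁅⁅H₁, X₁⁆, Y⁆
    simp only [leibniz_lie H₂ ⁅H₁, X₁⁆, h', zero_lie, zero_add] at h1
    rw [leibniz_lie H₁, h, lie_zero, add_zero] at h1
    rw [lie_add, h₀, zero_add, ← lie_skew, h1, neg_zero]
  let c : LieIdeal ℝ g :=
    { carrier := {W | ∀ X : g, ⁅W, ⁅H₁, X⁆⁆ = 0}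
      add_mem' := by
        intro a b ha hb X
        rw [add_lie, ha, hb, add_zero]
      zero_mem' := by intro X; simp
      smul_mem' := by
        intro r a ha X
        rw [smul_lie, ha, smul_zero]
      lie_mem := by
        intro Z W hW X
        change ∀ X : g, ⁅W, ⁅H₁, X⁆⁆ = 0 at hW
        obtain ⟨Z₀, Z₁, h₀, rfl⟩ := exists_add_lie hneg H₁ Z
        have hZ₀ : ⁅Z₀, ⁅H₁, X⁆⁆ = ⁅H₁, ⁅Z₀, X⁆⁆ := by
          rw [leibniz_lie H₁, h₀, zero_lie, zero_add]
        rw [lie_lie, hW, lie_zero, zero_sub, add_lie, lie_add, hZ₀, hW,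
          leibniz_lie W, hW, hW]
        simp }
  rcases IsSimple.eq_bot_or_eq_top c with hc | hc
  · right
    refine eq_zero_of_forall_lie hneg fun Y => ?_
    have : ⁅H₂, Y⁆ ∈ c := hmem Y
    rwa [hc, LieSubmodule.mem_bot] at this
  · left
    refine eq_zero_of_forall_lie hneg fun X => ?_
    refine eq_zero_of_forall_lie hneg fun W => ?_
    have : W ∈ c := hc ▸ LieSubmodule.mem_top W
    rw [← lie_skew, this X, neg_zero]

section Twisted

variable {A : Module.End ℝ g} {γ : ℝ} (hA : ∀ X Y, ip ℝ g (A X) Y = ip ℝ g X (A Y))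
  (hγ : ∀ X Y : g, A ⁅X, Y⁆ + ⁅X, A Y⁆ + ⁅A X, Y⁆ = γ • ⁅X, Y⁆)

include hγ

omit hneg [Module.Finite ℝ g] [IsSimple ℝ g] in
lemma apply_lie_of_eigenvector {X : g} {a : ℝ} (hX : A X = a • X) (Y : g) :
    A ⁅X, Y⁆ = (γ - a) • ⁅X, Y⁆ - ⁅X, A Y⁆ := by
  have h := hγ X Y
  rw [hX, smul_lie] at h
  rw [sub_smul, ← h]
  abel

omit hneg [Module.Finite ℝ g] [IsSimple ℝ g] in
lemma apply_lie_lie_of_eigenvector {X Y : g} {a b : ℝ} (hX : A X = a • X) (hY : A Y = b • Y)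
    (Z : g) : A ⁅X, ⁅Y, Z⁆⁆ = (b - a) • ⁅X, ⁅Y, Z⁆⁆ + ⁅X, ⁅Y, A Z⁆⁆ := by
  rw [apply_lie_of_eigenvector hγ hX, apply_lie_of_eigenvector hγ hY, lie_sub, lie_smul]
  module

lemma eigenvalue_eq_of_lie_eq_zero {X Y : g} {a b : ℝ} (hX : A X = a • X) (hY : A Y = b • Y)
    (hX0 : X ≠ 0) (hY0 : Y ≠ 0) (hXY : ⁅X, Y⁆ = 0) : a = b := by
  by_contra hab
  have hswap : ∀ Z : g, ⁅X, ⁅Y, Z⁆⁆ = ⁅Y, ⁅X, Z⁆⁆ := by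
    intro Z
    rw [leibniz_lie, hXY, zero_lie, zero_add]
  have hz : ∀ Z : g, ⁅X, ⁅Y, Z⁆⁆ = 0 := by
    intro Z
    have h1 := apply_lie_lie_of_eigenvector hγ hX hY Z
    have h2 := apply_lie_lie_of_eigenvector hγ hY hX Z
    rw [← hswap, ← hswap, h1] at h2
    have h3 : (2 * (b - a)) • ⁅X, ⁅Y, Z⁆⁆ = 0 := by
      rw [← sub_eq_zero] at h2
      rw [← h2]
      module
    refine (smul_eq_zero.mp h3).resolve_left ?_
    intro h
    exact hab (by linarith)
  rcases eq_zero_or_eq_zero_of_lie_lie hneg hz hXY with h | h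
  · exact hX0 h
  · exact hY0 h

include hA

/-- A symmetric endomorphism preserving the Cartan three-form up to scale is a homothety, as soon
as the algebra has even dimension. -/
lemma eq_smul_of_twisted_derivation (heven : Even (Module.finrank ℝ g)) :
    ∃ c : ℝ, ∀ X, A X = c • X := by
  rcases subsingleton_or_nontrivial g with hs | hn
  · exact ⟨0, fun X => Subsingleton.elim _ _⟩
  obtain ⟨X, -, hX0, a, hX⟩ := exists_ip_eigenvector_mem hneg hA (p := ⊤) (by simp) top_ne_bot
  refine ⟨a, ?_⟩
  by_contra hscal
  obtain ⟨X', ⟨hXX', hort⟩, hX'0, a', hX'⟩ : ∃ X' ∈ LinearMap.ker (ad ℝ g X) ⊓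
      LinearMap.ker (ipForm g X), X' ≠ 0 ∧ ∃ a' : ℝ, A X' = a' • X' := by
    refine exists_ip_eigenvector_mem hneg hA ?_ ?_
    · rintro Y ⟨h1, h2⟩
      simp only [LinearMap.mem_ker, ad_apply, SetLike.mem_coe, ipForm_apply] at h1 h2
      refine ⟨?_, ?_⟩
      · have := apply_lie_of_eigenvector hγ hX Y
        rw [h1, map_zero, smul_zero, zero_sub, eq_comm, neg_eq_zero] at this
        simpa using this
      · simp [ipForm_apply, ← hA, hX, h2]
    · intro hbot
      obtain ⟨k, hk⟩ := even_finrank_sub_ker_ad hneg X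
      obtain ⟨l, hl⟩ := heven
      have h1 := Submodule.finrank_sup_add_finrank_inf_eq
        (LinearMap.ker (ad ℝ g X)) (LinearMap.ker (ipForm g X))
      rw [hbot, finrank_bot] at h1
      have h2 := Submodule.finrank_le (LinearMap.ker (ad ℝ g X) ⊔ LinearMap.ker (ipForm g X))
      have h3 := LinearMap.finrank_range_add_finrank_ker (ipForm g X)
      have h4 := Submodule.finrank_le (LinearMap.range (ipForm g X))
      rw [Module.finrank_self] at h4
      have h5 : 1 ≤ Module.finrank ℝ (LinearMap.ker (ad ℝ g X)) := by
        rw [Submodule.one_le_finrank_iff, Submodule.ne_bot_iff]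
        exact ⟨X, by simp, hX0⟩
      omega
  simp only [LinearMap.mem_ker, ad_apply, SetLike.mem_coe, ipForm_apply] at hXX' hort
  obtain rfl := eigenvalue_eq_of_lie_eq_zero hneg hγ hX hX' hX0 hX'0 hXX'
  obtain ⟨b, hab, Y₁, hY₁, hY₁0⟩ : ∃ b : ℝ, b ≠ a ∧ ∃ Y, A Y = b • Y ∧ Y ≠ 0 := by
    obtain ⟨Y, ⟨U, hU⟩, hY0, b, hY⟩ := exists_ip_eigenvector_mem hneg hA
      (p := LinearMap.range (A - a • LinearMap.id)) (by
        rintro _ ⟨U, rfl⟩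
        exact ⟨A U, by simp⟩) (by
        intro h
        apply hscal
        intro Z
        have := LinearMap.congr_fun (LinearMap.range_eq_bot.mp h) Z
        simpa [sub_eq_zero] using this)
    refine ⟨b, ?_, Y, hY, hY0⟩
    rintro rfl
    apply hY0
    apply eq_zero_of_ip_self hneg
    nth_rw 1 [← hU]
    simp [hA, hY]
  have hcomm : ∀ Z : g, ⁅X', ⁅X, Z⁆⁆ = ⁅X, ⁅X', Z⁆⁆ := by
    intro Z
    rw [leibniz_lie X, hXX', zero_lie, zero_add]
  have hpres : ∀ {H H' : g}, A H = a • H → A H' = a • H' → ∀ Y, A Y = b • Y →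
      A ⁅H, ⁅H', Y⁆⁆ = b • ⁅H, ⁅H', Y⁆⁆ := by
    intro H H' h h' Y hY
    rw [apply_lie_lie_of_eigenvector hγ h h', hY, lie_smul, lie_smul, sub_self, zero_smul, zero_add]
  obtain ⟨Y₂, hY₂, hY₂0, p, hp⟩ := exists_ip_eigenvector_mem hneg
    (T := ad ℝ g X ∘ₗ ad ℝ g X) (p := Module.End.eigenspace A b)
    (by intro U V; simp [ip_lie_skew]) (by
      intro U hU
      rw [Module.End.mem_eigenspace_iff] at hU ⊢
      exact hpres hX hX U hU) (by
      intro h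
      apply hY₁0
      have : Y₁ ∈ Module.End.eigenspace A b := Module.End.mem_eigenspace_iff.mpr hY₁
      rwa [h] at this)
  obtain ⟨Y, ⟨hY, hYp⟩, hY0, q, hq⟩ := exists_ip_eigenvector_mem hneg
    (T := ad ℝ g X ∘ₗ ad ℝ g X')
    (p := Module.End.eigenspace A b ⊓ Module.End.eigenspace (ad ℝ g X ∘ₗ ad ℝ g X) p)
    (by intro U V; simp [ip_lie_skew, hcomm]) (by
      rintro U ⟨hU, hUp⟩
      simp only [SetLike.mem_coe, Module.End.mem_eigenspace_iff, LinearMap.comp_apply,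
        ad_apply] at hU hUp
      refine ⟨?_, ?_⟩
      · simp only [SetLike.mem_coe, Module.End.mem_eigenspace_iff]
        exact hpres hX hX' U hU
      · simp only [SetLike.mem_coe, Module.End.mem_eigenspace_iff, LinearMap.comp_apply,
          ad_apply]
        rw [← hcomm U, ← hcomm, ← hcomm, hUp, lie_smul, lie_smul]) (by
      intro h
      apply hY₂0
      have : Y₂ ∈ Module.End.eigenspace A b ⊓ Module.End.eigenspace (ad ℝ g X ∘ₗ ad ℝ g X) p :=
        ⟨hY₂, Module.End.mem_eigenspace_iff.mpr hp⟩
      rwa [h] at this)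
  simp only [SetLike.mem_coe, Module.End.mem_eigenspace_iff, LinearMap.comp_apply,
    ad_apply] at hY hYp hq
  have hp0 : p ≠ 0 := by
    rintro rfl
    have hXY : ⁅X, Y⁆ = 0 := by
      apply eq_zero_of_ip_self hneg
      rw [ip_lie_skew, hYp]
      simp
    exact hab (eigenvalue_eq_of_lie_eq_zero hneg hγ hX hY hX0 hY0 hXY).symm
  set W := p • X' - q • X with hW
  have hAW : A W = a • W := by
    rw [hW, map_sub, map_smul, map_smul, hX, hX']
    module
  have hW0 : W ≠ 0 := by
    intro h
    have h1 : ip ℝ g X' W = 0 := by rw [h, ip_zero_right]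
    rw [hW, ip_sub_right, ip_smul_right, ip_smul_right, ip_comm X' X, hort, mul_zero, sub_zero]
      at h1
    exact (mul_ne_zero hp0 (ip_self_pos hneg hX'0).ne') h1
  have hXW : ⁅X, W⁆ = 0 := by
    rw [hW, lie_sub, lie_smul, lie_smul, hXX', lie_self]
    simp
  have hXWY : ⁅X, ⁅W, Y⁆⁆ = 0 := by
    rw [hW, sub_lie, smul_lie, smul_lie, lie_sub, lie_smul, lie_smul, hq, hYp]
    module
  have hWY : ⁅W, Y⁆ = 0 := by
    have h1 : ∀ Z : g, ⁅X, ⁅W, Z⁆⁆ = ⁅W, ⁅X, Z⁆⁆ := by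
      intro Z
      rw [leibniz_lie, hXW, zero_lie, zero_add]
    have h2 : p • ⁅W, Y⁆ = 0 := by
      rw [← lie_smul, ← hYp, ← h1, ← h1, hXWY, lie_zero]
    exact (smul_eq_zero.mp h2).resolve_left hp0
  exact hab (eigenvalue_eq_of_lie_eq_zero hneg hγ hAW hY hW0 hY0 hWY).symm

end Twisted

end Simple

section Curvature

variable {g : Type*} [LieRing g] [LieAlgebra ℝ g]
  (hneg : ∀ X : g, X ≠ 0 → killingForm ℝ g X X < 0)

include hneg

lemma eq_of_forall_ip_lie {X Y : g} (h : ∀ C D : g, ip ℝ g X ⁅C, D⁆ = ip ℝ g Y ⁅C, D⁆) :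
    X = Y := by
  rw [← sub_eq_zero]
  refine eq_zero_of_forall_lie hneg fun C => eq_of_forall_ip hneg fun D => ?_
  rw [ip_lie_left, ip_sub_left, h]
  simp

/-- A curvature tensor with values in the adjoint representation factors through the bracket. -/
lemma exists_factor_of_bianchi {ι : Type*} [Fintype ι] [DecidableEq ι] {e : Module.Basis ι ℝ g}
    (he : ∀ i j, ip ℝ g (e i) (e j) = if i = j then 1 else 0)
    {ψ : g →ₗ[ℝ] g →ₗ[ℝ] g} (halt : ∀ X Y, ψ X Y = - ψ Y X)
    (hb : ∀ X Y Z : g, ⁅ψ X Y, Z⁆ + ⁅ψ Y Z, X⁆ + ⁅ψ Z X, Y⁆ = 0) :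
    ∃ S : Module.End ℝ g, (∀ X Y, ip ℝ g (S X) Y = ip ℝ g X (S Y)) ∧
      ∀ X Y, ψ X Y = S ⁅X, Y⁆ := by
  have hpair : ∀ X Y Z W : g, ip ℝ g (ψ X Y) ⁅Z, W⁆ = ip ℝ g (ψ Z W) ⁅X, Y⁆ := by
    have h1 : ∀ X Y Z W : g, ip ℝ g (ψ X Y) ⁅Z, W⁆ + ip ℝ g (ψ Y Z) ⁅X, W⁆
        + ip ℝ g (ψ Z X) ⁅Y, W⁆ = 0 := by
      intro X Y Z W
      have := congrArg (fun V => ip ℝ g V W) (hb X Y Z)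
      simpa [ip_lie_left] using this
    have h2 : ∀ X Y Z W : g, ip ℝ g (ψ X Y) ⁅Z, W⁆ = - ip ℝ g (ψ Y X) ⁅Z, W⁆ := by
      intro X Y Z W
      rw [halt, ip_neg_left]
    have h3 : ∀ X Y Z W : g, ip ℝ g (ψ X Y) ⁅Z, W⁆ = - ip ℝ g (ψ X Y) ⁅W, Z⁆ := by
      intro X Y Z W
      rw [← lie_skew, ip_neg_right]
    intro X Y Z W
    linarith [h1 X Y Z W, h1 Y Z W X, h1 Z W X Y, h1 W X Y Z, h3 X Y Z W, h3 Y Z X W, h3 Z X Y W,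
      h3 Y Z W X, h3 Z W Y X, h3 W Y Z X, h3 Z W X Y, h3 W X Z Y, h3 X Z W Y, h3 W X Y Z,
      h3 X Y W Z, h3 Y W X Z, h2 X Z Y W, h2 Y W X Z, h2 X Z W Y, h2 Y W Z X]
  let S : Module.End ℝ g := - ∑ i, ψ (e i) ∘ₗ ad ℝ g (e i)
  have hS : ∀ U, S U = - ∑ i, ψ (e i) ⁅e i, U⁆ := by intro U; simp [S]
  have hSψ : ∀ U C D : g, ip ℝ g (S U) ⁅C, D⁆ = ip ℝ g (ψ C D) U := by
    intro U C D
    rw [hS, ip_neg_left, ip_sum_left]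
    simp only [hpair _ _ C D]
    rw [← ip_sum_right, sum_lie_lie hneg he, ip_neg_right, neg_neg]
  refine ⟨S, fun X Y => ?_, fun X Y => ?_⟩
  · have h1 : Y = - ∑ i, ⁅e i, ⁅e i, Y⁆⁆ := by rw [sum_lie_lie hneg he, neg_neg]
    conv_lhs => rw [h1]
    rw [ip_neg_right, ip_sum_right]
    simp only [hSψ]
    rw [← ip_sum_left, ← ip_neg_left, ← hS, ip_comm]
  · refine eq_of_forall_ip_lie hneg fun C D => ?_
    rw [hSψ, hpair]

/-- The symmetric endomorphism underlying a curvature tensor with values in the adjoint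
representation is a twisted derivation of the bracket. -/
lemma exists_twisted_of_bianchi [Module.Finite ℝ g] [IsSimple ℝ g] {ι : Type*} [Fintype ι]
    [DecidableEq ι] {e : Module.Basis ι ℝ g}
    (he : ∀ i j, ip ℝ g (e i) (e j) = if i = j then 1 else 0) {S : Module.End ℝ g}
    (hS : ∀ X Y, ip ℝ g (S X) Y = ip ℝ g X (S Y))
    (hb : ∀ X Y Z : g, ⁅S ⁅X, Y⁆, Z⁆ + ⁅S ⁅Y, Z⁆, X⁆ + ⁅S ⁅Z, X⁆, Y⁆ = 0) :
    ∃ γ : ℝ, ∀ X Y : g, S ⁅X, Y⁆ + ⁅X, S Y⁆ + ⁅S X, Y⁆ = γ • ⁅X, Y⁆ := by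
  have hp : ∀ Z U : g, (2 : ℝ) • ∑ i, ⁅e i, S ⁅Z, ⁅U, e i⁆⁆⁆ = - ⁅S U, Z⁆ := by
    intro Z U
    have h0 : ∑ i, (⁅S ⁅⁅U, e i⁆, e i⁆, Z⁆ + ⁅S ⁅e i, Z⁆, ⁅U, e i⁆⁆ + ⁅S ⁅Z, ⁅U, e i⁆⁆, e i⁆)
        = 0 := Finset.sum_eq_zero fun i _ => hb _ _ _
    have h1 : ∑ i, ⁅S ⁅⁅U, e i⁆, e i⁆, Z⁆ = - ⁅S U, Z⁆ := by
      have h : ∀ i, ⁅S ⁅⁅U, e i⁆, e i⁆, Z⁆ = ⁅S ⁅e i, ⁅e i, U⁆⁆, Z⁆ := by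
        intro i
        rw [← lie_skew (e i) ⁅e i, U⁆, ← lie_skew U (e i), neg_lie]
      simp only [h]
      rw [← sum_lie, ← map_sum, sum_lie_lie hneg he, map_neg, neg_lie]
    have h2 : ∑ i, ⁅S ⁅e i, Z⁆, ⁅U, e i⁆⁆ = ∑ i, ⁅S ⁅Z, ⁅U, e i⁆⁆, e i⁆ := by
      have := sum_lie_swap he (LinearMap.mk₂ ℝ (fun x y => ⁅S ⁅y, Z⁆, x⁆) (by intros; simp)
        (by intros; simp) (by intros; simp) (by intros; simp)) U
      simp only [LinearMap.mk₂_apply] at this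
      rw [this, ← Finset.sum_neg_distrib]
      refine Finset.sum_congr rfl fun i _ => ?_
      rw [← lie_skew Z, map_neg, neg_lie]
    have h3 : ∑ i, ⁅e i, S ⁅Z, ⁅U, e i⁆⁆⁆ = - ∑ i, ⁅S ⁅Z, ⁅U, e i⁆⁆, e i⁆ := by
      rw [← Finset.sum_neg_distrib]
      exact Finset.sum_congr rfl fun i _ => (lie_skew _ _).symm
    rw [Finset.sum_add_distrib, Finset.sum_add_distrib, h1, h2] at h0
    rw [h3, ← sub_eq_zero, ← neg_eq_zero, ← h0]
    module
  let P : Module.End ℝ g := - ∑ i, ad ℝ g (e i) ∘ₗ S ∘ₗ ad ℝ g (e i)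
  have hP : ∀ V, P V = ∑ i, ⁅e i, S ⁅V, e i⁆⁆ := by
    intro V
    simp only [P, LinearMap.neg_apply, LinearMap.sum_apply, LinearMap.comp_apply, ad_apply,
      ← Finset.sum_neg_distrib]
    refine Finset.sum_congr rfl fun i _ => ?_
    rw [← lie_skew V, map_neg, lie_neg]
  have hPs : ∀ V W, ip ℝ g (P V) W = ip ℝ g V (P W) := by
    intro V W
    rw [hP, hP, ip_sum_left, ip_sum_right]
    refine Finset.sum_congr rfl fun i _ => ?_
    rw [ip_comm V, ip_lie_skew, ip_lie_skew, hS, ← lie_skew (e i) W, ← lie_skew (e i) V,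
      map_neg, ip_neg_right, ip_neg_right, ip_comm]
  have hP1 : ∀ Z V : g, (2 : ℝ) • P ⁅Z, V⁆ = ⁅S Z, V⁆ + ⁅Z, S V⁆ := by
    intro Z V
    have h1 : P ⁅Z, V⁆ = ∑ i, ⁅e i, S ⁅Z, ⁅V, e i⁆⁆⁆ - ∑ i, ⁅e i, S ⁅V, ⁅Z, e i⁆⁆⁆ := by
      rw [hP, ← Finset.sum_sub_distrib]
      refine Finset.sum_congr rfl fun i _ => ?_
      rw [lie_lie, map_sub, lie_sub]
    rw [h1, smul_sub, hp, hp, ← lie_skew Z (S V)]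
    abel
  have hP2 : ∀ Z V : g, (2 : ℝ) • ⁅Z, P V⁆ = ⁅S Z, V⁆ + S ⁅Z, V⁆ := by
    intro Z V
    refine eq_of_forall_ip hneg fun U => ?_
    have h := congrArg (fun W => ip ℝ g V W) (hP1 Z U)
    simp only [ip_smul_right, ip_add_right] at h
    rw [ip_smul_left, ip_lie_skew, hPs, ip_add_left, ip_lie_skew, hS, ip_lie_skew Z V]
    linarith
  obtain ⟨γ, hγ⟩ := exists_eq_smul_of_commute_ad hneg (T := (2 : ℝ) • P + S)
    (by intro X Y; simp [hPs, hS]) (by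
      intro X Y
      simp only [LinearMap.add_apply, LinearMap.smul_apply, lie_add, lie_smul, hP1, hP2]
      abel)
  refine ⟨γ, fun X Y => ?_⟩
  rw [← hγ, LinearMap.add_apply, LinearMap.smul_apply, hP1]
  abel

lemma eq_smul_lie_of_bianchi [Module.Finite ℝ g] [IsSimple ℝ g] {ι : Type*} [Fintype ι]
    [DecidableEq ι] {e : Module.Basis ι ℝ g}
    (he : ∀ i j, ip ℝ g (e i) (e j) = if i = j then 1 else 0)
    (heven : Even (Module.finrank ℝ g))
    {ψ : g →ₗ[ℝ] g →ₗ[ℝ] g} (halt : ∀ X Y, ψ X Y = - ψ Y X)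
    (hb : ∀ X Y Z : g, ⁅ψ X Y, Z⁆ + ⁅ψ Y Z, X⁆ + ⁅ψ Z X, Y⁆ = 0) :
    ∃ s : ℝ, ∀ X Y : g, ψ X Y = s • ⁅X, Y⁆ := by
  obtain ⟨S, hS, hψ⟩ := exists_factor_of_bianchi hneg he halt hb
  simp only [hψ] at hb
  obtain ⟨γ, hγ⟩ := exists_twisted_of_bianchi hneg he hS hb
  obtain ⟨s, hs⟩ := eq_smul_of_twisted_derivation hneg hS hγ heven
  exact ⟨s, fun X Y => by rw [hψ, hs]⟩

end Curvature

section Reduction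

variable {g : Type*} [LieRing g] [LieAlgebra ℝ g]

lemma trace_ad_comp_ad (V U : g) :
    LinearMap.trace ℝ g (ad ℝ g V ∘ₗ ad ℝ g U) = - ip ℝ g V U := by
  rw [ip, neg_neg]
  rfl

lemma trace_lie_comp_ad {T : Module.End ℝ g}
    (hT : ∀ U : g, LinearMap.trace ℝ g (T ∘ₗ ad ℝ g U) = 0) (W U : g) :
    LinearMap.trace ℝ g (⁅ad ℝ g W, T⁆ ∘ₗ ad ℝ g U) = 0 := by
  have h := hT ⁅U, W⁆
  have h1 : ad ℝ g ⁅U, W⁆ = ad ℝ g U * ad ℝ g W - ad ℝ g W * ad ℝ g U := by ext; simp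
  have h2 : ⁅ad ℝ g W, T⁆ = ad ℝ g W * T - T * ad ℝ g W := rfl
  simp only [h1, h2, ← Module.End.mul_eq_comp, mul_sub, sub_mul, map_sub] at h ⊢
  rw [← h, mul_assoc, LinearMap.trace_mul_comm, mul_assoc, mul_assoc]

lemma trace_wedge_comp_ad {ι : Type*} [Fintype ι] [DecidableEq ι] {e : Module.Basis ι ℝ g}
    (he : ∀ i j, ip ℝ g (e i) (e j) = if i = j then 1 else 0) (A B U : g) :
    LinearMap.trace ℝ g (wedge ℝ g A B ∘ₗ ad ℝ g U) = - 2 * ip ℝ g ⁅A, B⁆ U := by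
  rw [trace_eq_sum_ip he]
  simp only [LinearMap.comp_apply, ad_apply, wedge_apply, ip_sub_left, ip_smul_left,
    ← ip_lie_left, Finset.sum_sub_distrib]
  rw [sum_ip_mul he, sum_ip_mul he, ip_lie_left A U B, ip_lie_left B U A, ip_lie_left A B U,
    ip_comm B, ip_lie_skew U A B, ← lie_skew B U, ip_neg_right]
  ring

variable [Module.Finite ℝ g] [IsSimple ℝ g]

/-- Under the trace condition, `K` is determined by `Φ`. -/
lemma ip_eq_two_mul_ip_of_trace_eq_zero (hneg : ∀ X : g, X ≠ 0 → killingForm ℝ g X X < 0)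
    {ι : Type*} [Fintype ι] [DecidableEq ι] [Nonempty ι] {e : Module.Basis ι ℝ g}
    (he : ∀ i j, ip ℝ g (e i) (e j) = if i = j then 1 else 0)
    (heven : Even (Module.finrank ℝ g))
    {K : g →ₗ[ℝ] Module.End ℝ g} {Φ : g →ₗ[ℝ] g →ₗ[ℝ] g}
    (hskew : ∀ Z X Y : g, ip ℝ g (K Z X) Y + ip ℝ g X (K Z Y) = 0)
    (htr : ∀ Z U : g, LinearMap.trace ℝ g (K Z ∘ₗ ad ℝ g U) = 0)
    (hΦ : ∀ X Y : g, Φ X Y = - Φ Y X)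
    (hi : ∀ X Y Z : g, ip ℝ g (Φ X Y) Z + ip ℝ g (Φ Y Z) X + ip ℝ g (Φ Z X) Y = 0)
    (hii : ∀ X Y Z : g,
      (⁅ad ℝ g ⁅X, Y⁆, K Z⁆ + ad ℝ g ⁅K X Y - K Y X, Z⁆ + wedge ℝ g (Φ X Y) Z)
      + (⁅ad ℝ g ⁅Y, Z⁆, K X⁆ + ad ℝ g ⁅K Y Z - K Z Y, X⁆ + wedge ℝ g (Φ Y Z) X)
      + (⁅ad ℝ g ⁅Z, X⁆, K Y⁆ + ad ℝ g ⁅K Z X - K X Z, Y⁆ + wedge ℝ g (Φ Z X) Y) = 0)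
    (X Y Z : g) : ip ℝ g (K X Y) Z = 2 * ip ℝ g (Φ Y Z) X := by
  let K' : g →ₗ[ℝ] g →ₗ[ℝ] g := K
  let ψ : g →ₗ[ℝ] g →ₗ[ℝ] g := K' - K'.flip + (2 : ℝ) • Φ
  have hψ : ∀ X Y, ψ X Y = K X Y - K Y X + (2 : ℝ) • Φ X Y := fun X Y => rfl
  obtain ⟨s, hs⟩ : ∃ s : ℝ, ∀ X Y : g, ψ X Y = s • ⁅X, Y⁆ := by
    refine eq_smul_lie_of_bianchi hneg he heven (fun X Y => ?_) fun X Y Z => ?_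
    · rw [hψ, hψ, hΦ X Y]
      module
    · refine eq_of_forall_ip hneg fun U => ?_
      have h := congrArg (fun T : Module.End ℝ g => LinearMap.trace ℝ g (T ∘ₗ ad ℝ g U))
        (hii X Y Z)
      simp only [LinearMap.add_comp, map_add, trace_lie_comp_ad (htr _), trace_ad_comp_ad,
        trace_wedge_comp_ad he, LinearMap.zero_comp, map_zero] at h
      simp only [hψ, add_lie, smul_lie, ip_add_left, ip_smul_left, ip_zero_left]
      linarith
  have hK : ∀ X Y Z, ip ℝ g (K X Y) Z = s / 2 * ip ℝ g ⁅X, Y⁆ Z + 2 * ip ℝ g (Φ Y Z) X := by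
    intro X Y Z
    have h1 : ∀ X Y Z, ip ℝ g (K X Y) Z - ip ℝ g (K Y X) Z
        = s * ip ℝ g ⁅X, Y⁆ Z - 2 * ip ℝ g (Φ X Y) Z := by
      intro X Y Z
      have h := congrArg (fun V => ip ℝ g V Z) (hs X Y)
      simp only [hψ, ip_add_left, ip_sub_left, ip_smul_left] at h
      linarith
    have h2 : ip ℝ g ⁅Y, Z⁆ X = ip ℝ g ⁅X, Y⁆ Z := by rw [ip_lie_left X, ip_comm]
    have h3 : ip ℝ g ⁅Z, X⁆ Y = ip ℝ g ⁅X, Y⁆ Z := by rw [ip_lie_left Z, ip_comm]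
    have h4 : ∀ X Y Z, ip ℝ g (K X Y) Z = - ip ℝ g (K X Z) Y := by
      intro X Y Z
      linarith [hskew X Y Z, ip_comm Y (K X Z)]
    have a := h1 X Y Z
    have b := h1 Y Z X
    have c := h1 Z X Y
    rw [h2] at b
    rw [h3] at c
    linarith [h4 X Y Z, h4 Y Z X, h4 Z X Y, hi X Y Z]
  have hs0 : s = 0 := by
    have hQ : ∑ i, ∑ j, ip ℝ g (Φ ⁅e i, e j⁆ (e j)) (e i) = 0 := by
      have h1 : ∑ i, ∑ j, ip ℝ g (Φ (e i) ⁅e i, e j⁆) (e j)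
          = ∑ i, ∑ j, ip ℝ g (Φ ⁅e i, e j⁆ (e j)) (e i) := by
        rw [Finset.sum_comm]
        refine Finset.sum_congr rfl fun i _ => Finset.sum_congr rfl fun j _ => ?_
        rw [hΦ, ← lie_skew (e i) (e j), map_neg, LinearMap.neg_apply]
      have h2 : ∑ i, ∑ j, ip ℝ g (Φ (e j) (e i)) ⁅e i, e j⁆
          = ∑ i, ∑ j, ip ℝ g (Φ (e i) ⁅e i, e j⁆) (e j) := by
        refine Finset.sum_congr rfl fun i _ => ?_
        have := sum_lie_swap he (LinearMap.mk₂ ℝ (fun x y => ip ℝ g (Φ (e i) y) x)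
          (by intros; simp) (by intros; simp) (by intros; simp) (by intros; simp)) (e i)
        simp only [LinearMap.mk₂_apply] at this
        simp only [hΦ _ (e i), ip_neg_left, Finset.sum_neg_distrib]
        rw [this, neg_neg]
      have h3 : ∑ i, ∑ j, (ip ℝ g (Φ ⁅e i, e j⁆ (e j)) (e i) + ip ℝ g (Φ (e j) (e i)) ⁅e i, e j⁆
          + ip ℝ g (Φ (e i) ⁅e i, e j⁆) (e j)) = 0 :=
        Finset.sum_eq_zero fun i _ => Finset.sum_eq_zero fun j _ => hi _ _ _
      simp only [Finset.sum_add_distrib] at h3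
      linarith
    have h4 : ∑ i, ∑ j, ip ℝ g (K (e i) ⁅e i, e j⁆) (e j) = 0 := by
      refine Finset.sum_eq_zero fun i _ => ?_
      rw [← htr (e i) (e i), trace_eq_sum_ip he]
      simp
    have h5 : ∑ i, ∑ j, ip ℝ g ⁅e i, ⁅e i, e j⁆⁆ (e j) = - (Fintype.card ι : ℝ) := by
      rw [Finset.sum_comm]
      simp only [← ip_sum_left, sum_lie_lie hneg he, ip_neg_left, he]
      simp
    simp only [hK, Finset.sum_add_distrib, ← Finset.mul_sum, hQ, h5] at h4
    have h6 : (Fintype.card ι : ℝ) ≠ 0 := by simp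
    have h7 : s * (Fintype.card ι : ℝ) = 0 := by linarith
    exact (mul_eq_zero.mp h7).resolve_right h6
  rw [hK, hs0]
  ring

end Reduction

section Contraction

variable {g : Type*} [LieRing g] [LieAlgebra ℝ g] {ι : Type*} [Fintype ι] [DecidableEq ι]
  {e : Module.Basis ι ℝ g} {K : g →ₗ[ℝ] Module.End ℝ g} {Φ : g →ₗ[ℝ] g →ₗ[ℝ] g}
  (hneg : ∀ X : g, X ≠ 0 → killingForm ℝ g X X < 0)
  (he : ∀ i j, ip ℝ g (e i) (e j) = if i = j then 1 else 0)
  (htr : ∀ Z U : g, LinearMap.trace ℝ g (K Z ∘ₗ ad ℝ g U) = 0)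
  (hΦ : ∀ X Y : g, Φ X Y = - Φ Y X)
  (hi : ∀ X Y Z : g, ip ℝ g (Φ X Y) Z + ip ℝ g (Φ Y Z) X + ip ℝ g (Φ Z X) Y = 0)
  (hK : ∀ X Y Z : g, ip ℝ g (K X Y) Z = 2 * ip ℝ g (Φ Y Z) X)

include hΦ hK in
lemma ip_skew_of_eq (X Y Z : g) : ip ℝ g (K X Y) Z = - ip ℝ g Y (K X Z) := by
  rw [ip_comm Y, hK, hK, hΦ, ip_neg_left]
  ring

include hneg hΦ hi hK in
lemma sub_eq_neg_two_smul (X Y : g) : K X Y - K Y X = (-2 : ℝ) • Φ X Y := by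
  refine eq_of_forall_ip hneg fun Z => ?_
  have h := hi X Y Z
  rw [hΦ Z X, ip_neg_left] at h
  rw [ip_sub_left, hK, hK, ip_smul_left]
  linarith

include hneg he htr hK in
lemma sum_form_lie (U : g) : ∑ i, Φ ⁅U, e i⁆ (e i) = 0 := by
  refine eq_of_forall_ip hneg fun Z => ?_
  have h := htr Z U
  rw [trace_eq_sum_ip he] at h
  simp only [LinearMap.comp_apply, ad_apply, hK, ← Finset.mul_sum] at h
  rw [ip_sum_left, ip_zero_left]
  linarith

include hneg he htr hΦ hK in
lemma sum_lie_apply (X : g) : ∑ i, ⁅K X (e i), e i⁆ = 0 := by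
  refine eq_of_forall_ip hneg fun U => ?_
  rw [ip_sum_left, ip_zero_left, ← htr X U, trace_eq_sum_ip he]
  refine Finset.sum_congr rfl fun i _ => ?_
  rw [LinearMap.comp_apply, ad_apply, ip_lie_left, ip_skew_of_eq hΦ hK X ⁅U, e i⁆, ip_comm,
    ip_lie_left, ← lie_skew U (e i), ip_neg_left, neg_neg, ip_lie_left]

include hneg he htr hΦ hK in
lemma sum_lie_lie_apply (X V : g) : ∑ i, ⁅⁅V, K X (e i)⁆, e i⁆ = 0 := by
  have h1 := sum_skew he (LinearMap.mk₂ ℝ (fun x y => ⁅⁅V, x⁆, y⁆) (by intros; simp)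
    (by intros; simp) (by intros; simp) (by intros; simp)) (ip_skew_of_eq hΦ hK X)
  simp only [LinearMap.mk₂_apply] at h1
  have h2 : ∑ i, ⁅⁅V, K X (e i)⁆, e i⁆ = ∑ i, ⁅⁅V, e i⁆, K X (e i)⁆ := by
    rw [← sub_eq_zero, ← Finset.sum_sub_distrib, ← lie_zero V, ← sum_lie_apply hneg he htr hΦ hK X,
      lie_sum]
    refine Finset.sum_congr rfl fun i _ => ?_
    rw [lie_lie V (K X (e i)) (e i), ← lie_skew ⁅V, e i⁆ (K X (e i))]
    abel
  have h3 : (2 : ℝ) • ∑ i, ⁅⁅V, K X (e i)⁆, e i⁆ = 0 := by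
    rw [two_smul]
    nth_rw 1 [h1]
    rw [h2, neg_add_cancel]
  simpa using h3

include hneg he htr hΦ hK in
lemma sum_lie_lie_apply_right (X V : g) : ∑ i, ⁅⁅V, e i⁆, K X (e i)⁆ = 0 := by
  have h1 := sum_skew he (LinearMap.mk₂ ℝ (fun x y => ⁅⁅V, x⁆, y⁆) (by intros; simp)
    (by intros; simp) (by intros; simp) (by intros; simp)) (ip_skew_of_eq hΦ hK X)
  simp only [LinearMap.mk₂_apply] at h1
  rw [← neg_eq_zero, ← h1, sum_lie_lie_apply hneg he htr hΦ hK]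

include hneg he htr hΦ hi hK in
lemma sum_apply_lie (U : g) : ∑ i, K (e i) ⁅U, e i⁆ = 0 := by
  refine eq_of_forall_ip hneg fun Z => ?_
  rw [ip_sum_left, ip_zero_left]
  simp only [hK, ← Finset.mul_sum]
  have h1 := sum_lie_swap he (LinearMap.mk₂ ℝ (fun x y => ip ℝ g (Φ x Z) y) (by intros; simp)
    (by intros; simp) (by intros; simp) (by intros; simp)) U
  simp only [LinearMap.mk₂_apply] at h1
  have h2 : ∑ i, (ip ℝ g (Φ ⁅U, e i⁆ Z) (e i) + ip ℝ g (Φ Z (e i)) ⁅U, e i⁆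
      + ip ℝ g (Φ (e i) ⁅U, e i⁆) Z) = 0 := Finset.sum_eq_zero fun i _ => hi _ _ _
  have h3 : ∑ i, ip ℝ g (Φ (e i) ⁅U, e i⁆) Z = 0 := by
    simp only [hΦ (e _) ⁅U, _⁆, ip_neg_left, Finset.sum_neg_distrib]
    rw [← ip_sum_left, sum_form_lie hneg he htr hK, ip_zero_left, neg_zero]
  simp only [Finset.sum_add_distrib, hΦ Z (e _), ip_neg_left, Finset.sum_neg_distrib] at h2
  linarith

variable (hii : ∀ X Y Z : g,
    (⁅ad ℝ g ⁅X, Y⁆, K Z⁆ + ad ℝ g ⁅K X Y - K Y X, Z⁆ + wedge ℝ g (Φ X Y) Z)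
    + (⁅ad ℝ g ⁅Y, Z⁆, K X⁆ + ad ℝ g ⁅K Y Z - K Z Y, X⁆ + wedge ℝ g (Φ Y Z) X)
    + (⁅ad ℝ g ⁅Z, X⁆, K Y⁆ + ad ℝ g ⁅K Z X - K X Z, Y⁆ + wedge ℝ g (Φ Z X) Y) = 0)

include hneg he htr hΦ hi hK hii in
/-- The contraction of the Bianchi identity. -/
lemma contracted_bianchi (X Y : g) :
    ⁅⁅X, Y⁆, ∑ i, K (e i) (e i)⁆ - (2 : ℝ) • ∑ i, ⁅⁅Φ Y (e i), X⁆, e i⁆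
      + (2 : ℝ) • ∑ i, ⁅⁅Φ X (e i), Y⁆, e i⁆ + (3 - (Fintype.card ι : ℝ)) • Φ X Y
      + (∑ i, ip ℝ g (Φ Y (e i)) (e i)) • X - (∑ i, ip ℝ g (Φ X (e i)) (e i)) • Y = 0 := by
  have hbr : ∀ (W Z : g) (T : Module.End ℝ g), ⁅ad ℝ g W, T⁆ Z = ⁅W, T Z⁆ - T ⁅W, Z⁆ :=
    fun W Z T => rfl
  have hτ := sub_eq_neg_two_smul hneg hΦ hi hK
  have hcas : ∀ W : g, ∑ i, ⁅⁅W, e i⁆, e i⁆ = - W := by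
    intro W
    rw [← sum_lie_lie hneg he]
    refine Finset.sum_congr rfl fun i _ => ?_
    rw [← lie_skew, ← lie_skew W, lie_neg, neg_neg]
  have h : ∑ i, ((⁅ad ℝ g ⁅X, Y⁆, K (e i)⁆ + ad ℝ g ⁅K X Y - K Y X, e i⁆
        + wedge ℝ g (Φ X Y) (e i))
      + (⁅ad ℝ g ⁅Y, e i⁆, K X⁆ + ad ℝ g ⁅K Y (e i) - K (e i) Y, X⁆ + wedge ℝ g (Φ Y (e i)) X)
      + (⁅ad ℝ g ⁅e i, X⁆, K Y⁆ + ad ℝ g ⁅K (e i) X - K X (e i), Y⁆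
        + wedge ℝ g (Φ (e i) X) Y)) (e i) = 0 :=
    Finset.sum_eq_zero fun i _ => by rw [hii, LinearMap.zero_apply]
  simp only [LinearMap.add_apply, Finset.sum_add_distrib, hbr, ad_apply, wedge_apply, hτ] at h
  have h1 : ∑ i, (⁅⁅X, Y⁆, K (e i) (e i)⁆ - K (e i) ⁅⁅X, Y⁆, e i⁆)
      = ⁅⁅X, Y⁆, ∑ i, K (e i) (e i)⁆ := by
    rw [Finset.sum_sub_distrib, sum_apply_lie hneg he htr hΦ hi hK, sub_zero, lie_sum]
  have h3 : ∑ i, (ip ℝ g (Φ X Y) (e i) • e i - ip ℝ g (e i) (e i) • Φ X Y)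
      = Φ X Y - (Fintype.card ι : ℝ) • Φ X Y := by
    rw [Finset.sum_sub_distrib, sum_ip_smul he]
    simp [he, Nat.cast_smul_eq_nsmul]
  have h4 : ∑ i, (⁅⁅Y, e i⁆, K X (e i)⁆ - K X ⁅⁅Y, e i⁆, e i⁆) = K X Y := by
    rw [Finset.sum_sub_distrib, sum_lie_lie_apply_right hneg he htr hΦ hK, ← map_sum, hcas,
      map_neg, zero_sub, neg_neg]
  have h5 : ∑ i, ⁅⁅(-2 : ℝ) • Φ Y (e i), X⁆, e i⁆ = (-2 : ℝ) • ∑ i, ⁅⁅Φ Y (e i), X⁆, e i⁆ := by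
    simp only [smul_lie, Finset.smul_sum]
  have h6 : ∑ i, (ip ℝ g (Φ Y (e i)) (e i) • X - ip ℝ g X (e i) • Φ Y (e i))
      = (∑ i, ip ℝ g (Φ Y (e i)) (e i)) • X + Φ X Y := by
    have : ∑ i, ip ℝ g X (e i) • Φ Y (e i) = Φ Y X := by
      conv_rhs => rw [← sum_ip_smul he X]
      simp
    rw [Finset.sum_sub_distrib, Finset.sum_smul, this, hΦ X Y, sub_eq_add_neg]
  have h7 : ∑ i, (⁅⁅e i, X⁆, K Y (e i)⁆ - K Y ⁅⁅e i, X⁆, e i⁆) = - K Y X := by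
    have hsk : ∀ i, ⁅e i, X⁆ = - ⁅X, e i⁆ := fun i => (lie_skew _ _).symm
    simp only [hsk, neg_lie, map_neg]
    rw [Finset.sum_sub_distrib, Finset.sum_neg_distrib, Finset.sum_neg_distrib,
      sum_lie_lie_apply_right hneg he htr hΦ hK, ← map_sum, hcas]
    simp
  have h8 : ∑ i, ⁅⁅(-2 : ℝ) • Φ (e i) X, Y⁆, e i⁆ = (2 : ℝ) • ∑ i, ⁅⁅Φ X (e i), Y⁆, e i⁆ := by
    simp only [hΦ (e _) X, smul_lie, smul_neg, neg_smul, neg_neg, Finset.smul_sum]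
  have h9 : ∑ i, (ip ℝ g (Φ (e i) X) (e i) • Y - ip ℝ g Y (e i) • Φ (e i) X)
      = Φ X Y - (∑ i, ip ℝ g (Φ X (e i)) (e i)) • Y := by
    have : ∑ i, ip ℝ g Y (e i) • Φ X (e i) = Φ X Y := by
      conv_rhs => rw [← sum_ip_smul he Y]
      simp
    simp only [hΦ (e _) X, ip_neg_left, neg_smul, smul_neg, sub_neg_eq_add]
    rw [Finset.sum_add_distrib, Finset.sum_neg_distrib, ← Finset.sum_smul, this]
    abel
  rw [h1, hcas, h3, h4, h5, h6, h7, h8, h9] at h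
  have h10 : K X Y = K Y X - (2 : ℝ) • Φ X Y := by
    rw [sub_eq_add_neg, ← neg_smul, ← hτ]
    abel
  rw [h10] at h
  rw [← h]
  module

include hneg he htr hΦ hi hK hii in
lemma sum_ip_form_eq_zero (hcard : 2 < Fintype.card ι) (X : g) :
    ∑ i, ip ℝ g (Φ X (e i)) (e i) = 0 := by
  set θ : g → ℝ := fun X => ∑ i, ip ℝ g (Φ X (e i)) (e i) with hθ
  change θ X = 0
  set P : g := ∑ i, K (e i) (e i) with hP
  have hPθ : ∀ W, ip ℝ g P W = - 2 * θ W := by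
    intro W
    rw [hP, ip_sum_left, hθ, Finset.mul_sum]
    refine Finset.sum_congr rfl fun i _ => ?_
    rw [hK, hΦ, ip_neg_left]
    ring
  have h : ∑ j, ip ℝ g (⁅⁅X, e j⁆, P⁆ - (2 : ℝ) • ∑ i, ⁅⁅Φ (e j) (e i), X⁆, e i⁆
      + (2 : ℝ) • ∑ i, ⁅⁅Φ X (e i), e j⁆, e i⁆ + (3 - (Fintype.card ι : ℝ)) • Φ X (e j)
      + θ (e j) • X - θ X • e j) (e j) = 0 :=
    Finset.sum_eq_zero fun j _ => by
      rw [contracted_bianchi hneg he htr hΦ hi hK hii, ip_zero_left]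
  simp only [ip_sub_left, ip_add_left, ip_smul_left, Finset.sum_sub_distrib,
    Finset.sum_add_distrib, ← Finset.mul_sum] at h
  have h1 : ∑ j, ip ℝ g ⁅⁅X, e j⁆, P⁆ (e j) = - 2 * θ X := by
    simp only [ip_lie_left ⁅X, _⁆]
    rw [sum_ip_lie_lie he, ip_comm, hPθ]
  have h2 : ∑ j, ip ℝ g (∑ i, ⁅⁅Φ (e j) (e i), X⁆, e i⁆) (e j) = 0 := by
    have hz : ∑ j, ∑ i, ⁅⁅e j, e i⁆, Φ (e j) (e i)⁆ = 0 := by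
      have hsw : ∀ j, ∑ i, ⁅⁅e j, e i⁆, Φ (e j) (e i)⁆
          = - ∑ i, ⁅e i, Φ (e j) ⁅e j, e i⁆⁆ := by
        intro j
        have := sum_lie_swap he (LinearMap.mk₂ ℝ (fun x y => ⁅x, Φ (e j) y⁆) (by intros; simp)
          (by intros; simp) (by intros; simp) (by intros; simp)) (e j)
        simpa only [LinearMap.mk₂_apply] using this
      simp only [hsw, Finset.sum_neg_distrib]
      rw [Finset.sum_comm, neg_eq_zero]
      refine Finset.sum_eq_zero fun i _ => ?_
      have : ∀ j, Φ (e j) ⁅e j, e i⁆ = Φ ⁅e i, e j⁆ (e j) := by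
        intro j
        rw [hΦ, ← lie_skew, map_neg, LinearMap.neg_apply, neg_neg]
      rw [← lie_sum]
      simp only [this]
      rw [sum_form_lie hneg he htr hK, lie_zero]
    rw [← neg_eq_zero, ← ip_zero_right X, ← hz, ip_sum_right, ← Finset.sum_neg_distrib]
    refine Finset.sum_congr rfl fun j _ => ?_
    rw [ip_sum_left, ip_sum_right, ← Finset.sum_neg_distrib]
    refine Finset.sum_congr rfl fun i _ => ?_
    rw [ip_lie_left, ip_lie_skew, neg_neg, ← lie_skew (e j) (e i), neg_lie, lie_skew]
  have h3 : ∑ j, ip ℝ g (∑ i, ⁅⁅Φ X (e i), e j⁆, e i⁆) (e j) = θ X := by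
    simp only [ip_sum_left]
    rw [Finset.sum_comm]
    refine Finset.sum_congr rfl fun i _ => ?_
    simp only [ip_lie_left ⁅Φ X (e i), _⁆]
    rw [sum_ip_lie_lie he]
  have h4 : ∑ j, θ (e j) * ip ℝ g X (e j) = θ X := by
    have h5 := sum_ip_mul he P X
    simp only [hPθ, mul_assoc, ← Finset.mul_sum] at h5
    linarith
  have h6 : ∑ j, ip ℝ g (e j) (e j) = Fintype.card ι := by simp [he]
  have h7 : ∑ j, ip ℝ g (Φ X (e j)) (e j) = θ X := rfl
  rw [h1, h2, h3, h4, h6, h7] at h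
  have h8 : (2 : ℝ) < Fintype.card ι := by exact_mod_cast hcard
  have h9 : (4 - 2 * (Fintype.card ι : ℝ)) * θ X = 0 := by linarith
  refine (mul_eq_zero.mp h9).resolve_left ?_
  linarith

include hneg he htr hΦ hi hK hii in
lemma smul_form_eq (hcard : 2 < Fintype.card ι) (X Y : g) :
    ((Fintype.card ι : ℝ) - 3) • Φ X Y
      = (2 : ℝ) • ∑ i, ⁅⁅Φ X (e i), Y⁆, e i⁆ - (2 : ℝ) • ∑ i, ⁅⁅Φ Y (e i), X⁆, e i⁆ := by
  have hθ := sum_ip_form_eq_zero hneg he htr hΦ hi hK hii hcard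
  have hP : ∑ i, K (e i) (e i) = 0 := by
    refine eq_of_forall_ip hneg fun W => ?_
    have h := hθ W
    simp only [hΦ W, ip_neg_left, Finset.sum_neg_distrib, neg_eq_zero] at h
    simp only [ip_sum_left, hK, ← Finset.mul_sum, h, ip_zero_left, mul_zero]
  have h := contracted_bianchi hneg he htr hΦ hi hK hii X Y
  rw [hP, hθ, hθ, lie_zero] at h
  rw [← sub_eq_zero, ← neg_eq_zero, ← h]
  module

end Contraction

section Energy

variable {g : Type*} [LieRing g] [LieAlgebra ℝ g] {ι : Type*} [Fintype ι] [DecidableEq ι]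
  {e : Module.Basis ι ℝ g}
  (hneg : ∀ X : g, X ≠ 0 → killingForm ℝ g X X < 0)
  (he : ∀ i j, ip ℝ g (e i) (e j) = if i = j then 1 else 0)

include hneg he in
lemma sum_ip_commutator {A : Module.End ℝ g} (hA : ∀ X Y, ip ℝ g (A X) Y = ip ℝ g X (A Y)) :
    ∑ u, ∑ x, ip ℝ g (A ⁅e u, e x⁆ - ⁅e u, A (e x)⁆) (A ⁅e u, e x⁆ - ⁅e u, A (e x)⁆)
      = 2 * ∑ x, ip ℝ g (A (e x)) (A (e x))
        - 2 * ∑ x, ∑ z, ip ℝ g ⁅A (e z), e x⁆ ⁅e z, A (e x)⁆ := by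
  have h1 : ∑ u, ∑ x, ip ℝ g (A ⁅e u, e x⁆) (A ⁅e u, e x⁆)
      = ∑ x, ip ℝ g (A (e x)) (A (e x)) := by
    have hsw : ∀ u, ∑ x, ip ℝ g (A ⁅e u, e x⁆) (A ⁅e u, e x⁆)
        = - ∑ x, ip ℝ g (A (e x)) (A ⁅e u, ⁅e u, e x⁆⁆) := by
      intro u
      have := sum_lie_swap he (LinearMap.mk₂ ℝ (fun x y => ip ℝ g (A x) (A ⁅e u, y⁆))
        (by intros; simp) (by intros; simp) (by intros; simp) (by intros; simp)) (e u)
      simpa only [LinearMap.mk₂_apply] using this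
    simp only [hsw, Finset.sum_neg_distrib]
    rw [Finset.sum_comm, ← Finset.sum_neg_distrib]
    refine Finset.sum_congr rfl fun x _ => ?_
    rw [← ip_sum_right, ← map_sum, sum_lie_lie hneg he, map_neg, ip_neg_right, neg_neg]
  have h2 : ∑ u, ∑ x, ip ℝ g ⁅e u, A (e x)⁆ ⁅e u, A (e x)⁆
      = ∑ x, ip ℝ g (A (e x)) (A (e x)) := by
    rw [Finset.sum_comm]
    refine Finset.sum_congr rfl fun x _ => ?_
    rw [← sum_ip_lie_lie he]
    refine Finset.sum_congr rfl fun u _ => ?_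
    rw [← lie_skew, ip_neg_left, ip_neg_right, neg_neg]
  have h3 : ∑ u, ∑ x, ip ℝ g (A ⁅e u, e x⁆) ⁅e u, A (e x)⁆
      = ∑ x, ∑ w, ip ℝ g ⁅e x, e w⁆ ⁅A (e x), A (e w)⁆ := by
    have hexp : ∀ u x, ip ℝ g (A ⁅e u, e x⁆) ⁅e u, A (e x)⁆
        = ∑ w, ip ℝ g ⁅e x, e w⁆ (e u) * ip ℝ g ⁅A (e x), A (e w)⁆ (e u) := by
      intro u x
      rw [hA, ← sum_ip_mul he]
      refine Finset.sum_congr rfl fun w _ => ?_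
      rw [ip_lie_left, hA, ip_lie_left, ip_comm (e u), ip_comm (e u)]
    simp only [hexp]
    rw [Finset.sum_comm]
    refine Finset.sum_congr rfl fun x _ => ?_
    rw [Finset.sum_comm]
    simp only [sum_ip_mul he]
  have h4 : ∑ x, ∑ z, ip ℝ g ⁅A (e z), e x⁆ ⁅e z, A (e x)⁆
      = ∑ x, ∑ w, ip ℝ g ⁅e x, e w⁆ ⁅A (e x), A (e w)⁆ := by
    refine Finset.sum_congr rfl fun x _ => ?_
    have := sum_adjoint he (LinearMap.mk₂ ℝ (fun y z => ip ℝ g ⁅y, e x⁆ ⁅z, A (e x)⁆)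
      (by intros; simp) (by intros; simp) (by intros; simp) (by intros; simp)) hA
    simp only [LinearMap.mk₂_apply] at this
    rw [this]
    refine Finset.sum_congr rfl fun z _ => ?_
    rw [← lie_skew, ← lie_skew (A (e z)), ip_neg_left, ip_neg_right, neg_neg]
  rw [h4, ← h3]
  simp only [ip_sub_left, ip_sub_right, Finset.sum_sub_distrib,
    ip_comm ⁅_, A _⁆ (A _), h1, h2]
  ring

variable {K : g →ₗ[ℝ] Module.End ℝ g} {Φ : g →ₗ[ℝ] g →ₗ[ℝ] g}
  (htr : ∀ Z U : g, LinearMap.trace ℝ g (K Z ∘ₗ ad ℝ g U) = 0)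
  (hΦ : ∀ X Y : g, Φ X Y = - Φ Y X)
  (hi : ∀ X Y Z : g, ip ℝ g (Φ X Y) Z + ip ℝ g (Φ Y Z) X + ip ℝ g (Φ Z X) Y = 0)
  (hK : ∀ X Y Z : g, ip ℝ g (K X Y) Z = 2 * ip ℝ g (Φ Y Z) X)

include hΦ hi hK in
lemma ip_add_smul_symm (Z X Y : g) :
    ip ℝ g ((Φ Z + (1 / 4 : ℝ) • K Z) X) Y = ip ℝ g X ((Φ Z + (1 / 4 : ℝ) • K Z) Y) := by
  have h1 := hi Z X Y
  have h2 : ip ℝ g (Φ Y X) Z = - ip ℝ g (Φ X Y) Z := by rw [hΦ, ip_neg_left]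
  have h3 : ip ℝ g (Φ Y Z) X = - ip ℝ g (Φ Z Y) X := by rw [hΦ, ip_neg_left]
  simp only [ip_comm X, LinearMap.add_apply, LinearMap.smul_apply, ip_add_left, ip_smul_left, hK]
  linarith

include he hi hK in
lemma sum_ip_add_smul :
    ∑ y, ∑ x, ip ℝ g ((Φ (e y) + (1 / 4 : ℝ) • K (e y)) (e x))
        ((Φ (e y) + (1 / 4 : ℝ) • K (e y)) (e x))
      = 3 / 4 * ∑ y, ∑ x, ip ℝ g (Φ (e y) (e x)) (Φ (e y) (e x)) := by
  set φ : ι → ι → ι → ℝ := fun x y z => ip ℝ g (Φ (e x) (e y)) (e z) with hφ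
  have hN : ∑ y, ∑ x, ip ℝ g (Φ (e y) (e x)) (Φ (e y) (e x))
      = ∑ y, ∑ x, ∑ z, φ y x z * φ y x z := by
    simp only [hφ, sum_ip_mul he]
  have hA : ∑ y, ∑ x, ip ℝ g ((Φ (e y) + (1 / 4 : ℝ) • K (e y)) (e x))
        ((Φ (e y) + (1 / 4 : ℝ) • K (e y)) (e x))
      = ∑ y, ∑ x, ∑ z, (φ y x z * φ y x z + φ y x z * φ x z y
        + 1 / 4 * (φ x z y * φ x z y)) := by
    refine Finset.sum_congr rfl fun y _ => Finset.sum_congr rfl fun x _ => ?_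
    rw [← sum_ip_mul he]
    refine Finset.sum_congr rfl fun z _ => ?_
    simp only [LinearMap.add_apply, LinearMap.smul_apply, ip_add_left, ip_smul_left, hK, hφ]
    ring
  have hrot : ∀ f : ι → ι → ι → ℝ, ∑ y, ∑ x, ∑ z, f x z y = ∑ y, ∑ x, ∑ z, f y x z := by
    intro f
    rw [Finset.sum_comm]
    exact Finset.sum_congr rfl fun x _ => Finset.sum_comm
  have h1 := hrot fun x y z => φ x y z * φ x y z
  have h2 := hrot fun x y z => φ x y z * φ y z x
  have h3 := hrot fun x y z => φ z x y * φ z x y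
  have h4 := hrot fun x y z => φ z x y * φ x y z
  have h5 : ∑ y, ∑ x, ∑ z, (φ y x z + φ x z y + φ z y x) * (φ y x z + φ x z y + φ z y x) = 0 :=
    Finset.sum_eq_zero fun y _ => Finset.sum_eq_zero fun x _ => Finset.sum_eq_zero fun z _ => by
      rw [mul_self_eq_zero]
      exact hi _ _ _
  have h6 : ∑ y, ∑ x, ∑ z, (φ y x z + φ x z y + φ z y x) * (φ y x z + φ x z y + φ z y x)
      = ∑ y, ∑ x, ∑ z, φ y x z * φ y x z + ∑ y, ∑ x, ∑ z, φ x z y * φ x z y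
        + ∑ y, ∑ x, ∑ z, φ z y x * φ z y x + 2 * ∑ y, ∑ x, ∑ z, φ y x z * φ x z y
        + 2 * ∑ y, ∑ x, ∑ z, φ x z y * φ z y x + 2 * ∑ y, ∑ x, ∑ z, φ z y x * φ y x z := by
    simp only [Finset.mul_sum, ← Finset.sum_add_distrib]
    refine Finset.sum_congr rfl fun y _ => Finset.sum_congr rfl fun x _ =>
      Finset.sum_congr rfl fun z _ => ?_
    ring
  rw [hA, hN]
  simp only [Finset.sum_add_distrib, ← Finset.mul_sum]
  linarith

include hneg he htr hΦ hK in
lemma sum_lie_lie_add_smul (Z X : g) :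
    ∑ i, ⁅⁅Φ Z (e i), X⁆, e i⁆ = ∑ i, ⁅⁅(Φ Z + (1 / 4 : ℝ) • K Z) (e i), X⁆, e i⁆ := by
  have h : ∑ i, ⁅⁅K Z (e i), X⁆, e i⁆ = 0 := by
    rw [← neg_eq_zero, ← sum_lie_lie_apply hneg he htr hΦ hK Z X, ← Finset.sum_neg_distrib]
    refine Finset.sum_congr rfl fun i _ => ?_
    rw [← lie_skew X, neg_lie]
  simp only [LinearMap.add_apply, LinearMap.smul_apply, add_lie, smul_lie, Finset.sum_add_distrib,
    ← Finset.smul_sum, h, smul_zero, add_zero]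

include hneg he htr hΦ hK in
lemma sum_ip_sum_lie_lie (Z : g) :
    ∑ x, ip ℝ g (∑ i, ⁅⁅Φ Z (e i), e x⁆, e i⁆) (Φ Z (e x))
      = ∑ x, ∑ z, ip ℝ g ⁅(Φ Z + (1 / 4 : ℝ) • K Z) (e z), e x⁆
        ⁅e z, (Φ Z + (1 / 4 : ℝ) • K Z) (e x)⁆ := by
  have h1 : ∀ z, ∑ x, ip ℝ g ⁅(Φ Z + (1 / 4 : ℝ) • K Z) (e z), e x⁆ ⁅e z, K Z (e x)⁆ = 0 := by
    intro z
    rw [← neg_eq_zero, ← ip_zero_right ((Φ Z + (1 / 4 : ℝ) • K Z) (e z)),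
      ← sum_lie_lie_apply hneg he htr hΦ hK Z (e z), ip_sum_right, ← Finset.sum_neg_distrib]
    refine Finset.sum_congr rfl fun x _ => ?_
    rw [ip_lie_left, ← ip_neg_right, lie_skew]
  have h2 : ∑ x, ∑ z, ip ℝ g ⁅(Φ Z + (1 / 4 : ℝ) • K Z) (e z), e x⁆ ⁅e z, K Z (e x)⁆ = 0 := by
    rw [Finset.sum_comm]
    exact Finset.sum_eq_zero fun z _ => h1 z
  have h3 : ∀ x z, ip ℝ g ⁅(Φ Z + (1 / 4 : ℝ) • K Z) (e z), e x⁆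
        ⁅e z, (Φ Z + (1 / 4 : ℝ) • K Z) (e x)⁆
      = ip ℝ g ⁅(Φ Z + (1 / 4 : ℝ) • K Z) (e z), e x⁆ ⁅e z, Φ Z (e x)⁆
        + 1 / 4 * ip ℝ g ⁅(Φ Z + (1 / 4 : ℝ) • K Z) (e z), e x⁆ ⁅e z, K Z (e x)⁆ := by
    intro x z
    rw [← ip_smul_right, ← ip_add_right, ← lie_smul, ← lie_add]
    rfl
  simp only [h3, Finset.sum_add_distrib, ← Finset.mul_sum, h2, mul_zero, add_zero]
  refine Finset.sum_congr rfl fun x _ => ?_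
  rw [sum_lie_lie_add_smul hneg he htr hΦ hK, ip_sum_left]
  exact Finset.sum_congr rfl fun z _ => ip_lie_left _ _ _

include hneg he htr hΦ hi hK in
/-- In dimension at least six the contracted Bianchi identity forces `Φ` to vanish. -/
lemma form_eq_zero [Module.Finite ℝ g] [IsSimple ℝ g] (hcard : 6 ≤ Fintype.card ι)
    (hii : ∀ X Y Z : g,
      (⁅ad ℝ g ⁅X, Y⁆, K Z⁆ + ad ℝ g ⁅K X Y - K Y X, Z⁆ + wedge ℝ g (Φ X Y) Z)
      + (⁅ad ℝ g ⁅Y, Z⁆, K X⁆ + ad ℝ g ⁅K Y Z - K Z Y, X⁆ + wedge ℝ g (Φ Y Z) X)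
      + (⁅ad ℝ g ⁅Z, X⁆, K Y⁆ + ad ℝ g ⁅K Z X - K X Z, Y⁆ + wedge ℝ g (Φ Z X) Y) = 0) :
    Φ = 0 := by
  have hn : (6 : ℝ) ≤ Fintype.card ι := by exact_mod_cast hcard
  have hmain := smul_form_eq hneg he htr hΦ hi hK hii (by omega)
  set A : g → Module.End ℝ g := fun Z => Φ Z + (1 / 4 : ℝ) • K Z with hAdef
  have hA : ∀ Z X Y, ip ℝ g (A Z X) Y = ip ℝ g X (A Z Y) := ip_add_smul_symm hΦ hi hK
  set N : ℝ := ∑ y, ∑ x, ip ℝ g (Φ (e y) (e x)) (Φ (e y) (e x)) with hN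
  set C : ι → ι → ι → ℝ := fun y u x => ip ℝ g (A (e y) ⁅e u, e x⁆ - ⁅e u, A (e y) (e x)⁆)
    (A (e y) ⁅e u, e x⁆ - ⁅e u, A (e y) (e x)⁆) with hC
  have hC0 : ∀ y u x, 0 ≤ C y u x := fun y u x => ip_self_nonneg hneg _
  have hN0 : 0 ≤ N :=
    Finset.sum_nonneg fun y _ => Finset.sum_nonneg fun x _ => ip_self_nonneg hneg _
  have hquad : ((Fintype.card ι : ℝ) - 3) * N
      = 4 * ∑ y, ∑ x, ∑ z, ip ℝ g ⁅A (e y) (e z), e x⁆ ⁅e z, A (e y) (e x)⁆ := by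
    have h1 : ∀ y x, ((Fintype.card ι : ℝ) - 3) * ip ℝ g (Φ (e y) (e x)) (Φ (e y) (e x))
        = 2 * ip ℝ g (∑ i, ⁅⁅Φ (e y) (e i), e x⁆, e i⁆) (Φ (e y) (e x))
          + 2 * ip ℝ g (∑ i, ⁅⁅Φ (e x) (e i), e y⁆, e i⁆) (Φ (e x) (e y)) := by
      intro y x
      rw [← ip_smul_left, hmain, ip_sub_left, ip_smul_left, ip_smul_left, hΦ (e x) (e y),
        ip_neg_right]
      ring
    have h2 : ∑ y, ∑ x, ip ℝ g (∑ i, ⁅⁅Φ (e x) (e i), e y⁆, e i⁆) (Φ (e x) (e y))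
        = ∑ y, ∑ x, ip ℝ g (∑ i, ⁅⁅Φ (e y) (e i), e x⁆, e i⁆) (Φ (e y) (e x)) :=
      Finset.sum_comm
    simp only [hN, Finset.mul_sum, h1]
    simp only [Finset.sum_add_distrib, ← Finset.mul_sum, h2]
    simp only [sum_ip_sum_lie_lie hneg he htr hΦ hK]
    ring
  have hsum : ∑ y, ∑ u, ∑ x, C y u x = 0 := by
    have h1 : ∑ y, ∑ u, ∑ x, C y u x = 2 * (3 / 4 * N)
        - 2 * ∑ y, ∑ x, ∑ z, ip ℝ g ⁅A (e y) (e z), e x⁆ ⁅e z, A (e y) (e x)⁆ := by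
      simp only [hC, sum_ip_commutator hneg he (hA _), Finset.sum_sub_distrib, ← Finset.mul_sum]
      rw [hN, ← sum_ip_add_smul he hi hK]
    have h2 : 0 ≤ ∑ y, ∑ u, ∑ x, C y u x := Finset.sum_nonneg fun y _ =>
      Finset.sum_nonneg fun u _ => Finset.sum_nonneg fun x _ => hC0 y u x
    nlinarith [mul_nonneg (sub_nonneg.mpr hn) hN0]
  have hCzero : ∀ y u x, C y u x = 0 := by
    intro y u x
    rw [Finset.sum_eq_zero_iff_of_nonneg fun y _ => Finset.sum_nonneg fun u _ =>
      Finset.sum_nonneg fun x _ => hC0 y u x] at hsum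
    have h1 := hsum y (Finset.mem_univ y)
    rw [Finset.sum_eq_zero_iff_of_nonneg fun u _ => Finset.sum_nonneg fun x _ => hC0 y u x] at h1
    have h2 := h1 u (Finset.mem_univ u)
    rw [Finset.sum_eq_zero_iff_of_nonneg fun x _ => hC0 y u x] at h2
    exact h2 x (Finset.mem_univ x)
  have hcomm : ∀ y, ∀ X Y : g, A (e y) ⁅X, Y⁆ = ⁅X, A (e y) Y⁆ := by
    intro y X Y
    have h : (LinearMap.mk₂ ℝ (fun X Y => A (e y) ⁅X, Y⁆) (by intros; simp) (by intros; simp)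
        (by intros; simp) (by intros; simp) : g →ₗ[ℝ] g →ₗ[ℝ] g)
        = LinearMap.mk₂ ℝ (fun X Y => ⁅X, A (e y) Y⁆) (by intros; simp) (by intros; simp)
        (by intros; simp) (by intros; simp) := by
      refine LinearMap.ext_basis e e fun u x => ?_
      simp only [LinearMap.mk₂_apply]
      exact sub_eq_zero.mp (eq_zero_of_ip_self hneg (hCzero y u x))
    have := LinearMap.congr_fun₂ h X Y
    simpa only [LinearMap.mk₂_apply] using this
  have hA0 : ∀ y X, A (e y) X = 0 := by
    intro y X
    obtain ⟨c, hc⟩ := exists_eq_smul_of_commute_ad hneg (hA (e y)) (hcomm y)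
    have h1 : ∑ i, ip ℝ g (A (e y) (e i)) (e i) = 0 := by
      have hdiag : ∀ Z, Φ Z Z = 0 := by
        intro Z
        have h : (2 : ℝ) • Φ Z Z = 0 := by
          rw [two_smul]
          exact eq_neg_iff_add_eq_zero.mp (hΦ Z Z)
        simpa using h
      simp only [hAdef, LinearMap.add_apply, LinearMap.smul_apply, ip_add_left, ip_smul_left,
        Finset.sum_add_distrib, sum_ip_form_eq_zero hneg he htr hΦ hi hK hii (by omega), hK, hdiag]
      simp
    simp only [hc, ip_smul_left, he] at h1
    have h2 : (Fintype.card ι : ℝ) * c = 0 := by simpa using h1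
    rw [hc, (mul_eq_zero.mp h2).resolve_left (by linarith), zero_smul]
  refine LinearMap.ext_basis e e fun i j => ?_
  have hA0' : ∀ y X, (Φ (e y) + (1 / 4 : ℝ) • K (e y)) X = 0 := hA0
  have h := hmain (e i) (e j)
  simp only [sum_lie_lie_add_smul hneg he htr hΦ hK, hA0', zero_lie, Finset.sum_const_zero,
    smul_zero, sub_zero] at h
  refine (smul_eq_zero.mp h).resolve_left ?_
  linarith

end Energy

theorem stmt_11 (g : Type*) [LieRing g] [LieAlgebra ℝ g] [Module.Finite ℝ g]
    [LieAlgebra.IsSimple ℝ g]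
    (hneg : ∀ X : g, X ≠ 0 → killingForm ℝ g X X < 0)
    (hdim : 4 < Module.finrank ℝ g)
    (K : g →ₗ[ℝ] Module.End ℝ g)
    (hskew : ∀ Z X Y : g, ip ℝ g (K Z X) Y + ip ℝ g X (K Z Y) = 0)
    (htr : ∀ Z U : g, LinearMap.trace ℝ g (K Z ∘ₗ ad ℝ g U) = 0)
    (Φ : g →ₗ[ℝ] g →ₗ[ℝ] g)
    (hΦalt : ∀ X : g, Φ X X = 0)
    (hi : ∀ X Y Z : g, ip ℝ g (Φ X Y) Z + ip ℝ g (Φ Y Z) X + ip ℝ g (Φ Z X) Y = 0)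
    (hii : ∀ X Y Z : g,
      (⁅ad ℝ g ⁅X, Y⁆, K Z⁆ + ad ℝ g ⁅K X Y - K Y X, Z⁆ + wedge ℝ g (Φ X Y) Z)
      + (⁅ad ℝ g ⁅Y, Z⁆, K X⁆ + ad ℝ g ⁅K Y Z - K Z Y, X⁆ + wedge ℝ g (Φ Y Z) X)
      + (⁅ad ℝ g ⁅Z, X⁆, K Y⁆ + ad ℝ g ⁅K Z X - K X Z, Y⁆ + wedge ℝ g (Φ Z X) Y) = 0)
    (hrank : ∃ h : LieSubalgebra ℝ g, h.IsCartanSubalgebra ∧ Module.finrank ℝ h = 2) :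
    (∀ X Y : g, Φ X Y = 0) ∧ (∀ X Y : g, K X Y = 0) := by
  obtain ⟨h, hC, h2⟩ := hrank
  have heven : Even (Module.finrank ℝ g) := even_finrank_of_cartan hneg h hC h2
  obtain ⟨e, he⟩ := exists_orthonormal_basis (B := ipForm g)
    (fun X Y => by simp only [ipForm_apply, ip_comm X Y])
    (fun X hX => by simpa only [ipForm_apply] using ip_self_pos hneg hX)
  simp only [ipForm_apply] at he
  have hΦ : ∀ X Y : g, Φ X Y = - Φ Y X := by
    intro X Y
    have h := hΦalt (X + Y)
    simp only [map_add, LinearMap.add_apply, hΦalt, zero_add, add_zero] at h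
    exact eq_neg_of_add_eq_zero_right h
  have : Nonempty (Fin (Module.finrank ℝ g)) := ⟨⟨0, by omega⟩⟩
  have hK := ip_eq_two_mul_ip_of_trace_eq_zero hneg he heven hskew htr hΦ hi hii
  have hcard : 6 ≤ Fintype.card (Fin (Module.finrank ℝ g)) := by
    obtain ⟨k, hk⟩ := heven
    rw [Fintype.card_fin]
    omega
  have hΦ0 : ∀ X Y, Φ X Y = 0 := by
    simp [form_eq_zero hneg he htr hΦ hi hK hcard hii]
  refine ⟨hΦ0, fun X Y => eq_of_forall_ip hneg fun Z => ?_⟩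
  rw [hK, hΦ0, ip_zero_left, mul_zero, ip_zero_left]
end

section
/- Let g be a finite-dimensional complex simple Lie algebra of rank at least 3, and let K and Φ satisfy the complexified system: each K_Z is skew with respect to ⟨·,·⟩ = −κ(·,·), Tr(K_Z ∘ ad_U) = 0 for all Z,U, (i) σ_{XYZ}⟨Φ(X,Y),Z⟩ = 0, and (ii) σ_{XYZ}([ad_{[X,Y]}, K_Z] + ad_{[K_X Y − K_Y X, Z]} + Φ(X,Y)∧Z) = 0. Then Φ(X,Y) = 0 for all X, Y ∈ g with [X,Y] = 0. -/
open LieAlgebra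

namespace RootPairing

variable {ι K M N : Type*} [Field K] [CharZero K] [AddCommGroup M] [Module K M]
  [AddCommGroup N] [Module K N] (P : RootPairing ι K M N)

/-- In an irreducible root system, the roots not orthogonal to a given root span. -/
lemma span_root_pairing_ne_zero_eq_top [P.IsIrreducible] (i : ι) :
    Submodule.span K (P.root '' {j | P.pairing j i ≠ 0}) = ⊤ := by
  refine IsIrreducible.eq_top_of_invtSubmodule_reflection (P := P) _ (fun k ↦ ?_) ?_
  · rw [Module.End.mem_invtSubmodule, Submodule.span_le]
    rintro - ⟨j, hj, rfl⟩
    rw [SetLike.mem_coe, Submodule.mem_comap, LinearEquiv.coe_coe]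
    by_cases hk : P.pairing k i = 0
    · rw [← P.root_reflectionPerm]
      refine Submodule.subset_span ⟨_, ?_, rfl⟩
      rw [Set.mem_ofPred_eq, ← P.pairing_reflectionPerm,
        P.reflectionPerm_eq_of_pairing_eq_zero (P.pairing_eq_zero_iff.mp hk)]
      exact hj
    · rw [P.reflection_apply_root]
      exact Submodule.sub_mem _ (Submodule.subset_span ⟨j, hj, rfl⟩)
        (Submodule.smul_mem _ _ (Submodule.subset_span ⟨k, hk, rfl⟩))
  · refine ne_of_mem_of_not_mem' (a := P.root i) (Submodule.subset_span ⟨i, by simp, rfl⟩) ?_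
    simpa using P.ne_zero i

lemma root_sub_or_add_mem_of_pairing_ne_zero [Finite ι] [P.IsCrystallographic] {i j : ι}
    (h : P.pairing i j ≠ 0)
    (h₁ : P.root i ≠ P.root j) (h₂ : P.root i ≠ -P.root j) :
    P.root i - P.root j ∈ Set.range P.root ∨ P.root i + P.root j ∈ Set.range P.root := by
  rw [← P.algebraMap_pairingIn ℤ] at h
  rcases lt_trichotomy (P.pairingIn ℤ i j) 0 with hlt | h0 | hgt
  · exact .inr (P.root_add_root_mem_of_pairingIn_neg hlt h₂)
  · simp [h0] at h
  · exact .inl (P.root_sub_root_mem_of_pairingIn_pos hgt (by rintro rfl; exact h₁ rfl))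

/-- A symmetric bilinear form whose associated quadratic form vanishes on the roots of an
irreducible root system is zero. -/
lemma bilin_eq_zero_of_apply_root_self_eq_zero [Finite ι] [P.IsCrystallographic]
    [P.IsIrreducible] [P.IsRootSystem] (b : M →ₗ[K] M →ₗ[K] K)
    (hb : ∀ x y, b x y = b y x) (h : ∀ i, b (P.root i) (P.root i) = 0) : b = 0 := by
  have key (i j : ι) (hij : P.pairing j i ≠ 0) : b (P.root i) (P.root j) = 0 := by
    by_cases h₁ : P.root j = P.root i
    · rw [h₁, h]
    by_cases h₂ : P.root j = -P.root i
    · rw [h₂, map_neg, h, neg_zero]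
    have hij' := hb (P.root i) (P.root j)
    have hi := h i
    have hj := h j
    rcases P.root_sub_or_add_mem_of_pairing_ne_zero hij h₁ h₂ with ⟨k, hk⟩ | ⟨k, hk⟩ <;>
    · have := h k
      simp only [hk, map_sub, map_add, LinearMap.sub_apply, LinearMap.add_apply] at this
      grind
  have hroot (i : ι) : b (P.root i) = 0 := by
    rw [← LinearMap.ker_eq_top, ← top_le_iff, ← P.span_root_pairing_ne_zero_eq_top i,
      Submodule.span_le]
    rintro - ⟨j, hj, rfl⟩
    exact key i j hj
  rw [← LinearMap.ker_eq_top, ← top_le_iff, ← IsRootSystem.span_root_eq_top (P := P),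
    Submodule.span_le]
  rintro - ⟨i, rfl⟩
  exact hroot i

lemma exists_pairing_ne_zero_of_one_lt_finrank [P.IsIrreducible]
    (hM : 1 < Module.finrank K M) (i : ι) :
    ∃ j, P.pairing j i ≠ 0 ∧ P.root j ≠ P.root i ∧ P.root j ≠ -P.root i := by
  by_contra! hcon
  have hle : Submodule.span K (P.root '' {j | P.pairing j i ≠ 0}) ≤ K ∙ P.root i := by
    rw [Submodule.span_le]
    rintro - ⟨j, hj, rfl⟩
    rw [SetLike.mem_coe]
    by_cases h : P.root j = P.root i
    · rw [h]; exact Submodule.mem_span_singleton_self _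
    · rw [hcon j hj h]; exact Submodule.neg_mem _ (Submodule.mem_span_singleton_self _)
  rw [P.span_root_pairing_ne_zero_eq_top, top_le_iff] at hle
  have := finrank_span_singleton (K := K) (P.ne_zero i)
  rw [hle, finrank_top] at this
  omega

end RootPairing

namespace LieAlgebra.IsKilling

open LieModule

section Basic

variable {K L : Type*} [Field K] [LieRing L] [LieAlgebra K L] [FiniteDimensional K L]
  {H : LieSubalgebra K L} [H.IsCartanSubalgebra]

lemma killingForm_cartan_rootSpace [IsTriangularizable K H L] (x : H) {γ : H → K}
    (hγ : γ ≠ 0) {y : L} (hy : y ∈ rootSpace H γ) : killingForm K L x y = 0 :=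
  killingForm_apply_eq_zero_of_mem_rootSpace_of_add_ne_zero K L H (α := 0)
    (by simp) hy (by simpa using hγ)

lemma killingForm_cartanEquivDual_symm [IsKilling K L] (φ : Module.Dual K H) (x : H) :
    killingForm K L x ((cartanEquivDual H).symm φ : H) = φ x := by
  rw [traceForm_comm]
  exact congr($((cartanEquivDual H).apply_symm_apply φ) x)

lemma lie_cartan_eq_zero [IsKilling K L] (x y : H) : ⁅(x : L), (y : L)⁆ = 0 := by
  simpa using congr_arg Subtype.val (trivial_lie_zero H H x y)

lemma induction_cartan_rootSpace [IsTriangularizable K H L] {p : L → Prop}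
    (cartan : ∀ x : H, p x)
    (root : ∀ γ : Weight K H L, γ.IsNonZero → ∀ x ∈ rootSpace H γ, p x)
    (add : ∀ x y, p x → p y → p (x + y)) (x : L) : p x := by
  have hx : x ∈ ⨆ β : Weight K H L, rootSpace H β := by simp [iSup_genWeightSpace_eq_top' K H L]
  induction hx using LieSubmodule.iSup_induction' with
  | mem β y hy =>
    by_cases hβ : β.IsZero
    · rw [hβ] at hy
      exact cartan ⟨y, by simpa using hy⟩
    · exact root β hβ y hy
  | zero => simpa using cartan 0
  | add y z _ _ hy hz => exact add y z hy hz

lemma exists_cartan_apply_ne_zero [CharZero K] :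
    ∃ x : H, ∀ γ : Weight K H L, γ.IsNonZero → γ x ≠ 0 := by
  obtain ⟨x, hx⟩ := Module.Dual.exists_forall_ne_zero_of_forall_exists
    (fun γ : H.root ↦ γ.1.toLinear) fun γ ↦ by
      by_contra! h
      exact H.isNonZero_coe_root γ (funext h)
  exact ⟨x, fun γ hγ ↦ hx ⟨γ, by simpa using hγ⟩⟩

lemma killingForm_rootSpace_cartan [IsTriangularizable K H L] (x : H) {γ : H → K}
    (hγ : γ ≠ 0) {y : L} (hy : y ∈ rootSpace H γ) : killingForm K L y x = 0 := by
  rw [traceForm_comm, killingForm_cartan_rootSpace x hγ hy]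

lemma eq_zero_of_forall_killingForm_eq_zero [IsKilling K L] [IsTriangularizable K H L] {x : L}
    (h₀ : ∀ y : H, killingForm K L x y = 0)
    (h : ∀ γ : Weight K H L, γ.IsNonZero → ∀ y ∈ rootSpace H γ, killingForm K L x y = 0) :
    x = 0 := by
  have hx : x ∈ LinearMap.ker (killingForm K L) := by
    rw [LinearMap.mem_ker]
    ext y
    induction y using induction_cartan_rootSpace (H := H) with
    | cartan y => exact h₀ y
    | root γ hγ y hy => exact h γ hγ y hy
    | add y z hy hz => simp_all
  simpa using hx

end Basic

variable {K L : Type*} [Field K] [CharZero K] [LieRing L] [LieAlgebra K L] [FiniteDimensional K L]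
  [IsKilling K L] {H : LieSubalgebra K L} [H.IsCartanSubalgebra] [IsTriangularizable K H L]

lemma lie_ne_zero_of_apply_coroot_pos {α β : Weight K H L} (hα : α.IsNonZero) {e f : L}
    {h : L} (ht : IsSl2Triple h e f) (he : e ∈ rootSpace H α) (hf : f ∈ rootSpace H (-α))
    {x : L} (hx : x ∈ rootSpace H β) (hx0 : x ≠ 0) {n : ℤ} (hn : 0 < n)
    (hβ : β (coroot α) = n) : ⁅f, x⁆ ≠ 0 := by
  intro h0
  have hh := ht.h_eq_coroot hα he hf
  have hp : ht.symm.HasPrimitiveVectorWith x (-(n : K)) :=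
    ⟨hx0, by
      have := lie_eq_smul_of_mem_rootSpace hx (coroot α)
      rw [LieSubalgebra.coe_bracket_of_module, ← hh, hβ] at this
      rw [neg_lie, this, neg_smul], h0⟩
  obtain ⟨m, hm⟩ := hp.exists_nat
  have : (-n : ℤ) = m := by exact_mod_cast hm
  omega

/-- In rank at least two, a linear functional on a simple Lie algebra that vanishes on all brackets
of root vectors `x ∈ L_β`, `y ∈ L_δ` with `β + δ = γ` vanishes on the root space `L_γ`. -/
lemma apply_eq_zero_of_forall_lie [IsSimple K L] (hrank : 1 < Module.finrank K H)
    {γ : Weight K H L} (hγ : γ.IsNonZero) (φ : L →ₗ[K] K)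
    (hφ : ∀ β δ : H → K, β ≠ 0 → δ ≠ 0 → β + δ = γ →
      ∀ x ∈ rootSpace H β, ∀ y ∈ rootSpace H δ, φ ⁅x, y⁆ = 0)
    {z : L} (hz : z ∈ rootSpace H γ) : φ z = 0 := by
  let P := rootSystem H
  have hγ' : γ ∈ H.root := by simpa using hγ
  have hrank' : 1 < Module.finrank K (Module.Dual K H) := by rwa [Subspace.dual_finrank_eq]
  obtain ⟨β, n, hn, hβ, hβγ⟩ : ∃ (β : Weight K H L) (n : ℤ), 0 < n ∧ β (coroot γ) = n ∧
      (β : H → K) ≠ γ := by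
    obtain ⟨⟨β, hβm⟩, hβ, h₁, h₂⟩ :=
      P.exists_pairing_ne_zero_of_one_lt_finrank hrank' ⟨γ, hγ'⟩
    have hc := (P.algebraMap_pairingIn ℤ ⟨β, hβm⟩ ⟨γ, hγ'⟩)
    set n := P.pairingIn ℤ ⟨β, hβm⟩ ⟨γ, hγ'⟩
    have hc' : β (coroot γ) = n := by simpa [P] using hc.symm
    rcases lt_trichotomy n 0 with hlt | h0 | hgt
    · refine ⟨-β, -n, by omega, by simp [hc'], fun h ↦ h₂ ?_⟩
      ext x
      have := congr_fun h x
      simp [P] at this ⊢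
      rw [← this, neg_neg]
    · rw [← hc, h0] at hβ; simp at hβ
    · refine ⟨β, n, hgt, hc', fun h ↦ h₁ ?_⟩
      ext x
      exact congr_fun h x
  obtain ⟨h, e, f, ht, he, hf⟩ := exists_isSl2Triple_of_weight_isNonZero hγ
  obtain ⟨x, hx, hx0⟩ := β.exists_ne_zero
  have hfx := lie_ne_zero_of_apply_coroot_pos hγ ht he hf hx hx0 hn hβ
  have hfx' : ⁅f, x⁆ ∈ rootSpace H (-γ + β : H → K) :=
    lie_mem_genWeightSpace_of_mem_genWeightSpace hf hx
  obtain ⟨y, hy, hxy⟩ : ∃ y ∈ rootSpace H (-(-γ + β : H → K)), killingForm K L ⁅f, x⁆ y ≠ 0 := by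
    contrapose! hfx
    simpa using mem_ker_killingForm_of_mem_rootSpace_of_forall_rootSpace_neg K L H hfx' hfx
  have hxy' : ⁅x, y⁆ ∈ rootSpace H γ := by
    have := lie_mem_genWeightSpace_of_mem_genWeightSpace hx hy
    simpa using this
  have hne : ⁅x, y⁆ ≠ 0 := by
    intro h0
    rw [traceForm_apply_lie_apply, h0, map_zero] at hxy
    exact hxy rfl
  have hβ0 : (β : H → K) ≠ 0 := by
    intro h
    rw [h, Pi.zero_apply] at hβ
    have : n = 0 := by exact_mod_cast hβ.symm
    omega
  have hzero := hφ β (-(-γ + β)) hβ0 (by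
    intro h
    apply hβγ
    rw [neg_eq_zero] at h
    exact (neg_add_eq_zero.mp h).symm) (by abel) x hx y hy
  obtain ⟨c, hc⟩ := (finrank_eq_one_iff_of_nonzero' (⟨⁅x, y⁆, hxy'⟩ : rootSpace H γ)
    (by simpa [Subtype.ext_iff] using hne)).mp (finrank_rootSpace_eq_one γ hγ) ⟨z, hz⟩
  have hc' : c • ⁅x, y⁆ = z := congr_arg Subtype.val hc
  rw [← hc', map_smul, hzero, smul_zero]

lemma lie_cartan_rootSpace (x : H) {γ : H → K} {y : L} (hy : y ∈ rootSpace H γ) :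
    ⁅(x : L), y⁆ = γ x • y :=
  lie_eq_smul_of_mem_rootSpace hy x

/-- For `X, Y, Z` in a Lie algebra, the form on `L` associated with the endomorphism
`Φ(X,Y) ∧ Z + Φ(Y,Z) ∧ X + Φ(Z,X) ∧ Y`. -/
noncomputable def cyclicWedgeForm (Φ : L →ₗ[K] L →ₗ[K] L) (X Y Z U V : L) : K :=
  (killingForm K L Z U * killingForm K L (Φ X Y) V
    - killingForm K L (Φ X Y) U * killingForm K L Z V)
  + (killingForm K L X U * killingForm K L (Φ Y Z) V
    - killingForm K L (Φ Y Z) U * killingForm K L X V)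
  + (killingForm K L Y U * killingForm K L (Φ Z X) V
    - killingForm K L (Φ Z X) U * killingForm K L Y V)

variable {Φ : L →ₗ[K] L →ₗ[K] L}

lemma cyclicWedgeForm_cartan [IsSimple K L] (hrank : 1 < Module.finrank K H)
    (hinner : ∀ X Y Z : L, ⁅X, Y⁆ = 0 → ⁅Y, Z⁆ = 0 → ⁅Z, X⁆ = 0 →
      ∃ W : L, ∀ U V : L, cyclicWedgeForm Φ X Y Z U V = killingForm K L W ⁅U, V⁆)
    (X Y Z U : H) (V : L) : cyclicWedgeForm Φ X Y Z U V = 0 := by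
  obtain ⟨W, hW⟩ := hinner X Y Z (lie_cartan_eq_zero X Y) (lie_cartan_eq_zero Y Z)
    (lie_cartan_eq_zero Z X)
  have hWγ {γ : Weight K H L} (hγ : γ.IsNonZero) {e : L} (he : e ∈ rootSpace H γ) :
      killingForm K L W e = 0 := by
    refine apply_eq_zero_of_forall_lie hrank hγ (killingForm K L W) ?_ he
    intro β δ hβ hδ _ x hx y hy
    rw [← hW]
    simp [cyclicWedgeForm, killingForm_cartan_rootSpace _ hβ hx,
      killingForm_cartan_rootSpace _ hδ hy]
  rw [hW]
  induction V using induction_cartan_rootSpace (H := H) with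
  | cartan y => rw [lie_cartan_eq_zero U y, map_zero]
  | root γ hγ y hy => rw [lie_cartan_rootSpace U hy, map_smul, hWγ hγ hy, smul_zero]
  | add y z hy hz => rw [lie_add, map_add, hy, hz, add_zero]

lemma killingForm_apply_cartanEquivDual_symm_eq_zero [IsSimple K L]
    (hrank : 1 < Module.finrank K H)
    (hinner : ∀ X Y Z : L, ⁅X, Y⁆ = 0 → ⁅Y, Z⁆ = 0 → ⁅Z, X⁆ = 0 →
      ∃ W : L, ∀ U V : L, cyclicWedgeForm Φ X Y Z U V = killingForm K L W ⁅U, V⁆)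
    {α : Weight K H L} (hα : α.IsNonZero) (X Y : H) (hX : α X = 0) (hY : α Y = 0) :
    killingForm K L (Φ X Y) ((cartanEquivDual H).symm α.toLinear : H) = 0 := by
  obtain ⟨h, e, f, ht, he, hf⟩ := exists_isSl2Triple_of_weight_isNonZero hα
  have hα0 : (α : H → K) ≠ 0 := hα
  have hα0' : (-α : H → K) ≠ 0 := neg_ne_zero.mpr hα0
  obtain ⟨W, hW⟩ := hinner X Y e (lie_cartan_eq_zero X Y)
    (by rw [lie_cartan_rootSpace Y he, hY, zero_smul])
    (by rw [← lie_skew, lie_cartan_rootSpace X he, hX, zero_smul, neg_zero])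
  have hWf : killingForm K L W f = 0 := by
    refine apply_eq_zero_of_forall_lie (γ := -α) hrank hα.neg (killingForm K L W) ?_ hf
    intro β δ hβ hδ hβδ x hx y hy
    rw [Weight.coe_neg] at hβδ
    have hex : killingForm K L e x = 0 :=
      killingForm_apply_eq_zero_of_mem_rootSpace_of_add_ne_zero K L H he hx <| by
        contrapose! hδ
        rw [add_comm, add_eq_zero_iff_eq_neg] at hδ
        simpa [hδ] using hβδ
    have hey : killingForm K L e y = 0 :=
      killingForm_apply_eq_zero_of_mem_rootSpace_of_add_ne_zero K L H he hy <| by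
        contrapose! hβ
        rw [add_comm, add_eq_zero_iff_eq_neg] at hβ
        simpa [hβ] using hβδ
    rw [← hW]
    simp [cyclicWedgeForm, killingForm_cartan_rootSpace _ hβ hx,
      killingForm_cartan_rootSpace _ hδ hy, hex, hey]
  have hef : killingForm K L e f ≠ 0 := by
    intro h0
    apply ht.h_ne_zero
    rw [← ht.lie_e_f, lie_eq_killingForm_smul_of_mem_rootSpace_of_mem_rootSpace_neg he hf, h0,
      zero_smul]
  have := hW ((cartanEquivDual H).symm α.toLinear : H) f
  rw [lie_cartan_rootSpace _ hf, map_smul, hWf, smul_zero] at this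
  simpa [cyclicWedgeForm, killingForm_cartan_rootSpace _ hα0' hf,
    killingForm_rootSpace_cartan _ hα0 he, killingForm_cartanEquivDual_symm, hX, hY, hef] using this

theorem apply_cartan_eq_zero [IsSimple K L] (hrank : 3 ≤ Module.finrank K H)
    (hΦ : ∀ X, Φ X X = 0)
    (hinner : ∀ X Y Z : L, ⁅X, Y⁆ = 0 → ⁅Y, Z⁆ = 0 → ⁅Z, X⁆ = 0 →
      ∃ W : L, ∀ U V : L, cyclicWedgeForm Φ X Y Z U V = killingForm K L W ⁅U, V⁆)
    (X Y : H) : Φ X Y = 0 := by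
  have hrank' : 1 < Module.finrank K H := by omega
  have hskew (A B : L) : Φ A B = -Φ B A := by
    have := hΦ (A + B)
    simp only [map_add, LinearMap.add_apply, hΦ, zero_add, add_zero] at this
    exact eq_neg_of_add_eq_zero_right this
  obtain ⟨φ, hφ0, hφX, hφY⟩ : ∃ φ : Module.Dual K H, φ ≠ 0 ∧ φ X = 0 ∧ φ Y = 0 := by
    have hlt : Submodule.span K {X, Y} < ⊤ := by
      refine lt_top_iff_ne_top.mpr fun htop ↦ ?_
      classical
      have hcard := finrank_span_finset_le_card (R := K) ({X, Y} : Finset H)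
      rw [Finset.coe_pair, Set.finrank, htop, finrank_top] at hcard
      have := Finset.card_le_two (a := X) (b := Y)
      omega
    obtain ⟨φ, hφ0, hφ⟩ := Submodule.exists_le_ker_of_lt_top _ hlt
    exact ⟨φ, hφ0, hφ (Submodule.subset_span (by simp)), hφ (Submodule.subset_span (by simp))⟩
  obtain ⟨Z, hZ⟩ : ∃ Z, φ Z ≠ 0 := by
    contrapose! hφ0
    exact LinearMap.ext hφ0
  set t := (cartanEquivDual H).symm with ht
  let κΦ (A B : H) : Module.Dual K (Module.Dual K H) :=
    (killingForm K L (Φ A B)) ∘ₗ H.toSubmodule.subtype ∘ₗ t.toLinearMap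
  let ev (A : H) : Module.Dual K (Module.Dual K H) := Module.Dual.eval K H A
  let b : Module.Dual K H →ₗ[K] Module.Dual K H →ₗ[K] K :=
    (ev X).smulRight (κΦ Y Z) + (ev Y).smulRight (κΦ Z X) + (ev Z).smulRight (κΦ X Y)
  have hb_apply (ψ χ : Module.Dual K H) : b ψ χ = ψ X * killingForm K L (Φ Y Z) (t χ : H)
      + ψ Y * killingForm K L (Φ Z X) (t χ : H) + ψ Z * killingForm K L (Φ X Y) (t χ : H) := rfl
  have hb : b = 0 := by
    refine (rootSystem H).bilin_eq_zero_of_apply_root_self_eq_zero b (fun ψ χ ↦ ?_) fun i ↦ ?_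
    · have := cyclicWedgeForm_cartan hrank' hinner X Y Z (t ψ) (t χ : H)
      simp only [cyclicWedgeForm, ht, killingForm_cartanEquivDual_symm] at this
      rw [hb_apply, hb_apply]
      linear_combination this
    · have hi : (i : Weight K H L).IsNonZero := H.isNonZero_coe_root i
      have key (A B C : H) : i.1 A * (i.1 A * killingForm K L (Φ B C) (t i.1.toLinear : H)
          + i.1 B * killingForm K L (Φ C A) (t i.1.toLinear : H)
          + i.1 C * killingForm K L (Φ A B) (t i.1.toLinear : H)) = 0 := by
        have := killingForm_apply_cartanEquivDual_symm_eq_zero hrank' hinner hi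
          (i.1 A • B - i.1 B • A) (i.1 A • C - i.1 C • A)
          (by simp [mul_comm]) (by simp [mul_comm])
        push_cast at this
        simp only [map_sub, map_smul, LinearMap.sub_apply, LinearMap.smul_apply, hΦ,
          hskew B A, hskew A C, map_neg, LinearMap.neg_apply, smul_eq_mul, map_zero,
          LinearMap.zero_apply] at this
        linear_combination this
      rw [hb_apply, rootSystem_root_apply]
      simp only [Weight.toLinear_apply]
      have h₁ := key X Y Z
      have h₂ := key Y Z X
      have h₃ := key Z X Y
      grind
  have hker : φ Z • Φ X Y = 0 := by
    refine eq_zero_of_forall_killingForm_eq_zero (H := H) (fun V ↦ ?_) fun γ hγ V hV ↦ ?_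
    · have := congr($hb φ (cartanEquivDual H V))
      simpa [hb_apply, hφX, hφY, ht] using this
    · have := cyclicWedgeForm_cartan hrank' hinner X Y Z (t φ) V
      simpa [cyclicWedgeForm, ht, killingForm_cartanEquivDual_symm, hφX, hφY,
        killingForm_cartan_rootSpace _ hγ hV] using this
  exact (smul_eq_zero.mp hker).resolve_left hZ

lemma exists_eq_cartan_add_lie {x₀ : H} (hx₀ : ∀ γ : Weight K H L, γ.IsNonZero → γ x₀ ≠ 0)
    (x : L) : ∃ (z : H) (v : L), x = z + ⁅v, (x₀ : L)⁆ := by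
  induction x using induction_cartan_rootSpace (H := H) with
  | cartan x => exact ⟨x, 0, by simp⟩
  | root γ hγ x hx =>
    refine ⟨0, -(γ x₀)⁻¹ • x, ?_⟩
    rw [← lie_skew, lie_smul, lie_cartan_rootSpace x₀ hx, smul_smul]
    simp [hx₀ γ hγ]
  | add x y hx hy =>
    obtain ⟨z, v, rfl⟩ := hx
    obtain ⟨z', v', rfl⟩ := hy
    exact ⟨z + z', v + v', by push_cast; rw [add_lie]; abel⟩

section Inner

variable {F : Submodule K (Module.End K L)}

lemma exists_sub_ad_apply_cartan_eq_zero
    (hF_ad : ∀ U, ad K L U ∈ F) (hF_lie : ∀ U, ∀ T ∈ F, ⁅ad K L U, T⁆ ∈ F)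
    (hF_cartan : ∀ T ∈ F, ∀ x y : H, killingForm K L (T x) y = 0)
    {T : Module.End K L} (hT : T ∈ F) :
    ∃ V : L, ∀ x : H, (T - ad K L V) x = 0 := by
  obtain ⟨x₀, hx₀⟩ := exists_cartan_apply_ne_zero (H := H)
  obtain ⟨z, V, hzV⟩ := exists_eq_cartan_add_lie hx₀ (T x₀)
  have hz : (z : L) = 0 := by
    refine eq_zero_of_forall_killingForm_eq_zero (H := H) (fun y ↦ ?_) fun γ hγ y hy ↦
      killingForm_cartan_rootSpace z hγ hy
    have := hF_cartan T hT x₀ y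
    rwa [hzV, map_add, LinearMap.add_apply, traceForm_apply_lie_apply, lie_cartan_eq_zero,
      map_zero, add_zero] at this
  refine ⟨V, fun x ↦ ?_⟩
  set S := T - ad K L V
  have hS : S ∈ F := F.sub_mem hT (hF_ad V)
  have hSx₀ : S x₀ = 0 := by simp [S, hzV, hz]
  refine eq_zero_of_forall_killingForm_eq_zero (H := H) (hF_cartan S hS x) fun γ hγ e he ↦ ?_
  have hrel (a b : H) :
      γ b * killingForm K L (S a) e = - (γ a * killingForm K L (S e) b) := by
    have := hF_cartan _ (hF_lie e S hS) a b
    simp only [LieRing.of_associative_ring_bracket, Module.End.mul_apply, LinearMap.sub_apply,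
      ad_apply, map_sub] at this
    rw [← lie_skew e (a : L), lie_cartan_rootSpace a he, traceForm_apply_lie_apply',
      ← lie_skew e (b : L), lie_cartan_rootSpace b he] at this
    simp only [map_neg, map_smul, LinearMap.neg_apply, LinearMap.smul_apply, smul_eq_mul] at this
    linear_combination this
  have h₁ := hrel x x₀
  have h₂ := hrel x₀ x₀
  rw [hSx₀, map_zero, LinearMap.zero_apply, mul_zero, zero_eq_neg] at h₂
  rw [(mul_eq_zero.mp h₂).resolve_left (hx₀ γ hγ), mul_zero, neg_zero] at h₁
  exact (mul_eq_zero.mp h₁).resolve_left (hx₀ γ hγ)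

lemma lie_cartan_apply_of_mem_rootSpace
    (hF_lie : ∀ U, ∀ T ∈ F, ⁅ad K L U, T⁆ ∈ F)
    (hF_skew : ∀ T ∈ F, ∀ x y, killingForm K L (T x) y = -killingForm K L x (T y))
    (hF_cartan : ∀ T ∈ F, ∀ x y : H, killingForm K L (T x) y = 0)
    {T : Module.End K L} (hT : T ∈ F) (hT₀ : ∀ x : H, T x = 0)
    {χ : H → K} {e : L} (he : e ∈ rootSpace H χ) (x : H) : ⁅(x : L), T e⁆ = χ x • T e := by
  by_cases he0 : e = 0
  · simp [he0]
  by_cases hχ : χ = 0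
  · subst hχ
    simp [hT₀ ⟨e, by simpa using he⟩]
  let α : Weight K H L := ⟨χ, fun h ↦ he0 (by simpa [h] using he)⟩
  have hα : α.IsNonZero := hχ
  have hαχ : (α : H → K) = χ := rfl
  have hdet {β : Weight K H L} {f : L} (hf : f ∈ rootSpace H β) (a b : H) :
      killingForm K L (T e) f * (χ a * β b - β a * χ b) = 0 := by
    have := hF_cartan _ (hF_lie f _ (hF_lie e T hT)) a b
    simp only [LieRing.of_associative_ring_bracket, Module.End.mul_apply, LinearMap.sub_apply,
      ad_apply, map_sub, hT₀, lie_zero, zero_sub] at this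
    rw [← lie_skew e (a : L), ← lie_skew f (a : L), lie_cartan_rootSpace a he,
      lie_cartan_rootSpace a hf] at this
    simp only [map_neg, map_smul, lie_neg, lie_smul, LinearMap.neg_apply, LinearMap.smul_apply,
      smul_eq_mul, traceForm_apply_lie_apply', hF_skew T hT ⁅e, f⁆, hT₀, map_zero] at this
    rw [← lie_skew e (b : L), ← lie_skew f (b : L), lie_cartan_rootSpace b he,
      lie_cartan_rootSpace b hf] at this
    simp only [map_neg, map_smul, smul_eq_mul, hF_skew T hT f e,
      traceForm_comm K L L f (T e)] at this
    linear_combination this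
  have horth {β : Weight K H L} (hβ : β.IsNonZero) (hβα : (β : H → K) ≠ -χ) {f : L}
      (hf : f ∈ rootSpace H β) : killingForm K L (T e) f = 0 := by
    by_cases hβα' : β = α
    · subst hβα'
      obtain ⟨c, hc⟩ := (finrank_eq_one_iff_of_nonzero' (⟨e, he⟩ : rootSpace H α)
        (by simpa [Subtype.ext_iff] using he0)).mp (finrank_rootSpace_eq_one α hα) ⟨f, hf⟩
      have hc' : c • e = f := congr_arg Subtype.val hc
      have := hF_skew T hT e e
      rw [traceForm_comm K L L e, self_eq_neg] at this
      rw [← hc', map_smul, this, smul_zero]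
    · by_contra hne
      obtain ⟨a, ha⟩ : ∃ a, χ a ≠ 0 := Function.ne_iff.mp hχ
      have hprop : (β : H → K) = (β a / χ a) • (α : H → K) := by
        ext b
        have := (mul_eq_zero.mp (hdet hf a b)).resolve_left hne
        rw [Pi.smul_apply, smul_eq_mul, hαχ]
        field_simp
        linear_combination this
      rcases eq_neg_or_eq_of_eq_smul α β hβ _ hprop with h | h
      · exact hβα (by rw [h, Weight.coe_neg, hαχ])
      · exact hβα' h
  rw [← sub_eq_zero]
  refine eq_zero_of_forall_killingForm_eq_zero (H := H) (fun y ↦ ?_) fun β hβ f hf ↦ ?_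
  · simp [traceForm_apply_lie_apply', lie_cartan_eq_zero, hF_skew T hT e, hT₀]
  · rw [map_sub, map_smul, LinearMap.sub_apply, LinearMap.smul_apply, traceForm_apply_lie_apply',
      lie_cartan_rootSpace x hf, map_smul, smul_eq_mul, smul_eq_mul]
    by_cases h : (β : H → K) = -χ
    · rw [h, Pi.neg_apply]; ring
    · rw [horth hβ h hf]; ring

/-- Let `F` be a space of skew endomorphisms of `L` which contains the inner derivations and is
stable under bracketing with them. If `⟨T x, y⟩ = 0` for all `T ∈ F` and all `x`, `y` in some Cartan
subalgebra, then `F` consists of inner derivations. -/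
theorem exists_eq_ad_of_forall_killingForm_cartan_eq_zero
    (hF_ad : ∀ U, ad K L U ∈ F) (hF_lie : ∀ U, ∀ T ∈ F, ⁅ad K L U, T⁆ ∈ F)
    (hF_skew : ∀ T ∈ F, ∀ x y, killingForm K L (T x) y = -killingForm K L x (T y))
    (hF_cartan : ∀ T ∈ F, ∀ x y : H, killingForm K L (T x) y = 0)
    {T : Module.End K L} (hT : T ∈ F) : ∃ V, T = ad K L V := by
  obtain ⟨V₀, hV₀⟩ := exists_sub_ad_apply_cartan_eq_zero hF_ad hF_lie hF_cartan hT
  set S := T - ad K L V₀ with hS_def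
  have hS : S ∈ F := F.sub_mem hT (hF_ad V₀)
  have hweight {T : Module.End K L} (hT : T ∈ F) (hT₀ : ∀ x : H, T x = 0) {χ : H → K} {e : L}
      (he : e ∈ rootSpace H χ) (x : H) : ⁅(x : L), T e⁆ = χ x • T e :=
    lie_cartan_apply_of_mem_rootSpace hF_lie hF_skew hF_cartan hT hT₀ he x
  have hleibniz (a b : L) : S ⁅a, b⁆ = ⁅a, S b⁆ - ⁅b, S a⁆ := by
    induction a using induction_cartan_rootSpace (H := H) with
    | cartan x =>
      induction b using induction_cartan_rootSpace (H := H) with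
      | cartan y => simp [lie_cartan_eq_zero, hV₀]
      | root β hβ f hf =>
        rw [lie_cartan_rootSpace x hf, hweight hS hV₀ hf, hV₀, map_smul, lie_zero, sub_zero]
      | add b c hb hc => simp only [lie_add, add_lie, map_add, hb, hc]; abel
    | root α hα e he =>
      let D := ⁅ad K L e, S⁆ + ad K L (S e)
      have hD_apply (b : L) : D b = ⁅e, S b⁆ - S ⁅e, b⁆ + ⁅S e, b⁆ := rfl
      have hD : D ∈ F := F.add_mem (hF_lie e S hS) (hF_ad _)
      have hD₀ (x : H) : D x = 0 := by
        rw [hD_apply, hV₀, lie_zero, ← lie_skew e, lie_cartan_rootSpace x he, ← lie_skew (S e),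
          hweight hS hV₀ he]
        simp
      have hD_zero : D b = 0 := by
        induction b using induction_cartan_rootSpace (H := H) with
        | cartan y => exact hD₀ y
        | root β hβ f hf =>
          obtain ⟨x, hx⟩ : ∃ x, α x ≠ 0 := Function.ne_iff.mp hα
          have h₁ := hweight hD hD₀ hf x
          have hef : ⁅e, f⁆ ∈ rootSpace H (α + β : H → K) :=
            lie_mem_genWeightSpace_of_mem_genWeightSpace he hf
          have h₂ : ⁅(x : L), D f⁆ = (α x + β x) • D f := by
            rw [hD_apply, lie_add, lie_sub, leibniz_lie, leibniz_lie (x : L) (S e),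
              hweight hS hV₀ hef, hweight hS hV₀ he, hweight hS hV₀ hf,
              lie_cartan_rootSpace x he, lie_cartan_rootSpace x hf]
            simp only [smul_lie, lie_smul, Pi.add_apply]
            module
          rw [h₁, add_smul, right_eq_add, smul_eq_zero] at h₂
          exact h₂.resolve_left hx
        | add b c hb hc => rw [map_add, hb, hc, add_zero]
      rw [hD_apply, ← lie_skew (S e)] at hD_zero
      rw [← sub_eq_zero, ← neg_eq_zero, ← hD_zero]
      abel
    | add a c ha hc => simp only [lie_add, add_lie, map_add, ha, hc]; abel
  obtain ⟨V, hV⟩ := LieDerivation.IsKilling.exists_eq_ad (R := K) (L := L) ⟨S, hleibniz⟩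
  refine ⟨V + V₀, ?_⟩
  have hSV : S = ad K L V := by
    ext x
    simpa using congr($hV x).symm
  rw [map_add, ← hSV, hS_def, sub_add_cancel]

end Inner

section Cyclic

attribute [local instance] LieRing.ofAssociativeRing

variable {K L : Type*} [Field K] [LieRing L] [LieAlgebra K L]

lemma wedge_apply (X Y Z : L) :
    wedge K L X Y Z = killingForm K L Y Z • X - killingForm K L X Z • Y := by
  simp only [wedge, LinearMap.sub_apply, LinearMap.smulRight_apply, LinearMap.neg_apply, neg_smul]
  abel

lemma lie_ad_wedge (U X Y : L) :
    ⁅ad K L U, wedge K L X Y⁆ = wedge K L ⁅U, X⁆ Y + wedge K L X ⁅U, Y⁆ := by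
  ext Z
  simp only [LieRing.of_associative_ring_bracket, LinearMap.sub_apply, Module.End.mul_apply,
    LinearMap.add_apply, wedge_apply, ad_apply, lie_sub, lie_smul,
    LieModule.traceForm_apply_lie_apply', neg_smul]
  abel

/-- The summand of the cyclic identity, without its inner part. -/
noncomputable def cyclicTerm (A : L →ₗ[K] Module.End K L) (Φ : L →ₗ[K] L →ₗ[K] L) (X Y Z : L) :
    Module.End K L :=
  ⁅ad K L ⁅X, Y⁆, A Z⁆ + wedge K L (Φ X Y) Z

/-- The pairs `(A, Φ)` for which the cyclic sum of `cyclicTerm A Φ` is an inner derivation. -/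
structure IsCyclicInner (A : L →ₗ[K] Module.End K L) (Φ : L →ₗ[K] L →ₗ[K] L) : Prop where
  apply_self : ∀ X, Φ X X = 0
  exists_eq_ad : ∀ X Y Z, ∃ W,
    cyclicTerm A Φ X Y Z + cyclicTerm A Φ Y Z X + cyclicTerm A Φ Z X Y = ad K L W

variable {A : L →ₗ[K] Module.End K L} {Φ : L →ₗ[K] L →ₗ[K] L}

lemma cyclicTerm_lie (U X Y Z : L) :
    cyclicTerm (ad K (Module.End K L) (ad K L U) ∘ₗ A - A ∘ₗ ad K L U) ⁅U, Φ⁆ X Y Z =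
      ⁅ad K L U, cyclicTerm A Φ X Y Z⁆ - cyclicTerm A Φ ⁅U, X⁆ Y Z - cyclicTerm A Φ X ⁅U, Y⁆ Z -
        cyclicTerm A Φ X Y ⁅U, Z⁆ := by
  have h1 : ⁅ad K L U, ⁅ad K L ⁅X, Y⁆, A Z⁆⁆ = ⁅ad K L ⁅⁅U, X⁆, Y⁆, A Z⁆ +
      ⁅ad K L ⁅X, ⁅U, Y⁆⁆, A Z⁆ + ⁅ad K L ⁅X, Y⁆, ⁅ad K L U, A Z⁆⁆ := by
    rw [leibniz_lie, ← LieHom.map_lie, leibniz_lie U X Y, map_add, add_lie]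
  have h2 : wedge K L (⁅U, Φ⁆ X Y) Z = wedge K L ⁅U, Φ X Y⁆ Z - wedge K L (Φ ⁅U, X⁆ Y) Z -
      wedge K L (Φ X ⁅U, Y⁆) Z := by
    ext V
    simp only [LieHom.lie_apply, LinearMap.sub_apply, wedge_apply, map_sub, smul_sub, sub_smul]
    abel
  simp only [cyclicTerm, h2, lie_add, h1, lie_ad_wedge, LinearMap.sub_apply, LinearMap.comp_apply,
    ad_apply, lie_sub]
  abel

lemma IsCyclicInner.lie (h : IsCyclicInner A Φ) (U : L) :
    IsCyclicInner (ad K (Module.End K L) (ad K L U) ∘ₗ A - A ∘ₗ ad K L U) ⁅U, Φ⁆ where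
  apply_self X := by
    have h1 := h.apply_self (⁅U, X⁆ + X)
    simp only [map_add, LinearMap.add_apply, h.apply_self, zero_add, add_zero] at h1
    simp only [LieHom.lie_apply, LinearMap.sub_apply, h.apply_self, lie_zero, zero_sub]
    rw [← neg_eq_zero, ← h1]
    abel
  exists_eq_ad X Y Z := by
    obtain ⟨W, hW⟩ := h.exists_eq_ad X Y Z
    obtain ⟨W₁, hW₁⟩ := h.exists_eq_ad ⁅U, X⁆ Y Z
    obtain ⟨W₂, hW₂⟩ := h.exists_eq_ad X ⁅U, Y⁆ Z
    obtain ⟨W₃, hW₃⟩ := h.exists_eq_ad X Y ⁅U, Z⁆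
    refine ⟨⁅U, W⁆ - W₁ - W₂ - W₃, ?_⟩
    simp only [map_sub, LieHom.map_lie, ← hW, ← hW₁, ← hW₂, ← hW₃, cyclicTerm_lie, lie_add]
    abel

lemma IsCyclicInner.exists_cyclicWedgeForm_eq (h : IsCyclicInner A Φ) (X Y Z : L)
    (hXY : ⁅X, Y⁆ = 0) (hYZ : ⁅Y, Z⁆ = 0) (hZX : ⁅Z, X⁆ = 0) :
    ∃ W, ∀ U V, cyclicWedgeForm Φ X Y Z U V = killingForm K L W ⁅U, V⁆ := by
  obtain ⟨W, hW⟩ := h.exists_eq_ad X Y Z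
  refine ⟨W, fun U V ↦ ?_⟩
  have h1 := congr(killingForm K L ($hW U) V)
  simp only [cyclicTerm, hXY, hYZ, hZX, map_zero, zero_lie, zero_add, LinearMap.add_apply,
    wedge_apply, map_add, map_sub, LinearMap.sub_apply, map_smul, LinearMap.smul_apply,
    smul_eq_mul, ad_apply, LieModule.traceForm_apply_lie_apply] at h1
  rw [← h1, cyclicWedgeForm]

/-- `T` is the endomorphism with `⟨T X, Y⟩ = ⟨Φ X Y, W⟩`. -/
def IsContraction (Φ : L →ₗ[K] L →ₗ[K] L) (W : L) (T : Module.End K L) : Prop :=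
  ∀ X Y, killingForm K L (T X) Y = killingForm K L (Φ X Y) W

lemma exists_isContraction [FiniteDimensional K L] [IsKilling K L]
    (Φ : L →ₗ[K] L →ₗ[K] L) (W : L) : ∃ T, IsContraction Φ W T := by
  let e := (killingForm K L).toDual (killingForm_nondegenerate K L)
  refine ⟨e.symm.toLinearMap ∘ₗ Φ.compr₂ ((killingForm K L).flip W), fun X Y ↦ ?_⟩
  have h1 (f : Module.Dual K L) : killingForm K L (e.symm f) Y = f Y := by
    rw [← LinearMap.BilinForm.toDual_def (killingForm_nondegenerate K L)]
    exact congr($(e.apply_symm_apply f) Y)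
  rw [LinearMap.comp_apply, LinearEquiv.coe_coe, h1]
  simp

lemma IsContraction.lie_sub {W : L} {T T' : Module.End K L} (hT : IsContraction Φ W T) {U : L}
    (hT' : IsContraction ⁅U, Φ⁆ W T') : IsContraction Φ ⁅U, W⁆ (⁅ad K L U, T⁆ - T') := by
  intro X Y
  simp only [LieRing.of_associative_ring_bracket, LinearMap.sub_apply, Module.End.mul_apply,
    map_sub, ad_apply, hT' X Y, LieModule.traceForm_apply_lie_apply', hT _ _, LieHom.lie_apply]
  ring

/-- The span of the inner derivations and of the contractions of all `Φ` occurring in a pair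
satisfying `IsCyclicInner`. -/
def contractionSpan (K L : Type*) [Field K] [LieRing L] [LieAlgebra K L] :
    Submodule K (Module.End K L) :=
  Submodule.span K (Set.range (ad K L) ∪
    {T | ∃ A Φ W, IsCyclicInner A Φ ∧ IsContraction Φ W T})

lemma lie_ad_mem_contractionSpan [FiniteDimensional K L] [IsKilling K L] (U : L)
    {T : Module.End K L}
    (hT : T ∈ contractionSpan K L) : ⁅ad K L U, T⁆ ∈ contractionSpan K L := by
  induction hT using Submodule.span_induction with
  | mem T hT =>
    rcases hT with ⟨V, rfl⟩ | ⟨A, Φ, W, h, hT⟩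
    · exact Submodule.subset_span (Or.inl ⟨⁅U, V⁆, LieHom.map_lie _ _ _⟩)
    · obtain ⟨T', hT'⟩ := exists_isContraction ⁅U, Φ⁆ W
      rw [← sub_add_cancel ⁅ad K L U, T⁆ T']
      exact add_mem (Submodule.subset_span (Or.inr ⟨A, Φ, _, h, hT.lie_sub hT'⟩))
        (Submodule.subset_span (Or.inr ⟨_, _, W, h.lie U, hT'⟩))
  | zero => simp
  | add _ _ _ _ h₁ h₂ => rw [lie_add]; exact add_mem h₁ h₂
  | smul _ _ _ h => rw [lie_smul]; exact Submodule.smul_mem _ _ h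

lemma killingForm_apply_of_mem_contractionSpan {T : Module.End K L}
    (hT : T ∈ contractionSpan K L) (X Y : L) :
    killingForm K L (T X) Y = -killingForm K L X (T Y) := by
  induction hT using Submodule.span_induction with
  | mem T hT =>
    rcases hT with ⟨V, rfl⟩ | ⟨A, Φ, W, h, hT⟩
    · simp only [ad_apply, LieModule.traceForm_apply_lie_apply']
    · have h1 := h.apply_self (X + Y)
      simp only [map_add, LinearMap.add_apply, h.apply_self, zero_add, add_zero] at h1
      rw [LieModule.traceForm_comm K L L X, hT, hT, eq_neg_of_add_eq_zero_right h1, map_neg,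
        LinearMap.neg_apply]
  | zero => simp
  | add _ _ _ _ h₁ h₂ => simp only [LinearMap.add_apply, map_add, h₁, h₂]; ring
  | smul _ _ _ h => simp only [LinearMap.smul_apply, map_smul, h, smul_neg]

end Cyclic

lemma killingForm_cartan_of_mem_contractionSpan [IsSimple K L]
    (hrank : 3 ≤ Module.finrank K H) {T : Module.End K L}
    (hT : T ∈ contractionSpan K L) (X Y : H) : killingForm K L (T X) Y = 0 := by
  induction hT using Submodule.span_induction with
  | mem T hT =>
    rcases hT with ⟨V, rfl⟩ | ⟨A, Φ, W, h, hT⟩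
    · rw [ad_apply, LieModule.traceForm_apply_lie_apply, lie_cartan_eq_zero, map_zero]
    · rw [hT, apply_cartan_eq_zero hrank h.apply_self h.exists_cyclicWedgeForm_eq, map_zero,
        LinearMap.zero_apply]
  | zero => simp
  | add _ _ _ _ h₁ h₂ => simp [h₁, h₂]
  | smul _ _ _ h => simp [h]

theorem IsCyclicInner.apply_eq_zero [IsSimple K L] (hrank : 3 ≤ Module.finrank K H)
    {A : L →ₗ[K] Module.End K L} (h : IsCyclicInner A Φ) {X Y : L} (hXY : ⁅X, Y⁆ = 0) :
    Φ X Y = 0 := by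
  suffices hker : ∀ W, killingForm K L (Φ X Y) W = 0 from
    eq_zero_of_forall_killingForm_eq_zero (H := H) (fun W ↦ hker W) fun _ _ W _ ↦ hker W
  intro W
  obtain ⟨T, hT⟩ := exists_isContraction Φ W
  obtain ⟨V, rfl⟩ := exists_eq_ad_of_forall_killingForm_cartan_eq_zero (H := H)
    (F := contractionSpan K L) (fun U ↦ Submodule.subset_span (Or.inl ⟨U, rfl⟩))
    (fun U T hT ↦ lie_ad_mem_contractionSpan U hT)
    (fun T hT ↦ killingForm_apply_of_mem_contractionSpan hT)
    (fun T hT ↦ killingForm_cartan_of_mem_contractionSpan (H := H) hrank hT)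
    (Submodule.subset_span (Or.inr ⟨A, Φ, W, h, hT⟩))
  rw [← hT, ad_apply, LieModule.traceForm_apply_lie_apply, hXY, map_zero]

end LieAlgebra.IsKilling

theorem stmt_12 (g : Type*) [LieRing g] [LieAlgebra ℂ g] [Module.Finite ℂ g]
    [LieAlgebra.IsSimple ℂ g]
    (K : g →ₗ[ℂ] Module.End ℂ g)
    (hskew : ∀ Z X Y : g, ip ℂ g (K Z X) Y + ip ℂ g X (K Z Y) = 0)
    (htr : ∀ Z U : g, LinearMap.trace ℂ g (K Z ∘ₗ ad ℂ g U) = 0)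
    (Φ : g →ₗ[ℂ] g →ₗ[ℂ] g)
    (hΦalt : ∀ X : g, Φ X X = 0)
    (hi : ∀ X Y Z : g, ip ℂ g (Φ X Y) Z + ip ℂ g (Φ Y Z) X + ip ℂ g (Φ Z X) Y = 0)
    (hii : ∀ X Y Z : g,
      (⁅ad ℂ g ⁅X, Y⁆, K Z⁆ + ad ℂ g ⁅K X Y - K Y X, Z⁆ + wedge ℂ g (Φ X Y) Z)
      + (⁅ad ℂ g ⁅Y, Z⁆, K X⁆ + ad ℂ g ⁅K Y Z - K Z Y, X⁆ + wedge ℂ g (Φ Y Z) X)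
      + (⁅ad ℂ g ⁅Z, X⁆, K Y⁆ + ad ℂ g ⁅K Z X - K X Z, Y⁆ + wedge ℂ g (Φ Z X) Y) = 0)
    (hrank : ∃ h : LieSubalgebra ℂ g, h.IsCartanSubalgebra ∧ 3 ≤ Module.finrank ℂ h) :
    ∀ X Y : g, ⁅X, Y⁆ = 0 → Φ X Y = 0 := by
  obtain ⟨H, hH, hrank⟩ := hrank
  intro X Y hXY
  refine IsKilling.IsCyclicInner.apply_eq_zero (H := H) (A := K) hrank ⟨hΦalt, fun X Y Z ↦
    ⟨-(⁅K X Y - K Y X, Z⁆ + ⁅K Y Z - K Z Y, X⁆ + ⁅K Z X - K X Z, Y⁆), ?_⟩⟩ hXY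
  rw [← sub_eq_zero, ← hii X Y Z]
  simp only [IsKilling.cyclicTerm, map_neg, map_add]
  abel
end
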